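/- Let G be a finitely generated virtually polycyclic group. Then: (1) if G is virtually cyclic, M_SFT(G) = {0_M}; (2) if G is not virtually cyclic, then M_SFT(G) equals the set of all Π⁰₁ Medvedev degrees. -/

import Mathlib

namespace MedvedevFormal

/-! ### Medvedev reducibility on Baire space -/

/-- The finite prefix of length `k` of a point of Baire space, as a list. -/
def pref (x : ℕ → ℕ) (k : ℕ) : List ℕ := (List.range k).map x

/-- Medvedev reducibility `m(P) ≤ m(Q)` between subsets of Baire space: some computable
monotone prefix-functional (i.e. a partial computable type-two functional), defined on all
of `Q`, maps every element of `Q` to an element of `P`. -/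
def BaireLE (P Q : Set (ℕ → ℕ)) : Prop :=
  ∃ φ : List ℕ → List ℕ, Computable φ ∧
    (∀ l₁ l₂ : List ℕ, l₁ <+: l₂ → φ l₁ <+: φ l₂) ∧
    ∀ x ∈ Q, ∃ y ∈ P, ∀ n : ℕ, ∃ k : ℕ, (φ (pref x k))[n]? = some (y n)

/-- Medvedev equivalence: `m(P) = m(Q)`. -/
def BaireEquiv (P Q : Set (ℕ → ℕ)) : Prop := BaireLE P Q ∧ BaireLE Q P

/-- A canonical representative of the join `m(P) ∨ m(Q)`. -/
def joinSet (P Q : Set (ℕ → ℕ)) : Set (ℕ → ℕ) :=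
  {x | (fun n => x (2 * n)) ∈ P ∧ (fun n => x (2 * n + 1)) ∈ Q}

/-- A canonical representative of the meet `m(P) ∧ m(Q)`. -/
def meetSet (P Q : Set (ℕ → ℕ)) : Set (ℕ → ℕ) :=
  {x | (x 0 = 0 ∧ (fun n => x (n + 1)) ∈ P) ∨ (x 0 = 1 ∧ (fun n => x (n + 1)) ∈ Q)}

/-- `P` has the zero Medvedev degree `0_M`: it contains a computable point. -/
def IsZeroDeg (P : Set (ℕ → ℕ)) : Prop := ∃ y ∈ P, Computable y

/-- The cylinder of a finite word in Baire space. -/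
def cylinder (l : List ℕ) : Set (ℕ → ℕ) :=
  {x | ∀ (i : ℕ) (h : i < l.length), x i = l[i]}

/-- Cantor space `{0,1}^ℕ` inside Baire space. -/
def cantorSpace : Set (ℕ → ℕ) := {x | ∀ n, x n ≤ 1}

/-- `P` is an effectively closed (`Π⁰₁`) subset of Cantor space: its complement within
Cantor space is the union of the cylinders of a computably enumerable sequence of words. -/
def IsPi01Cantor (P : Set (ℕ → ℕ)) : Prop :=
  ∃ f : ℕ → List ℕ, Computable f ∧ P = cantorSpace \ ⋃ n, cylinder (f n)

/-- The Medvedev degree of `P` is a `Π⁰₁` Medvedev degree. -/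
def IsPi01Deg (P : Set (ℕ → ℕ)) : Prop :=
  ∃ Q, IsPi01Cantor Q ∧ Q.Nonempty ∧ BaireEquiv P Q

/-- `P` realizes the maximal `Π⁰₁` Medvedev degree (the degree of the class of complete
consistent extensions of Peano arithmetic): it is a nonempty `Π⁰₁` subset of Cantor space
to which every nonempty `Π⁰₁` subset of Cantor space is Medvedev reducible. -/
def IsMaxPi01 (P : Set (ℕ → ℕ)) : Prop :=
  IsPi01Cantor P ∧ P.Nonempty ∧ ∀ Q, IsPi01Cantor Q → Q.Nonempty → BaireLE Q P

/-! ### Encoding of configuration spaces -/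

/-- The canonical encoding of a configuration `x : α → A` as a point of Baire space. -/
def confFun {α A : Type*} [Encodable α] [Encodable A] (x : α → A) : ℕ → ℕ :=
  fun n => Encodable.encode ((Encodable.decode (α := α) n).map x)

/-- The image of a set of configurations in Baire space, used to measure its
Medvedev degree. -/
def mSet {α A : Type*} [Encodable α] [Encodable A] (X : Set (α → A)) : Set (ℕ → ℕ) :=
  confFun '' X

/-- A configuration is computable if its Baire-space encoding is computable. -/
def ComputablePoint {α A : Type*} [Encodable α] [Encodable A] (x : α → A) : Prop :=
  Computable (confFun x)

/-- `m(X) ≤ m(Y)` for sets of configurations. -/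
def MedLE {α A β B : Type*} [Encodable α] [Encodable A] [Encodable β] [Encodable B]
    (X : Set (α → A)) (Y : Set (β → B)) : Prop :=
  BaireLE (mSet X) (mSet Y)

/-- `m(X) = m(Y)` for sets of configurations. -/
def MedEquiv {α A β B : Type*} [Encodable α] [Encodable A] [Encodable β] [Encodable B]
    (X : Set (α → A)) (Y : Set (β → B)) : Prop :=
  MedLE X Y ∧ MedLE Y X

/-! ### Subshifts -/

/-- The left shift action: `(g • x) h = x (g⁻¹ h)`. -/
def shift {G A : Type*} [Group G] (g : G) (x : G → A) : G → A := fun h => x (g⁻¹ * h)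

/-- The prodiscrete topology on `A^G`. -/
def prodiscrete (G A : Type*) : TopologicalSpace (G → A) :=
  @Pi.topologicalSpace G (fun _ => A) fun _ => ⊥

/-- A subshift: a shift-invariant subset of `A^G`, closed in the prodiscrete topology. -/
def IsSubshift {G A : Type*} [Group G] (X : Set (G → A)) : Prop :=
  (∀ x ∈ X, ∀ g : G, shift g x ∈ X) ∧ @IsClosed (G → A) (prodiscrete G A) X

/-- A pattern: a map `p : D → A` with `D ⊆ G` finite. -/
structure Pattern (G A : Type*) where
  dom : Finset G
  val : {g // g ∈ dom} → A

/-- The translate `g • x` agrees with the pattern `p` on its domain. -/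
def MatchesAt {G A : Type*} [Group G] (p : Pattern G A) (g : G) (x : G → A) : Prop :=
  ∀ h : {g' // g' ∈ p.dom}, shift g x h = p.val h

/-- A subshift of finite type: defined by a finite list of forbidden patterns. -/
def IsSFT {G A : Type*} [Group G] (X : Set (G → A)) : Prop :=
  ∃ F : List (Pattern G A), X = {x | ∀ p ∈ F, ∀ g : G, ¬MatchesAt p g x}

/-- A morphism between subshifts: a continuous shift-equivariant map from `X` to `Y`. -/
def IsMorphism {G A B : Type*} [Group G] (X : Set (G → A)) (Y : Set (G → B))
    (φ : (G → A) → (G → B)) : Prop :=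
  Set.MapsTo φ X Y ∧
    @ContinuousOn (G → A) (G → B) (prodiscrete G A) (prodiscrete G B) φ X ∧
    ∀ x ∈ X, ∀ g : G, φ (shift g x) = shift g (φ x)

/-- A sofic subshift: the image of an SFT (on some finite alphabet) under a topological
factor map. -/
def IsSofic {G A : Type*} [Group G] (X : Set (G → A)) : Prop :=
  ∃ (B : Type) (_ : Finite B) (Y : Set (G → B)) (φ : (G → B) → (G → A)),
    IsSFT Y ∧ IsMorphism Y X φ ∧ φ '' Y = X

/-! ### Finitely generated groups, covers and pullbacks -/

/-- `σ` enumerates a finite symmetric generating set of `G`. -/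
def IsSymmGen {G : Type*} [Group G] {k : ℕ} (σ : Fin k → G) : Prop :=
  Subgroup.closure (Set.range σ) = ⊤ ∧ ∀ i, (σ i)⁻¹ ∈ Set.range σ

/-- The canonical encoding of a free group via reduced words. -/
instance freeGroupEncodable {α : Type*} [DecidableEq α] [Encodable α] :
    Encodable (FreeGroup α) :=
  Encodable.ofLeftInjection FreeGroup.toWord (fun l => some (FreeGroup.mk l))
    fun _ => congrArg some FreeGroup.mk_toWord

/-- The canonical homomorphism from the free group determined by `σ`. -/
def cover {G : Type*} [Group G] {k : ℕ} (σ : Fin k → G) : FreeGroup (Fin k) →* G :=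
  FreeGroup.lift σ

/-- The pullback of a subshift along a group homomorphism. -/
def pullback {K G A : Type*} [Group K] [Group G] (ρ : K →* G) (X : Set (G → A)) :
    Set (K → A) :=
  (fun x => x ∘ ρ) '' X

/-- The group element represented by a word over the generators. -/
def wordVal {G : Type*} [Group G] {k : ℕ} (σ : Fin k → G) (w : List (Fin k × Bool)) : G :=
  cover σ (FreeGroup.mk w)

/-- `G` is recursively presented w.r.t. `σ`: its word problem is recursively enumerable. -/
def RecursivelyPresented {G : Type*} [Group G] {k : ℕ} (σ : Fin k → G) : Prop :=
  ∃ f : ℕ → Option (List (Fin k × Bool)), Computable f ∧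
    ∀ w : List (Fin k × Bool), (wordVal σ w = 1 ↔ ∃ n, f n = some w)

/-- The membership problem of the subgroup `H` in `G` is decidable w.r.t. `σ`. -/
def DecidableMembership {G : Type*} [Group G] {k : ℕ} (σ : Fin k → G)
    (H : Subgroup G) : Prop :=
  ∃ φ : List (Fin k × Bool) → Bool, Computable φ ∧
    ∀ w : List (Fin k × Bool), (φ w = true ↔ wordVal σ w ∈ H)

/-- `G` has decidable word problem w.r.t. `σ`. -/
def DecidableWordProblem {G : Type*} [Group G] {k : ℕ} (σ : Fin k → G) : Prop :=
  ∃ φ : List (Fin k × Bool) → Bool, Computable φ ∧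
    ∀ w : List (Fin k × Bool), (φ w = true ↔ wordVal σ w = 1)

/-- The set of configurations on the free group matching a coded pattern: a pattern is
coded as a list of pairs (code of a group element, code of a letter). -/
def codedCylinder {k : ℕ} {A : Type*} [Encodable A] (p : List (ℕ × ℕ)) :
    Set (FreeGroup (Fin k) → A) :=
  {x | ∀ q ∈ p, ∀ g : FreeGroup (Fin k),
    Encodable.encode g = q.1 → Encodable.encode (x g) = q.2}

/-- `X` is an effective subshift: the complement of its pullback to the free group is the
union of the cylinders of a computably enumerable sequence of finitely supported patterns. -/
def IsEffective {G : Type*} [Group G] {k : ℕ} (σ : Fin k → G) {A : Type*} [Encodable A]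
    (X : Set (G → A)) : Prop :=
  ∃ f : ℕ → List (ℕ × ℕ), Computable f ∧
    (pullback (cover σ) X)ᶜ = ⋃ n, codedCylinder (f n)

/-! ### Degree spectra -/

/-- The Medvedev degree of `P` belongs to `M_SFT(G)`: some nonempty `G`-SFT has the
Medvedev degree of `P`. -/
def IsSFTDeg {G : Type*} [Group G] {k : ℕ} (σ : Fin k → G) (P : Set (ℕ → ℕ)) : Prop :=
  ∃ (n : ℕ) (X : Set (G → Fin n)), IsSFT X ∧ X.Nonempty ∧
    BaireEquiv (mSet (pullback (cover σ) X)) P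

/-- The Medvedev degree of `P` belongs to `M_sof(G)`. -/
def IsSoficDeg {G : Type*} [Group G] {k : ℕ} (σ : Fin k → G) (P : Set (ℕ → ℕ)) : Prop :=
  ∃ (n : ℕ) (X : Set (G → Fin n)), IsSofic X ∧ X.Nonempty ∧
    BaireEquiv (mSet (pullback (cover σ) X)) P

/-- The Medvedev degree of `P` belongs to `M_eff(G)`. -/
def IsEffDeg {G : Type*} [Group G] {k : ℕ} (σ : Fin k → G) (P : Set (ℕ → ℕ)) : Prop :=
  ∃ (n : ℕ) (X : Set (G → Fin n)), IsSubshift X ∧ IsEffective σ X ∧ X.Nonempty ∧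
    BaireEquiv (mSet (pullback (cover σ) X)) P

/-! ### Word metrics and quasi-isometries -/

/-- The word length of `g` w.r.t. the (symmetric) generating map `σ`. -/
noncomputable def wordNorm {G : Type*} [Group G] {k : ℕ} (σ : Fin k → G) (g : G) : ℕ :=
  sInf {n | ∃ w : List (Fin k), w.length = n ∧ (w.map σ).prod = g}

/-- The word metric on `G` w.r.t. `σ`, as a real number. -/
noncomputable def wordDist {G : Type*} [Group G] {k : ℕ} (σ : Fin k → G) (g g' : G) : ℝ :=
  (wordNorm σ (g⁻¹ * g') : ℝ)

/-- `f : G → H` is a quasi-isometry w.r.t. the word metrics given by `σ` and `τ`. -/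
def IsQIGroups {G H : Type*} [Group G] [Group H] {k r : ℕ} (σ : Fin k → G)
    (τ : Fin r → H) (f : G → H) : Prop :=
  ∃ C : ℝ, 1 ≤ C ∧
    (∀ g g' : G, (1 / C) * wordDist σ g g' - C ≤ wordDist τ (f g) (f g') ∧
      wordDist τ (f g) (f g') ≤ C * wordDist σ g g' + C) ∧
    ∀ h : H, ∃ g : G, wordDist τ h (f g) ≤ C

/-- `f : G → Y` is a quasi-isometry from the group `G` (with word metric from `σ`) to the
metric space `Y`. -/
def IsQIToSpace {G : Type*} [Group G] {k : ℕ} (σ : Fin k → G) {Y : Type*}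
    [MetricSpace Y] (f : G → Y) : Prop :=
  ∃ C : ℝ, 1 ≤ C ∧
    (∀ g g' : G, (1 / C) * wordDist σ g g' - C ≤ dist (f g) (f g') ∧
      dist (f g) (f g') ≤ C * wordDist σ g g' + C) ∧
    ∀ y : Y, ∃ g : G, dist y (f g) ≤ C

/-- `f : G → H` is computable w.r.t. the generating maps `σ` and `τ`: some computable map
on words sends each word representing `g` to a word representing `f g`. -/
def ComputableMap {G H : Type*} [Group G] [Group H] {k r : ℕ} (σ : Fin k → G)
    (τ : Fin r → H) (f : G → H) : Prop :=
  ∃ φ : List (Fin k × Bool) → List (Fin r × Bool), Computable φ ∧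
    ∀ w : List (Fin k × Bool), wordVal τ (φ w) = f (wordVal σ w)

/-- `K` is normal in `L` and the quotient `L/K` is cyclic (stated without forming the
quotient group). -/
def CyclicQuotientStep {G : Type*} [Group G] (K L : Subgroup G) : Prop :=
  K ≤ L ∧ (∀ x ∈ L, ∀ y ∈ K, x * y * x⁻¹ ∈ K) ∧
    ∃ g ∈ L, ∀ x ∈ L, ∃ m : ℤ, (g ^ m)⁻¹ * x ∈ K

/-- A group is polycyclic if it has a subnormal series with cyclic quotients. -/
def IsPolycyclic (G : Type*) [Group G] : Prop :=
  ∃ (n : ℕ) (s : Fin (n + 1) → Subgroup G),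
    s 0 = ⊥ ∧ s (Fin.last n) = ⊤ ∧
    ∀ i : Fin n, CyclicQuotientStep (s i.castSucc) (s i.succ)

end MedvedevFormal

namespace MedvedevFormal

/-! ### Computability of list operations -/

section ListComp

variable {α β γ δ : Type*} [Primcodable α] [Primcodable β] [Primcodable γ] [Primcodable δ]

theorem computable_list_foldl {f : α → List β} {g : α → γ} {h : α → γ × β → γ}
    (hf : Computable f) (hg : Computable g) (hh : Computable₂ h) :
    Computable fun a => (f a).foldl (fun s b => h a (s, b)) (g a) := by
  have hstep : Computable₂ fun (a : α) (p : ℕ × γ) =>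
      Option.casesOn (motive := fun _ => γ) ((f a)[p.1]?) p.2 (fun b => h a (p.2, b)) := by
    refine Computable.option_casesOn
      (Computable.list_getElem?.comp (hf.comp Computable.fst) (Computable.fst.comp Computable.snd))
      (Computable.snd.comp Computable.snd) ?_
    exact hh.comp (Computable.fst.comp Computable.fst)
      (Computable.pair (Computable.snd.comp (Computable.snd.comp Computable.fst)) Computable.snd)
  refine (Computable.nat_rec (Computable.list_length.comp hf) hg hstep).of_eq fun a => ?_
  have key : ∀ k ≤ (f a).length, (Nat.rec (g a) (fun y IH =>
      Option.casesOn (motive := fun _ => γ) ((f a)[(y, IH).1]?) (y, IH).2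
        (fun b => h a ((y, IH).2, b))) k : γ) =
      ((f a).take k).foldl (fun s b => h a (s, b)) (g a) := by
    intro k
    induction k with
    | zero => intro _; simp
    | succ k ih =>
      intro hk
      have hk' : k < (f a).length := hk
      simp only [ih hk'.le, List.take_add_one, List.foldl_append, List.getElem?_eq_getElem hk']
      simp
  rw [key _ le_rfl, List.take_length]

theorem computable_list_map {f : α → List β} {g : α → β → γ}
    (hf : Computable f) (hg : Computable₂ g) : Computable fun a => (f a).map (g a) := by
  have := computable_list_foldl (h := fun a (p : List γ × β) => p.1 ++ [g a p.2]) hf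
    (Computable.const ([] : List γ))
    (Computable.list_concat.comp (Computable.fst.comp Computable.snd)
      (hg.comp Computable.fst (Computable.snd.comp Computable.snd)))
  refine this.of_eq fun a => ?_
  have : ∀ (l : List β) (s : List γ),
      l.foldl (fun s b => s ++ [g a b]) s = s ++ l.map (g a) := by
    intro l; induction l with
    | nil => simp
    | cons b l ih => intro s; simp [ih]
  simp [this]

theorem computable_list_flatMap {f : α → List β} {g : α → β → List γ}
    (hf : Computable f) (hg : Computable₂ g) : Computable fun a => (f a).flatMap (g a) :=
  (Primrec.list_flatten.to_comp.comp (computable_list_map hf hg)).of_eq fun a => by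
    simp [List.flatMap_def]

theorem computable_and {f g : α → Bool} (hf : Computable f) (hg : Computable g) :
    Computable fun a => f a && g a := Primrec.and.to_comp.comp hf hg

theorem computable_or {f g : α → Bool} (hf : Computable f) (hg : Computable g) :
    Computable fun a => f a || g a := Primrec.or.to_comp.comp hf hg

theorem computable_not {f : α → Bool} (hf : Computable f) :
    Computable fun a => !f a := Primrec.not.to_comp.comp hf

theorem computable_list_all {f : α → List β} {p : α → β → Bool}
    (hf : Computable f) (hp : Computable₂ p) : Computable fun a => (f a).all (p a) := by
  have := computable_list_foldl (h := fun a (q : Bool × β) => q.1 && p a q.2) hf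
    (Computable.const true)
    (computable_and (Computable.fst.comp Computable.snd)
      (hp.comp Computable.fst (Computable.snd.comp Computable.snd)))
  refine this.of_eq fun a => ?_
  have : ∀ (l : List β) (s : Bool), l.foldl (fun s b => s && p a b) s = (s && l.all (p a)) := by
    intro l; induction l with
    | nil => simp
    | cons b l ih => intro s; simp [ih, Bool.and_assoc]
  simp [this]

theorem computable_list_any {f : α → List β} {p : α → β → Bool}
    (hf : Computable f) (hp : Computable₂ p) : Computable fun a => (f a).any (p a) :=
  (computable_not (computable_list_all hf (computable_not hp).to₂)).of_eq fun a => by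
    simp [List.all_eq_not_any_not]

theorem computable_decide_eq [DecidableEq β] {f g : α → β} (hf : Computable f)
    (hg : Computable g) : Computable fun a => decide (f a = g a) :=
  (Primrec.eq.decide (α := β)).to_comp.comp hf hg |>.of_eq fun a => by simp

theorem computable_decide_le {f g : α → ℕ} (hf : Computable f)
    (hg : Computable g) : Computable fun a => decide (f a ≤ g a) :=
  (Primrec.nat_le.decide).to_comp.comp hf hg |>.of_eq fun a => by simp

theorem computable_decide_lt {f g : α → ℕ} (hf : Computable f)
    (hg : Computable g) : Computable fun a => decide (f a < g a) :=
  (Primrec.nat_lt.decide).to_comp.comp hf hg |>.of_eq fun a => by simp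

theorem computable_nat_find {p : α → ℕ → Bool} (hp : Computable₂ p)
    (h : ∀ a, ∃ n, p a n = true) : Computable fun a => Nat.find (h a) := by
  have h1 : Partrec fun a => Nat.rfind (p a : ℕ →. Bool) := Partrec.rfind hp.partrec₂
  refine h1.of_eq_tot fun a => ?_
  refine Nat.mem_rfind.2 ⟨?_, fun {m} hm => ?_⟩
  · simpa using (Nat.find_spec (h a)).symm
  · simpa using (Nat.find_min (h a) hm)

end ListComp

/-! ### Medvedev reducibility -/

theorem pref_length (x : ℕ → ℕ) (k : ℕ) : (pref x k).length = k := by simp [pref]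

theorem pref_getElem? (x : ℕ → ℕ) (k i : ℕ) :
    (pref x k)[i]? = if i < k then some (x i) else none := by
  unfold pref; split_ifs with h
  · simp [h]
  · simpa using h

theorem pref_take (x : ℕ → ℕ) {j k : ℕ} (h : j ≤ k) : (pref x k).take j = pref x j := by
  simp [pref, ← List.map_take, List.take_range, h]

theorem pref_prefix (x : ℕ → ℕ) {j k : ℕ} (h : j ≤ k) : pref x j <+: pref x k := by
  rw [← pref_take x h]; exact List.take_prefix _ _

theorem pref_getD (x : ℕ → ℕ) {k i : ℕ} (h : i < k) (d : ℕ) : (pref x k).getD i d = x i := by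
  rw [List.getD_eq_getElem?_getD, pref_getElem?, if_pos h]; rfl

theorem getElem?_of_prefix {α : Type*} {l₁ l₂ : List α} (h : l₁ <+: l₂) {n : ℕ} {v : α}
    (hv : l₁[n]? = some v) : l₂[n]? = some v := by
  obtain ⟨t, rfl⟩ := h
  have hn : n < l₁.length := (List.getElem?_eq_some_iff.1 hv).1
  rw [List.getElem?_append_left hn, hv]

theorem BaireLE.trans {P Q R : Set (ℕ → ℕ)} (h₁ : BaireLE P Q) (h₂ : BaireLE Q R) :
    BaireLE P R := by
  obtain ⟨φ, hφ, mφ, cφ⟩ := h₁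
  obtain ⟨θ, hθ, mθ, cθ⟩ := h₂
  refine ⟨fun l => φ (θ l), hφ.comp hθ, fun _ _ h => mφ _ _ (mθ _ _ h), fun x hx => ?_⟩
  obtain ⟨y, hy, hxy⟩ := cθ x hx
  obtain ⟨z, hz, hyz⟩ := cφ y hy
  refine ⟨z, hz, fun n => ?_⟩
  obtain ⟨k, hk⟩ := hyz n
  have hpre : ∃ j, pref y k <+: θ (pref x j) := by
    choose f hf using hxy
    refine ⟨(Finset.range k).sup f, ?_⟩
    rw [List.prefix_iff_getElem?]
    intro i hi
    have hi' := hi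
    rw [pref_length] at hi'
    rw [getElem?_of_prefix (mθ _ _ (pref_prefix x
      (Finset.le_sup (f := f) (Finset.mem_range.2 hi')))) (hf i)]
    simp [pref]
  obtain ⟨j, hj⟩ := hpre
  exact ⟨j, getElem?_of_prefix (mφ _ _ hj) hk⟩

/-- The prefix functional obtained from a family of approximations `ψ l n` to the `n`-th
output from the input prefix `l`. -/
def stageFun (ψ : List ℕ → ℕ → Option ℕ) (l : List ℕ) : List ℕ :=
  Nat.rec [] (fun k out => Option.casesOn (motive := fun _ => List ℕ)
    (ψ (l.take (k + 1)) out.length) out (fun v => out ++ [v])) l.length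

/-- To reduce `P` to `Q` it suffices to give a computable family of partial guesses at the values
of the output which are eventually always defined and never wrong. -/
theorem baireLE_of_stage {P Q : Set (ℕ → ℕ)} (ψ : List ℕ → ℕ → Option ℕ) (hψ : Computable₂ ψ)
    (h : ∀ x ∈ Q, ∃ y ∈ P, (∀ k n v, ψ (pref x k) n = some v → v = y n) ∧
      ∀ n, ∃ k₀, ∀ k ≥ k₀, (ψ (pref x k) n).isSome) : BaireLE P Q := by
  refine ⟨stageFun ψ, ?_, ?_, ?_⟩
  · have hstep : Computable₂ fun (l : List ℕ) (p : ℕ × List ℕ) =>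
        Option.casesOn (motive := fun _ => List ℕ) (ψ (l.take (p.1 + 1)) p.2.length) p.2
          (fun v => p.2 ++ [v]) := ?_
    · exact Computable.nat_rec Computable.list_length (Computable.const ([] : List ℕ)) hstep
    refine Computable.option_casesOn ?_ (Computable.snd.comp Computable.snd) ?_
    · exact hψ.comp (Primrec.list_take.to_comp.comp
        (Computable.succ.comp (Computable.fst.comp Computable.snd)) Computable.fst)
        (Computable.list_length.comp (Computable.snd.comp Computable.snd))
    · exact Computable.list_concat.comp
        (Computable.snd.comp (Computable.snd.comp Computable.fst)) Computable.snd
  · rintro l₁ l₂ ⟨t, rfl⟩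
    induction t using List.reverseRecOn with
    | nil => simp
    | append_singleton t a ih =>
      refine ih.trans ?_
      rw [← List.append_assoc]
      set l := l₁ ++ t
      have e : stageFun ψ (l ++ [a]) = Option.casesOn (motive := fun _ => List ℕ)
          (ψ (l ++ [a]) (stageFun ψ l).length) (stageFun ψ l) (fun v => stageFun ψ l ++ [v]) := by
        have e2 : ∀ k ≤ l.length, (Nat.rec [] (fun k out => Option.casesOn
            (motive := fun _ => List ℕ) (ψ ((l ++ [a]).take (k + 1)) out.length) out
            (fun v => out ++ [v])) k : List ℕ) = Nat.rec [] (fun k out => Option.casesOn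
            (motive := fun _ => List ℕ) (ψ (l.take (k + 1)) out.length) out
            (fun v => out ++ [v])) k := by
          intro k
          induction k with
          | zero => simp
          | succ k ih =>
            intro hk
            simp only [ih (Nat.le_of_succ_le hk)]
            rw [List.take_append_of_le_length hk]
        unfold stageFun
        rw [List.length_append, List.length_singleton, ← e2 l.length le_rfl]
        simp [List.take_of_length_le]
      rw [e]
      cases ψ (l ++ [a]) (stageFun ψ l).length <;> simp
  · intro x hx
    obtain ⟨y, hy, hc, he⟩ := h x hx
    refine ⟨y, hy, ?_⟩
    have hs : ∀ k, stageFun ψ (pref x (k + 1)) = Option.casesOn (motive := fun _ => List ℕ)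
        (ψ (pref x (k + 1)) (stageFun ψ (pref x k)).length) (stageFun ψ (pref x k))
        (fun v => stageFun ψ (pref x k) ++ [v]) := by
      have e2 : ∀ n k, k ≤ n → (Nat.rec [] (fun k out => Option.casesOn
          (motive := fun _ => List ℕ) (ψ ((pref x n).take (k + 1)) out.length) out
          (fun v => out ++ [v])) k : List ℕ) = Nat.rec [] (fun k out => Option.casesOn
          (motive := fun _ => List ℕ) (ψ (pref x (k + 1)) out.length) out
          (fun v => out ++ [v])) k := by
        intro n k
        induction k with
        | zero => simp
        | succ k ih =>
          intro hk
          simp only [ih (Nat.le_of_succ_le hk), pref_take x hk]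
      intro k
      unfold stageFun
      rw [pref_length, pref_length, e2 k k le_rfl]
      exact e2 (k + 1) (k + 1) le_rfl
    have hp : ∀ k, ∃ m, stageFun ψ (pref x k) = pref y m := by
      intro k
      induction k with
      | zero => exact ⟨0, by simp [stageFun, pref]⟩
      | succ k ih =>
        obtain ⟨m, hm⟩ := ih
        rw [hs, hm, pref_length]
        cases hv : ψ (pref x (k + 1)) m with
        | none => exact ⟨m, rfl⟩
        | some v =>
          refine ⟨m + 1, ?_⟩
          rw [hc _ _ _ hv]
          simp [pref, List.range_succ]
    have hl : ∀ n, ∃ k, n < (stageFun ψ (pref x k)).length := by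
      intro n
      induction n with
      | zero =>
        by_contra! hcon
        obtain ⟨k₀, hk₀⟩ := he 0
        have h1 := hk₀ (k₀ + 1) (by lia)
        have h2 := hs k₀
        have h3 := hcon (k₀ + 1)
        rw [Nat.le_zero.1 (hcon k₀)] at h2
        obtain ⟨v, hv⟩ := Option.isSome_iff_exists.1 h1
        rw [h2, hv] at h3
        simp at h3
      | succ n ih =>
        by_contra! hcon
        obtain ⟨k₁, hk₁⟩ := ih
        obtain ⟨k₀, hk₀⟩ := he (n + 1)
        have hmono : ∀ k, (stageFun ψ (pref x k)).length ≤
            (stageFun ψ (pref x (k + 1))).length := by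
          intro k; rw [hs k]
          cases ψ (pref x (k + 1)) (stageFun ψ (pref x k)).length <;> simp
        have hmono' := monotone_nat_of_le_succ hmono
        have h0 : (stageFun ψ (pref x (max k₀ k₁))).length = n + 1 :=
          le_antisymm (hcon _) (hk₁.trans_le (hmono' (le_max_right _ _)))
        have h1 := hk₀ (max k₀ k₁ + 1) (by lia)
        have h2 := hs (max k₀ k₁)
        have h3 := hcon (max k₀ k₁ + 1)
        obtain ⟨v, hv⟩ := Option.isSome_iff_exists.1 h1
        rw [h0] at h2
        rw [h2, hv] at h3
        simp [h0] at h3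
    intro n
    obtain ⟨k, hk⟩ := hl n
    obtain ⟨m, hm⟩ := hp k
    rw [hm, pref_length] at hk
    exact ⟨k, by rw [hm, pref_getElem?, if_pos hk]⟩

/-- A reduction given by a computable functional with a computable use function. -/
theorem baireLE_of_use {P Q : Set (ℕ → ℕ)} (g : List ℕ → ℕ → ℕ) (hg : Computable₂ g)
    (u : ℕ → ℕ) (hu : Computable u)
    (h : ∀ x ∈ Q, ∃ y ∈ P, ∀ n, g (pref x (u n)) n = y n) : BaireLE P Q := by
  refine baireLE_of_stage (fun l n => bif decide (u n ≤ l.length) then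
    some (g (l.take (u n)) n) else none) ?_ ?_
  · refine Computable.cond (computable_decide_le (hu.comp Computable.snd)
      (Computable.list_length.comp Computable.fst)) ?_ (Computable.const none)
    exact Computable.option_some.comp (hg.comp (Primrec.list_take.to_comp.comp
      (hu.comp Computable.snd) Computable.fst) Computable.snd)
  · intro x hx
    obtain ⟨y, hy, hxy⟩ := h x hx
    refine ⟨y, hy, fun k n v => ?_, fun n => ⟨u n, fun k hk => ?_⟩⟩
    · rw [pref_length]
      by_cases hk : u n ≤ k
      · simp only [hk, decide_true, cond_true, Option.some.injEq, pref_take x hk, hxy]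
        exact fun h => h.symm
      · simp [hk]
    · have hk' : u n ≤ k := hk
      simp [pref_length, hk']

theorem baireLE_of_computable_mem {P Q : Set (ℕ → ℕ)} (h : IsZeroDeg P) : BaireLE P Q := by
  obtain ⟨y, hy, hc⟩ := h
  exact baireLE_of_use (fun _ n => y n) (hc.comp Computable.snd) (fun _ => 0)
    (Computable.const 0) fun x _ => ⟨y, hy, fun _ => rfl⟩

theorem IsZeroDeg.of_baireLE {P Q : Set (ℕ → ℕ)} (h : BaireLE P Q) (hQ : IsZeroDeg Q) :
    IsZeroDeg P := by
  obtain ⟨x, hx, hc⟩ := hQ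
  obtain ⟨φ, hφ, mφ, hcφ⟩ := h
  obtain ⟨y, hy, hxy⟩ := hcφ x hx
  refine ⟨y, hy, ?_⟩
  have hpref : Computable (pref x) :=
    (computable_list_map (f := List.range) (g := fun _ b => x b) Primrec.list_range.to_comp
      (hc.comp Computable.snd))
  have hq : Computable₂ fun n k => (φ (pref x k))[n]? :=
    Computable.list_getElem?.comp (hφ.comp (hpref.comp Computable.snd)) Computable.fst
  have := Partrec.rfindOpt hq
  refine this.of_eq_tot fun n => ?_
  obtain ⟨k, hk⟩ := hxy n
  have hdom : (Nat.rfindOpt fun k => (φ (pref x k))[n]?).Dom := Nat.rfindOpt_dom.2 ⟨k, y n, hk⟩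
  obtain ⟨j, hj⟩ := Nat.rfindOpt_spec (Part.get_mem hdom)
  have e : (Nat.rfindOpt fun k => (φ (pref x k))[n]?).get hdom = y n := by
    have h1 := getElem?_of_prefix (mφ _ _ (pref_prefix x (le_max_left j k))) hj
    have h2 := getElem?_of_prefix (mφ _ _ (pref_prefix x (le_max_right j k))) hk
    exact Option.some.inj (h1.symm.trans h2)
  exact e ▸ Part.get_mem hdom

end MedvedevFormal

namespace MedvedevFormal

/-! ### Words over a tuple of group elements -/

section Words

variable {G : Type*} [Group G] {k r : ℕ}

theorem wordVal_eq_prod (σ : Fin k → G) (w : List (Fin k × Bool)) :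
    wordVal σ w = (w.map fun p => cond p.2 (σ p.1) (σ p.1)⁻¹).prod := by
  simp [wordVal, cover]

theorem wordVal_nil (σ : Fin k → G) : wordVal σ [] = 1 := by simp [wordVal_eq_prod]

theorem wordVal_append (σ : Fin k → G) (v w : List (Fin k × Bool)) :
    wordVal σ (v ++ w) = wordVal σ v * wordVal σ w := by simp [wordVal_eq_prod]

/-- The formal inverse of a word. -/
def invWord (w : List (Fin k × Bool)) : List (Fin k × Bool) :=
  FreeGroup.invRev w

theorem wordVal_invWord (σ : Fin k → G) (w : List (Fin k × Bool)) :
    wordVal σ (invWord w) = (wordVal σ w)⁻¹ := by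
  rw [wordVal, wordVal, invWord, ← map_inv, FreeGroup.inv_mk]

theorem primrec_invWord : Primrec (invWord (k := k)) :=
  Primrec.list_reverse.comp (Primrec.list_map Primrec.id
    (Primrec.pair (Primrec.fst.comp Primrec.snd)
      (Primrec.not.comp (Primrec.snd.comp Primrec.snd))).to₂)

theorem wordVal_flatMap (τ : Fin r → G) (φ : G → G) (h1 : φ 1 = 1)
    (hmul : ∀ x y, φ (x * y) = φ x * φ y)
    (sub : Fin r × Bool → List (Fin r × Bool))
    (hsub : ∀ l, wordVal τ (sub l) = φ (wordVal τ [l])) (w : List (Fin r × Bool)) :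
    wordVal τ (w.flatMap sub) = φ (wordVal τ w) := by
  induction w with
  | nil => simp [wordVal_nil, h1]
  | cons a w ih =>
    rw [List.flatMap_cons, wordVal_append, ih, hsub, ← hmul, ← wordVal_append]; rfl

theorem wordVal_mem {τ : Fin r → G} {L : Subgroup G} (h : ∀ i, τ i ∈ L)
    (w : List (Fin r × Bool)) : wordVal τ w ∈ L := by
  rw [wordVal_eq_prod]
  refine L.list_prod_mem fun x hx => ?_
  obtain ⟨⟨i, b⟩, -, rfl⟩ := List.mem_map.1 hx
  cases b
  · exact L.inv_mem (h i)
  · exact h i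

theorem exists_wordVal_eq {τ : Fin r → G} {x : G} (hx : x ∈ Subgroup.closure (Set.range τ)) :
    ∃ w, wordVal τ w = x := by
  induction hx using Subgroup.closure_induction with
  | mem x hx => obtain ⟨i, rfl⟩ := hx; exact ⟨[(i, true)], by simp [wordVal_eq_prod]⟩
  | one => exact ⟨[], wordVal_nil τ⟩
  | mul x y _ _ hx hy =>
    obtain ⟨v, rfl⟩ := hx
    obtain ⟨w, rfl⟩ := hy
    exact ⟨v ++ w, wordVal_append τ v w⟩
  | inv x _ hx =>
    obtain ⟨v, rfl⟩ := hx
    exact ⟨invWord v, wordVal_invWord τ v⟩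

theorem exists_tuple_of_fg {L : Subgroup G} (h : L.FG) :
    ∃ (r : ℕ) (ν : Fin r → G), Subgroup.closure (Set.range ν) = L := by
  obtain ⟨S, rfl⟩ := h
  exact ⟨S.card, fun i => (S.equivFin.symm i : G), by
    congr 1
    ext x
    constructor
    · rintro ⟨i, rfl⟩; exact (S.equivFin.symm i).2
    · intro hx; exact ⟨S.equivFin ⟨x, hx⟩, by simp⟩⟩

end Words

/-! ### Decidability of membership -/

section Membership

variable {G : Type*} [Group G] {k r : ℕ}

/-- The rewriting automaton which reads a word and produces a state and a word over another
alphabet. -/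
def rewriteFold {S : Type} (s₀ : S) (v₀ : List (Fin r × Bool)) (step : S × (Fin k × Bool) → S)
    (pre ext : S × (Fin k × Bool) → List (Fin r × Bool))
    (sub : (Fin k × Bool) × (Fin r × Bool) → List (Fin r × Bool)) (w : List (Fin k × Bool)) :
    S × List (Fin r × Bool) :=
  w.foldl (fun p l => (step (p.1, l),
    pre (p.1, l) ++ p.2.flatMap (fun b => sub (l, b)) ++ ext (p.1, l))) (s₀, v₀)

theorem rewriteFold_nil {S : Type} (s₀ : S) (v₀ : List (Fin r × Bool)) (step : S × (Fin k × Bool) → S)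
    (pre ext : S × (Fin k × Bool) → List (Fin r × Bool))
    (sub : (Fin k × Bool) × (Fin r × Bool) → List (Fin r × Bool)) :
    rewriteFold s₀ v₀ step pre ext sub [] = (s₀, v₀) := rfl

theorem rewriteFold_concat {S : Type} (s₀ : S) (v₀ : List (Fin r × Bool)) (step : S × (Fin k × Bool) → S)
    (pre ext : S × (Fin k × Bool) → List (Fin r × Bool))
    (sub : (Fin k × Bool) × (Fin r × Bool) → List (Fin r × Bool)) (w : List (Fin k × Bool))
    (l : Fin k × Bool) :
    rewriteFold s₀ v₀ step pre ext sub (w ++ [l]) =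
      (step ((rewriteFold s₀ v₀ step pre ext sub w).1, l),
        pre ((rewriteFold s₀ v₀ step pre ext sub w).1, l) ++
        (rewriteFold s₀ v₀ step pre ext sub w).2.flatMap (fun b => sub (l, b)) ++
        ext ((rewriteFold s₀ v₀ step pre ext sub w).1, l)) := by
  simp [rewriteFold]

theorem computable_rewriteFold {S : Type} [Primcodable S] {s₀ : S} {v₀ : List (Fin r × Bool)}
    {step : S × (Fin k × Bool) → S}
    {pre ext : S × (Fin k × Bool) → List (Fin r × Bool)}
    {sub : (Fin k × Bool) × (Fin r × Bool) → List (Fin r × Bool)}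
    (hstep : Primrec step) (hpre : Primrec pre) (hext : Primrec ext) :
    Primrec (rewriteFold s₀ v₀ step pre ext sub) := by
  have hsub : Primrec sub := Primrec.dom_finite sub
  refine Primrec.list_foldl Primrec.id (Primrec.const (s₀, v₀)) (h := fun _ q =>
    (step (q.1.1, q.2), pre (q.1.1, q.2) ++ q.1.2.flatMap (fun b => sub (q.2, b)) ++
      ext (q.1.1, q.2))) ?_
  have h1 : Primrec fun (x : List (Fin k × Bool) × ((S × List (Fin r × Bool)) × (Fin k × Bool))) =>
      (x.2.1.1, x.2.2) :=
    Primrec.pair (Primrec.fst.comp (Primrec.fst.comp Primrec.snd))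
      (Primrec.snd.comp Primrec.snd)
  refine Primrec.pair (hstep.comp h1) (Primrec.list_append.comp (Primrec.list_append.comp
    (hpre.comp h1) (Primrec.list_flatMap (Primrec.snd.comp (Primrec.fst.comp Primrec.snd)) ?_))
    (hext.comp h1))
  exact hsub.comp (Primrec.pair (Primrec.snd.comp (Primrec.snd.comp Primrec.fst)) Primrec.snd)

theorem decidableMembership_of_fold {S : Type} [Primcodable S] {τ : Fin k → G}
    {ν : Fin r → G} {H H' : Subgroup G} (hν : DecidableMembership ν H') {s₀ : S} {v₀ : List (Fin r × Bool)}
    {step : S × (Fin k × Bool) → S}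
    {pre ext : S × (Fin k × Bool) → List (Fin r × Bool)}
    {sub : (Fin k × Bool) × (Fin r × Bool) → List (Fin r × Bool)}
    (hstep : Primrec step) (hpre : Primrec pre) (hext : Primrec ext)
    {fin : S → List (Fin r × Bool)} {good : S → Bool} (hfin : Primrec fin) (hgood : Primrec good)
    (h : ∀ w, (wordVal τ w ∈ H ↔ good (rewriteFold s₀ v₀ step pre ext sub w).1 = true ∧
      wordVal ν ((rewriteFold s₀ v₀ step pre ext sub w).2 ++
        fin (rewriteFold s₀ v₀ step pre ext sub w).1) ∈ H')) :
    DecidableMembership τ H := by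
  obtain ⟨φ, hφ, hs⟩ := hν
  have hF : Computable (rewriteFold s₀ v₀ step pre ext sub) :=
    (computable_rewriteFold hstep hpre hext).to_comp
  refine ⟨fun w => good (rewriteFold s₀ v₀ step pre ext sub w).1 &&
    φ ((rewriteFold s₀ v₀ step pre ext sub w).2 ++ fin (rewriteFold s₀ v₀ step pre ext sub w).1), ?_, ?_⟩
  · exact computable_and (hgood.to_comp.comp (Computable.fst.comp hF))
      (hφ.comp (Computable.list_append.comp (Computable.snd.comp hF)
        (hfin.to_comp.comp (Computable.fst.comp hF))))
  · intro w
    rw [h w, Bool.and_eq_true, hs]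

/-- `L` is finitely generated and every subgroup has decidable membership problem with respect
to every finite tuple in `L`. -/
def AllDecidable (L : Subgroup G) : Prop :=
  L.FG ∧ ∀ (k : ℕ) (τ : Fin k → G), (∀ i, τ i ∈ L) → ∀ H : Subgroup G, DecidableMembership τ H

theorem allDecidable_bot : AllDecidable (⊥ : Subgroup G) := by
  refine ⟨⟨∅, by simp⟩, fun k τ hτ H => ⟨fun _ => true, Computable.const true, fun w => ?_⟩⟩
  have : wordVal τ w = 1 := by simpa using wordVal_mem (L := ⊥) hτ w
  simp [this, H.one_mem]

theorem AllDecidable.of_finiteIndex {K : Subgroup G} (hK : AllDecidable K)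
    (hfi : K.FiniteIndex) (τ : Fin k → G) (H : Subgroup G) : DecidableMembership τ H := by
  classical
  obtain ⟨r, ν, hν⟩ := exists_tuple_of_fg hK.1
  obtain ⟨n, ⟨e⟩⟩ := Finite.exists_equiv_fin (G ⧸ K)
  set q : Fin n → G := fun s => ((e.symm s).out : G)⁻¹ with hq
  set cl : G → Fin n := fun g => e ((g⁻¹ : G) : G ⧸ K) with hcl
  have hrep : ∀ g, g * (q (cl g))⁻¹ ∈ K := by
    intro g
    have h1 : (((e.symm (cl g)).out : G) : G ⧸ K) = ((g⁻¹ : G) : G ⧸ K) := by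
      rw [hcl]; simp
    have := QuotientGroup.eq.1 h1.symm
    simpa [hq] using this
  have hw : ∀ x ∈ K, ∃ w, wordVal ν w = x := fun x hx => exists_wordVal_eq (by rwa [hν])
  choose! W hW using hw
  have hνK : ∀ i, ν i ∈ K := fun i => hν ▸ Subgroup.subset_closure (Set.mem_range_self i)
  have hfin : ∀ s, ∃ c ∈ K, (∃ x ∈ K, x * q s ∈ H) → c * q s ∈ H := by
    intro s
    by_cases h : ∃ x ∈ K, x * q s ∈ H
    · obtain ⟨x, hx, hx'⟩ := h
      exact ⟨x, hx, fun _ => hx'⟩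
    · exact ⟨1, K.one_mem, fun h' => absurd h' h⟩
  choose c hcK hc using hfin
  let step : Fin n × (Fin k × Bool) → Fin n := fun p => cl (q p.1 * wordVal τ [p.2])
  let ext : Fin n × (Fin k × Bool) → List (Fin r × Bool) :=
    fun p => W (q p.1 * wordVal τ [p.2] * (q (step p))⁻¹)
  let pre : Fin n × (Fin k × Bool) → List (Fin r × Bool) := fun _ => []
  let sub : (Fin k × Bool) × (Fin r × Bool) → List (Fin r × Bool) := fun p => [p.2]
  have inv : ∀ w, wordVal τ w = wordVal ν
      (rewriteFold (cl 1) (W (q (cl 1))⁻¹) step pre ext sub w).2 *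
      q (rewriteFold (cl 1) (W (q (cl 1))⁻¹) step pre ext sub w).1 := by
    intro w
    induction w using List.reverseRecOn with
    | nil =>
      have := hrep 1
      rw [one_mul] at this
      rw [rewriteFold_nil, hW _ this, wordVal_nil, inv_mul_cancel]
    | append_singleton w l ih =>
      rw [rewriteFold_concat, wordVal_append, ih]
      set p := rewriteFold (cl 1) (W (q (cl 1))⁻¹) step pre ext sub w
      have h1 : p.2.flatMap (fun b => sub (l, b)) = p.2 := by simp [sub]
      have h2 : wordVal ν (ext (p.1, l)) = q p.1 * wordVal τ [l] * (q (step (p.1, l)))⁻¹ :=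
        hW _ (hrep _)
      simp only [h1, pre, List.nil_append, wordVal_append, h2]
      group
  refine decidableMembership_of_fold (S := Fin n) (s₀ := cl 1) (v₀ := W (q (cl 1))⁻¹)
    (step := step) (pre := pre) (ext := ext) (sub := sub) (hK.2 r ν hνK H)
    (fin := fun s => invWord (W (c s))) (good := fun s => decide (∃ x ∈ K, x * q s ∈ H))
    (Primrec.dom_finite _) (Primrec.dom_finite _) (Primrec.dom_finite _)
    (Primrec.dom_finite _) (Primrec.dom_finite _) fun w => ?_
  rw [inv w]
  set p := rewriteFold (cl 1) (W (q (cl 1))⁻¹) step pre ext sub w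
  rw [decide_eq_true_eq, wordVal_append, wordVal_invWord, hW _ (hcK p.1)]
  constructor
  · intro h
    have hx : ∃ x ∈ K, x * q p.1 ∈ H := ⟨_, wordVal_mem hνK p.2, h⟩
    refine ⟨hx, ?_⟩
    have := H.mul_mem h (H.inv_mem (hc p.1 hx))
    convert this using 1; group
  · rintro ⟨hx, h⟩
    have := H.mul_mem h (hc p.1 hx)
    convert this using 1; group

theorem AllDecidable.step {N L : Subgroup G} (hN : AllDecidable N)
    (h : CyclicQuotientStep N L) : AllDecidable L := by
  classical
  obtain ⟨hNL, hnorm, g, hg, hgen⟩ := h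
  obtain ⟨r, ν, hν⟩ := exists_tuple_of_fg hN.1
  have hw : ∀ x ∈ N, ∃ w, wordVal ν w = x := fun x hx => exists_wordVal_eq (by rwa [hν])
  choose! W hW using hw
  have hνN : ∀ i, ν i ∈ N := fun i => hν ▸ Subgroup.subset_closure (Set.mem_range_self i)
  constructor
  · obtain ⟨S, hS⟩ := hN.1
    refine ⟨insert g S, le_antisymm ?_ ?_⟩
    · rw [Subgroup.closure_le, Finset.coe_insert, Set.insert_subset_iff]
      exact ⟨hg, fun x hx => hNL (hS ▸ Subgroup.subset_closure hx)⟩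
    · intro x hx
      obtain ⟨m, hm⟩ := hgen x hx
      have h1 : g ∈ Subgroup.closure (↑(insert g S) : Set G) :=
        Subgroup.subset_closure (by simp)
      have h2 : N ≤ Subgroup.closure (↑(insert g S) : Set G) := by
        rw [← hS]; exact Subgroup.closure_mono (by simp)
      have := Subgroup.mul_mem _ (Subgroup.zpow_mem _ h1 m) (h2 hm)
      simpa using this
  intro k τ hτ H
  have hlet : ∀ l : Fin k × Bool, ∃ m : ℤ, (g ^ m)⁻¹ * wordVal τ [l] ∈ N :=
    fun l => hgen _ (wordVal_mem hτ [l])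
  choose e he using hlet
  have hconj : ∀ (m : ℤ), ∀ x ∈ N, (g ^ m)⁻¹ * x * g ^ m ∈ N := by
    intro m x hx
    have := hnorm _ (L.inv_mem (L.zpow_mem hg m)) x hx
    simpa using this
  let sub : (Fin k × Bool) × (Fin r × Bool) → List (Fin r × Bool) :=
    fun p => W ((g ^ e p.1)⁻¹ * wordVal ν [p.2] * g ^ e p.1)
  have hsub : ∀ l w, wordVal ν (w.flatMap fun b => sub (l, b)) =
      (g ^ e l)⁻¹ * wordVal ν w * g ^ e l := by
    intro l w
    refine wordVal_flatMap ν (fun x => (g ^ e l)⁻¹ * x * g ^ e l) (by simp) (fun x y => by group)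
      _ (fun b => ?_) w
    exact hW _ (hconj _ _ (wordVal_mem hνN _))
  by_cases hM : ∃ m : ℕ, 0 < m ∧ ∃ n ∈ N, g ^ m * n ∈ H
  · obtain ⟨hm0, n₀, hn₀, hh⟩ := Nat.find_spec hM
    have hmin : ∀ m < Nat.find hM, 0 < m → ∀ n ∈ N, g ^ m * n ∉ H :=
      fun m hm h0 n hn hc => Nat.find_min hM hm ⟨h0, n, hn, hc⟩
    set m₀ := Nat.find hM
    have hred : ∀ m : ℤ, ∃ (ρ : ℕ) (h : G) (n : G), ρ < m₀ ∧ h ∈ H ∧ n ∈ N ∧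
        g ^ m = h * g ^ ρ * n := by
      intro m
      induction m using Int.induction_on with
      | zero => exact ⟨0, 1, 1, hm0, H.one_mem, N.one_mem, by simp⟩
      | succ i ih =>
        obtain ⟨ρ, h, n, hρlt, hh', hn, hi⟩ := ih
        have hn' := hconj 1 n hn
        rw [zpow_one] at hn'
        by_cases hρ : ρ + 1 < m₀
        · refine ⟨ρ + 1, h, _, hρ, hh', hn', ?_⟩
          rw [zpow_add_one, hi]; simp only [pow_succ]; group
        · have hρ' : ρ + 1 = m₀ := le_antisymm hρlt (not_lt.1 hρ)
          refine ⟨0, h * (g ^ m₀ * n₀), _, hm0, H.mul_mem hh' hh,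
            N.mul_mem (N.inv_mem hn₀) hn', ?_⟩
          rw [zpow_add_one, hi, ← hρ']; simp only [pow_succ]; group
      | pred i ih =>
        obtain ⟨ρ, h, n, hρlt, hh', hn, hi⟩ := ih
        have hn' := hconj (-1) n hn
        by_cases hρ : 0 < ρ
        · refine ⟨ρ - 1, h, _, by lia, hh', hn', ?_⟩
          rw [zpow_sub_one, hi]
          obtain ⟨t, ht⟩ := Nat.exists_eq_succ_of_ne_zero hρ.ne'
          rw [ht]; simp only [Nat.succ_eq_add_one, pow_succ, Nat.add_sub_cancel]; group
        · have hρ' : ρ = 0 := by lia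
          obtain ⟨t, ht⟩ := Nat.exists_eq_succ_of_ne_zero hm0.ne'
          have hn₁ : g * n₀ * g⁻¹ ∈ N := hnorm g hg _ hn₀
          have hx : (g ^ t)⁻¹ * ((g ^ m₀ * n₀) * n₀ * (g ^ m₀ * n₀)⁻¹) * g ^ t ∈ N := by
            have := hconj t _ (hnorm _ (L.mul_mem (L.pow_mem hg m₀) (hNL hn₀)) n₀ hn₀)
            simpa using this
          refine ⟨t, h * (g ^ m₀ * n₀)⁻¹, _, by lia, H.mul_mem hh' (H.inv_mem hh),
            N.mul_mem hx hn', ?_⟩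
          rw [zpow_sub_one, hi, hρ', ht]; simp only [Nat.succ_eq_add_one, pow_succ]; group
    choose ρ' h' n' hρlt hh' hn' hρ' using hred
    have hm0' : NeZero m₀ := ⟨hm0.ne'⟩
    let step : Fin m₀ × (Fin k × Bool) → Fin m₀ := fun p => ⟨ρ' ((p.1 : ℕ) + e p.2), hρlt _⟩
    let pre : Fin m₀ × (Fin k × Bool) → List (Fin r × Bool) :=
      fun p => W (n' ((p.1 : ℕ) + e p.2))
    let ext : Fin m₀ × (Fin k × Bool) → List (Fin r × Bool) :=
      fun p => W ((g ^ e p.2)⁻¹ * wordVal τ [p.2])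
    have inv : ∀ w, ∃ h ∈ H, wordVal τ w =
        h * g ^ ((rewriteFold 0 [] step pre ext sub w).1 : ℕ) *
        wordVal ν (rewriteFold 0 [] step pre ext sub w).2 := by
      intro w
      induction w using List.reverseRecOn with
      | nil => exact ⟨1, H.one_mem, by simp [rewriteFold_nil, wordVal_nil]⟩
      | append_singleton w l ih =>
        obtain ⟨h, hhH, hhw⟩ := ih
        rw [rewriteFold_concat, wordVal_append, hhw]
        set p := rewriteFold 0 [] step pre ext sub w
        refine ⟨h * h' ((p.1 : ℕ) + e l), H.mul_mem hhH (hh' _), ?_⟩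
        have e1 := hρ' ((p.1 : ℕ) + e l)
        rw [zpow_add, zpow_natCast] at e1
        have e2 : wordVal ν (pre (p.1, l)) = n' ((p.1 : ℕ) + e l) := hW _ (hn' _)
        have e3 : wordVal ν (ext (p.1, l)) = (g ^ e l)⁻¹ * wordVal τ [l] := hW _ (he l)
        have e4 : g ^ (step (p.1, l) : ℕ) * n' ((p.1 : ℕ) + e l) =
            (h' ((p.1 : ℕ) + e l))⁻¹ * (g ^ (p.1 : ℕ) * g ^ e l) := by
          rw [e1]; simp [step, mul_assoc]
        simp only [wordVal_append, hsub, e2, e3]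
        calc h * g ^ (p.1 : ℕ) * wordVal ν p.2 * wordVal τ [l]
            = h * h' ((p.1 : ℕ) + e l) * ((h' ((p.1 : ℕ) + e l))⁻¹ *
              (g ^ (p.1 : ℕ) * g ^ e l)) * ((g ^ e l)⁻¹ * wordVal ν p.2 * g ^ e l *
              ((g ^ e l)⁻¹ * wordVal τ [l])) := by group
          _ = _ := by rw [← e4]; simp only [mul_assoc]
    refine decidableMembership_of_fold (S := Fin m₀) (s₀ := 0) (v₀ := [])
      (step := step) (pre := pre) (ext := ext) (sub := sub) (hN.2 r ν hνN H)
      (fin := fun _ => []) (good := fun s => decide (s = 0))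
      (Primrec.dom_finite _) (Primrec.dom_finite _) (Primrec.dom_finite _)
      (Primrec.dom_finite _) (Primrec.dom_finite _) fun w => ?_
    obtain ⟨h, hhH, hhw⟩ := inv w
    rw [hhw]
    set p := rewriteFold 0 [] step pre ext sub w
    rw [decide_eq_true_eq, List.append_nil, mul_assoc, H.mul_mem_cancel_left hhH]
    constructor
    · intro h1
      have h0 : p.1 = 0 := by
        by_contra h0
        exact hmin p.1 p.1.2 (Nat.pos_of_ne_zero fun h2 => h0 (Fin.ext (by simpa using h2))) _
          (wordVal_mem hνN p.2) h1
      refine ⟨h0, ?_⟩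
      simpa [h0] using h1
    · rintro ⟨h0, h1⟩
      simpa [h0] using h1
  · push Not at hM
    have hM' : ∀ m : ℤ, (∃ n ∈ N, g ^ m * n ∈ H) → m = 0 := by
      rintro m ⟨n, hn, hmn⟩
      rcases lt_trichotomy m 0 with h | h | h
      · exfalso
        obtain ⟨t, rfl⟩ : ∃ t : ℕ, m = -t := ⟨m.natAbs, by lia⟩
        refine hM t (by lia) _ (hnorm _ (L.inv_mem (L.pow_mem hg t)) _ (N.inv_mem hn)) ?_
        have := H.inv_mem hmn
        convert this using 1
        simp [mul_assoc]
      · exact h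
      · exfalso
        obtain ⟨t, rfl⟩ : ∃ t : ℕ, m = t := ⟨m.natAbs, by lia⟩
        exact hM t (by lia) n hn (by simpa using hmn)
    let step : (ℕ × ℕ) × (Fin k × Bool) → ℕ × ℕ :=
      fun p => (p.1.1 + (e p.2).toNat, p.1.2 + (-e p.2).toNat)
    let pre : (ℕ × ℕ) × (Fin k × Bool) → List (Fin r × Bool) := fun _ => []
    let ext : (ℕ × ℕ) × (Fin k × Bool) → List (Fin r × Bool) :=
      fun p => W ((g ^ e p.2)⁻¹ * wordVal τ [p.2])
    have inv : ∀ w, wordVal τ w =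
        g ^ (((rewriteFold (0, 0) [] step pre ext sub w).1.1 : ℤ) -
          (rewriteFold (0, 0) [] step pre ext sub w).1.2) *
        wordVal ν (rewriteFold (0, 0) [] step pre ext sub w).2 := by
      intro w
      induction w using List.reverseRecOn with
      | nil => simp [rewriteFold_nil, wordVal_nil]
      | append_singleton w l ih =>
        rw [rewriteFold_concat, wordVal_append, ih]
        set p := rewriteFold (0, 0) [] step pre ext sub w
        have e3 : wordVal ν (ext (p.1, l)) = (g ^ e l)⁻¹ * wordVal τ [l] := hW _ (he l)
        have e4 : ((step (p.1, l)).1 : ℤ) - (step (p.1, l)).2 = (p.1.1 - p.1.2) + e l := by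
          simp only [step]; push_cast; lia
        rw [e4, zpow_add]
        simp only [wordVal_append, hsub, e3, pre, List.nil_append]
        group
    have hstep : Primrec step := by
      refine Primrec.pair (Primrec.nat_add.comp (Primrec.fst.comp Primrec.fst) ?_)
        (Primrec.nat_add.comp (Primrec.snd.comp Primrec.fst) ?_)
      · exact (Primrec.dom_finite fun l => (e l).toNat).comp Primrec.snd
      · exact (Primrec.dom_finite fun l => (-e l).toNat).comp Primrec.snd
    have hext : Primrec ext :=
      (Primrec.dom_finite fun l => W ((g ^ e l)⁻¹ * wordVal τ [l])).comp Primrec.snd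
    refine decidableMembership_of_fold (S := ℕ × ℕ) (s₀ := (0, 0)) (v₀ := [])
      (step := step) (pre := pre) (ext := ext) (sub := sub) (hN.2 r ν hνN H)
      (fin := fun _ => []) (good := fun s => decide (s.1 = s.2))
      hstep (Primrec.const _) hext (Primrec.const _)
      ((Primrec.eq.decide (α := ℕ)).comp Primrec.fst Primrec.snd) fun w => ?_
    rw [inv w]
    set p := rewriteFold (0, 0) [] step pre ext sub w
    rw [decide_eq_true_eq, List.append_nil]
    constructor
    · intro h1
      have h0 := hM' _ ⟨_, wordVal_mem hνN p.2, h1⟩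
      rw [h0] at h1
      exact ⟨by lia, by simpa using h1⟩
    · rintro ⟨h0, h1⟩
      simpa [h0] using h1

theorem CyclicQuotientStep.map {G' : Type*} [Group G'] {K L : Subgroup G}
    (h : CyclicQuotientStep K L) (f : G →* G') : CyclicQuotientStep (K.map f) (L.map f) := by
  obtain ⟨h1, h2, g, hg, h3⟩ := h
  refine ⟨Subgroup.map_mono h1, ?_, f g, Subgroup.mem_map_of_mem f hg, ?_⟩
  · rintro _ ⟨x, hx, rfl⟩ _ ⟨y, hy, rfl⟩
    exact ⟨x * y * x⁻¹, h2 x hx y hy, by simp⟩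
  · rintro _ ⟨x, hx, rfl⟩
    obtain ⟨m, hm⟩ := h3 x hx
    exact ⟨m, _, hm, by simp⟩

/-- A subgroup which is polycyclic is the top of a chain of subgroups of the ambient group. -/
theorem induction_of_polycyclic {K : Subgroup G} (hK : IsPolycyclic K) {p : Subgroup G → Prop}
    (h0 : p ⊥) (hs : ∀ N L, p N → CyclicQuotientStep N L → p L) : p K := by
  obtain ⟨n, s, hs0, hsn, hstep⟩ := hK
  have : ∀ i, p ((s i).map K.subtype) := by
    intro i
    induction i using Fin.induction with
    | zero => simpa [hs0] using h0
    | succ i ih => exact hs _ _ ih ((hstep i).map K.subtype)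
  have hlast := this (Fin.last n)
  rwa [hsn, ← MonoidHom.range_eq_map, Subgroup.range_subtype] at hlast

/-- Virtually polycyclic groups have decidable subgroup membership problem. -/
theorem decidableMembership_of_polycyclic
    (hvp : ∃ K : Subgroup G, K.FiniteIndex ∧ IsPolycyclic K) (τ : Fin k → G)
    (H : Subgroup G) : DecidableMembership τ H := by
  obtain ⟨K, hfi, hK⟩ := hvp
  exact (induction_of_polycyclic hK allDecidable_bot fun _ _ hN h => hN.step h).of_finiteIndex
    hfi τ H

end Membership
end MedvedevFormal

namespace MedvedevFormal

/-! ### Polycyclic groups contain `ℤ²` or are virtually cyclic -/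

section ZSquared

variable {G : Type*} [Group G]

theorem relIndex_ne_zero_of_cover {H L : Subgroup G} {ι : Type*} [Finite ι] (f : ι → G)
    (hf : ∀ i, f i ∈ L) (h : ∀ x ∈ L, ∃ i, (f i)⁻¹ * x ∈ H) : H.relIndex L ≠ 0 := by
  rw [Subgroup.relIndex, Subgroup.index_ne_zero_iff_finite]
  refine Finite.of_surjective
    (fun i => ((⟨f i, hf i⟩ : L) : L ⧸ H.subgroupOf L)) fun q => ?_
  obtain ⟨x, rfl⟩ := QuotientGroup.mk_surjective q
  obtain ⟨i, hi⟩ := h x x.2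
  exact ⟨i, QuotientGroup.eq.2 (by simpa [Subgroup.mem_subgroupOf] using hi)⟩

/-- The pair `a, b` freely generates an abelian group of rank two. -/
def IsZSquared (a b : G) : Prop :=
  a * b = b * a ∧ ∀ i j : ℤ, a ^ i * b ^ j = 1 → i = 0 ∧ j = 0

theorem zpow_eq_one_of_not_isOfFinOrder {c : G} (hc : ¬IsOfFinOrder c) {i : ℤ}
    (h : c ^ i = 1) : i = 0 := by
  by_contra h0
  exact hc (isOfFinOrder_iff_zpow_eq_one.2 ⟨i, h0, h⟩)

theorem virtuallyCyclic_or_zSquared_step {N L : Subgroup G}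
    (hN : (∃ c ∈ N, (Subgroup.zpowers c).relIndex N ≠ 0) ∨ ∃ a b : G, IsZSquared a b)
    (h : CyclicQuotientStep N L) :
    (∃ c ∈ L, (Subgroup.zpowers c).relIndex L ≠ 0) ∨ ∃ a b : G, IsZSquared a b := by
  rcases hN with ⟨c, hcN, hc⟩ | h'
  swap
  · exact Or.inr h'
  obtain ⟨hNL, hnorm, g, hg, hgen⟩ := h
  by_cases hfin : ∃ m : ℕ, 0 < m ∧ g ^ m ∈ N
  · left
    obtain ⟨m, hm, hmN⟩ := hfin
    refine ⟨c, hNL hcN, ?_⟩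
    rw [← Subgroup.relIndex_mul_relIndex _ N L (by simpa using hcN) hNL]
    refine mul_ne_zero hc (relIndex_ne_zero_of_cover (fun i : Fin m => g ^ (i : ℕ))
      (fun i => L.pow_mem hg _) fun x hx => ?_)
    obtain ⟨e, he⟩ := hgen x hx
    have hm' : (m : ℤ) ≠ 0 := by lia
    refine ⟨⟨(e % m).toNat, ?_⟩, ?_⟩
    · have := Int.emod_lt_of_pos e (b := m) (by lia)
      have := Int.emod_nonneg e hm'
      lia
    · have h1 : g ^ (e % m).toNat = g ^ (e % m) := by
        rw [← zpow_natCast, Int.toNat_of_nonneg (Int.emod_nonneg e hm')]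
      have h2 : g ^ e = g ^ (e % m) * (g ^ m) ^ (e / m) := by
        rw [← zpow_natCast, ← zpow_mul, ← zpow_add, Int.emod_add_mul_ediv]
      have := N.mul_mem (N.zpow_mem hmN (e / m)) he
      rw [h2] at this
      convert this using 1
      rw [h1]
      group
  push Not at hfin
  have hinf : ∀ j : ℤ, g ^ j ∈ N → j = 0 := by
    intro j hj
    by_contra h0
    refine hfin j.natAbs (by lia) ?_
    rcases Int.natAbs_eq j with h | h
    · rw [h, zpow_natCast] at hj; exact hj
    · rw [h, zpow_neg, zpow_natCast] at hj; simpa using hj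
  by_cases hord : IsOfFinOrder c
  · left
    have hNfin : Finite N := by
      have h1 : Finite (Subgroup.zpowers c) := (finite_zpowers.2 hord).to_subtype
      have h2 := Subgroup.relIndex_mul_relIndex ⊥ (Subgroup.zpowers c) N bot_le
        (by simpa using hcN)
      rw [Subgroup.relIndex_bot_left, Subgroup.relIndex_bot_left] at h2
      refine Nat.finite_of_card_ne_zero (h2 ▸ mul_ne_zero Nat.card_pos.ne' hc)
    refine ⟨g, hg, relIndex_ne_zero_of_cover (fun i : N => (i : G)) (fun i => hNL i.2)
      fun x hx => ?_⟩
    obtain ⟨e, he⟩ := hgen x hx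
    have h1 := hnorm _ (L.zpow_mem hg e) _ he
    refine ⟨⟨_, h1⟩, ?_⟩
    convert (Subgroup.zpow_mem _ (Subgroup.mem_zpowers g) e) using 1
    group
  right
  set M := ((Subgroup.zpowers c).relIndex N).factorial
  have hM : ∀ x ∈ N, x ^ M ∈ Subgroup.zpowers c := by
    intro x hx
    obtain ⟨n, hn, hn', hxn⟩ := Subgroup.exists_pow_mem_of_relIndex_ne_zero hc hx
    obtain ⟨t, ht⟩ := Nat.dvd_factorial hn hn'
    rw [show M = n * t from ht, pow_mul]
    exact Subgroup.pow_mem _ hxn.1 t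
  set P := Subgroup.closure {y | ∃ x ∈ N, x ^ M = y}
  have hPc : P ≤ Subgroup.zpowers c := by
    rw [Subgroup.closure_le]
    rintro _ ⟨x, hx, rfl⟩
    exact hM x hx
  have hPN : P ≤ N := by
    rw [Subgroup.closure_le]
    rintro _ ⟨x, hx, rfl⟩
    exact N.pow_mem hx M
  have hPconj : ∀ y ∈ L, ∀ x ∈ P, y * x * y⁻¹ ∈ P := by
    intro y hy x hx
    induction hx using Subgroup.closure_induction with
    | mem x hx =>
      obtain ⟨z, hz, rfl⟩ := hx
      exact Subgroup.subset_closure ⟨y * z * y⁻¹, hnorm y hy z hz, by rw [conj_pow]⟩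
    | one => simp
    | mul u v _ _ hu hv => simpa [mul_assoc] using P.mul_mem hu hv
    | inv u _ hu => simpa [mul_assoc] using P.inv_mem hu
  have hcyc : IsCyclic P := isCyclic_of_injective (Subgroup.inclusion hPc)
    (Subgroup.inclusion_injective hPc)
  obtain ⟨⟨d, hd⟩, hgd⟩ := hcyc.exists_generator
  have hgd' : ∀ x ∈ P, ∃ u : ℤ, d ^ u = x := by
    intro x hx
    obtain ⟨u, hu⟩ := Subgroup.mem_zpowers_iff.1 (hgd ⟨x, hx⟩)
    exact ⟨u, by simpa using congrArg Subtype.val hu⟩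
  have hdinf : ¬IsOfFinOrder d := by
    intro hdf
    obtain ⟨u, hu⟩ := hgd' (c ^ M) (Subgroup.subset_closure ⟨c, hcN, rfl⟩)
    have h1 : IsOfFinOrder (c ^ M) := hu ▸ hdf.zpow
    exact hord ((isOfFinOrder_pow.1 h1).resolve_right (Nat.factorial_ne_zero _))
  obtain ⟨u, hu⟩ := hgd' _ (hPconj g hg d hd)
  obtain ⟨v, hv⟩ := hgd' _ (hPconj g⁻¹ (L.inv_mem hg) d hd)
  have huv : u * v = 1 := by
    have h1 : d ^ (u * v) = d := by
      rw [mul_comm, zpow_mul, hv, conj_zpow, hu]; group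
    have h2 : d ^ (u * v - 1) = 1 := by rw [zpow_sub_one, h1, mul_inv_cancel]
    have := zpow_eq_one_of_not_isOfFinOrder hdinf h2
    lia
  have hu2 : u * u = 1 := by
    rcases Int.mul_eq_one_iff_eq_one_or_neg_one.1 huv with h | h <;> simp [h.1]
  have hcomm : d * g ^ 2 = g ^ 2 * d := by
    have h1 : g * (g * d * g⁻¹) * g⁻¹ = d := by
      rw [← hu, ← conj_zpow, ← hu, ← zpow_mul, hu2, zpow_one]
    calc d * g ^ 2 = (g * (g * d * g⁻¹) * g⁻¹) * g ^ 2 := by rw [h1]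
      _ = g ^ 2 * d := by simp only [pow_two]; group
  refine ⟨d, g ^ 2, hcomm, fun i j hij => ?_⟩
  have hj : j = 0 := by
    have h1 : g ^ (2 * j) ∈ N := by
      have h2 : (g ^ 2) ^ j = (d ^ i)⁻¹ := eq_inv_of_mul_eq_one_right hij
      have h3 : g ^ (2 * j) = (d ^ i)⁻¹ := by
        rw [← h2, zpow_mul]; norm_cast
      rw [h3]
      exact N.inv_mem (N.zpow_mem (hPN hd) i)
    have := hinf _ h1
    lia
  refine ⟨zpow_eq_one_of_not_isOfFinOrder hdinf ?_, hj⟩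
  simpa [hj] using hij

theorem exists_zSquared_of_not_virtuallyCyclic
    (hvp : ∃ K : Subgroup G, K.FiniteIndex ∧ IsPolycyclic K)
    (hvc : ¬∃ K : Subgroup G, K.FiniteIndex ∧ IsCyclic K) : ∃ a b : G, IsZSquared a b := by
  obtain ⟨K, hfi, hK⟩ := hvp
  refine (induction_of_polycyclic hK (p := fun L =>
    (∃ c ∈ L, (Subgroup.zpowers c).relIndex L ≠ 0) ∨ ∃ a b : G, IsZSquared a b) ?_
    fun _ _ => virtuallyCyclic_or_zSquared_step).resolve_left ?_
  · exact Or.inl ⟨1, Subgroup.mem_bot.2 rfl, by simp⟩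
  · rintro ⟨c, hc, hcK⟩
    refine hvc ⟨Subgroup.zpowers c, ⟨?_⟩, inferInstance⟩
    rw [← Subgroup.relIndex_mul_index (K := K) (by simpa using hc)]
    exact mul_ne_zero hcK hfi.index_ne_zero

end ZSquared
end MedvedevFormal

namespace MedvedevFormal

/-! ### Subshifts of finite type on virtually cyclic groups -/

section VirtuallyCyclic

variable {G : Type*} [Group G] {k : ℕ} {A : Type*}

theorem decode_freeGroup (n : ℕ) : Encodable.decode (α := FreeGroup (Fin k)) n =
    (Encodable.decode (α := List (Fin k × Bool)) n).map FreeGroup.mk := by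
  show (Encodable.decode (α := List (Fin k × Bool)) n).bind _ = _
  simp [Option.map_eq_bind]

theorem confFun_comp_cover [Encodable A] (σ : Fin k → G) (x : G → A) (n : ℕ) :
    confFun (x ∘ cover σ) n =
      Encodable.encode ((Encodable.decode (α := List (Fin k × Bool)) n).map
        fun w => x (wordVal σ w)) := by
  simp only [confFun, decode_freeGroup, Option.map_map]
  rfl

theorem computable_confFun_of_computable_word [Primcodable A] (σ : Fin k → G) (x : G → A)
    (h : Computable fun w => x (wordVal σ w)) : Computable (confFun (x ∘ cover σ)) := by
  have : Computable fun n : ℕ => Encodable.encode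
      ((Encodable.decode (α := List (Fin k × Bool)) n).map fun w => x (wordVal σ w)) :=
    Computable.encode.comp (Computable.option_map Computable.decode (h.comp Computable.snd).to₂)
  exact this.of_eq fun n => (confFun_comp_cover σ x n).symm

/-- A configuration with finitely many translates is computable by a finite automaton. -/
theorem computable_word_of_finite_translates [Primcodable A] (σ : Fin k → G) (x : G → A)
    (hx : (Set.range fun g h : G => x (g * h)).Finite) :
    Computable fun w => x (wordVal σ w) := by
  classical
  have : Finite (Set.range fun g h : G => x (g * h)) := hx.to_subtype
  obtain ⟨m, ⟨e⟩⟩ := Finite.exists_equiv_fin (Set.range fun g h : G => x (g * h))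
  have hmem : ∀ (s : Set.range fun g h : G => x (g * h)) (u : G),
      (fun h => s.1 (u * h)) ∈ Set.range fun g h : G => x (g * h) := by
    rintro ⟨_, g, rfl⟩ u
    exact ⟨g * u, by simp [mul_assoc]⟩
  let st : Fin m → Fin k × Bool → Fin m := fun s l =>
    e ⟨_, hmem (e.symm s) (wordVal σ [l])⟩
  let s0 : Fin m := e ⟨_, 1, rfl⟩
  have hst : Computable₂ st := (Primrec.dom_finite _).to_comp
  have hfold : ∀ (w : List (Fin k × Bool)),
      (e.symm (w.foldl st s0)).1 = fun h => x (wordVal σ w * h) := by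
    intro w
    induction w using List.reverseRecOn with
    | nil => simp [s0, wordVal_nil]
    | append_singleton w l ih =>
      simp [st, List.foldl_append, ih, wordVal_append, mul_assoc]
  have hout : Computable fun s : Fin m => (e.symm s).1 1 := (Primrec.dom_finite _).to_comp
  have : Computable fun w : List (Fin k × Bool) => w.foldl st s0 :=
    computable_list_foldl Computable.id (Computable.const s0)
      (hst.comp (Computable.fst.comp Computable.snd) (Computable.snd.comp Computable.snd)).to₂
  refine (hout.comp this).of_eq fun w => ?_
  simp [hfold]

theorem exists_finite_translates {X : Set (G → A)} [Finite A] (hX : IsSFT X) (hne : X.Nonempty)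
    (hvc : ∃ K : Subgroup G, K.FiniteIndex ∧ IsCyclic K) :
    ∃ y ∈ X, (Set.range fun g h : G => y (g * h)).Finite := by
  classical
  obtain ⟨K, hK, hcyc⟩ := hvc
  obtain ⟨⟨t, ht⟩, hgen⟩ := hcyc.exists_generator
  obtain ⟨x, hx⟩ := hne
  have hKt : ∀ g ∈ K, ∃ n : ℤ, t ^ n = g := by
    intro g hg
    obtain ⟨u, hu⟩ := Subgroup.mem_zpowers_iff.1 (hgen ⟨g, hg⟩)
    exact ⟨u, by simpa using congrArg Subtype.val hu⟩
  let Q := Quotient (QuotientGroup.rightRel K)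
  have hQfin : Finite Q := Finite.of_equiv _ (QuotientGroup.quotientRightRelEquivQuotientLeftRel K).symm
  let f : G → G := fun g => (Quotient.mk (QuotientGroup.rightRel K) g : Q).out
  have hf1 : ∀ g, g * (f g)⁻¹ ∈ K := fun g => by
    have := Quotient.exact (Quotient.out_eq (Quotient.mk (QuotientGroup.rightRel K) g))
    exact QuotientGroup.rightRel_apply.1 this
  choose τ hτ using fun g => hKt _ (hf1 g)
  have hτ' : ∀ g, t ^ τ g * f g = g := fun g => by rw [hτ]; group
  have hft : ∀ (n : ℤ) g, f (t ^ n * g) = f g := fun n g => by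
    have : (Quotient.mk (QuotientGroup.rightRel K) (t ^ n * g)) = Quotient.mk _ g := by
      refine Quotient.sound (QuotientGroup.rightRel_apply.2 ?_)
      have := K.zpow_mem ht (-n)
      convert this using 1; group
    show Quotient.out _ = Quotient.out _
    rw [this]
  have hfrange : (Set.range f).Finite := by
    refine (Set.finite_range (fun q : Q => q.out)).subset ?_
    rintro _ ⟨g, rfl⟩
    exact ⟨_, rfl⟩
  by_cases hord : IsOfFinOrder t
  · have hG : Finite G := by
      have h1 : Finite (Subgroup.zpowers t) := (finite_zpowers.2 hord).to_subtype
      have hKf : Finite K := Finite.of_injective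
        (fun g : K => (⟨g, Subgroup.mem_zpowers_iff.2 (hKt g g.2)⟩ : Subgroup.zpowers t))
        fun a b h => Subtype.ext (congrArg (fun z => z.1) h)
      refine Nat.finite_of_card_ne_zero ?_
      rw [← K.card_mul_index]
      exact mul_ne_zero Nat.card_pos.ne' hK.index_ne_zero
    exact ⟨x, hx, Set.finite_range _⟩
  have hinj : ∀ {m n : ℤ}, t ^ m = t ^ n → m = n := fun {m n} h => by
    have h1 : t ^ (m - n) = 1 := by rw [zpow_sub, h, mul_inv_cancel]
    have := zpow_eq_one_of_not_isOfFinOrder hord h1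
    lia
  have hτt : ∀ n g, τ (t ^ n * g) = n + τ g := fun n g => by
    refine hinj ?_
    rw [hτ, hft, zpow_add, hτ, mul_assoc]
  obtain ⟨F, rfl⟩ := hX
  let D : Set G := ⋃ p ∈ F, (p.dom : Set G)
  have hD : D.Finite := Set.Finite.biUnion (List.finite_toSet F) fun p _ => p.dom.finite_toSet
  obtain ⟨W, hW⟩ : ∃ W : ℕ, ∀ g, ∀ d ∈ D, |τ (g * d) - τ g| ≤ W := by
    have h1 := ((hfrange.prod hD).image fun p : G × G => |τ (p.1 * p.2)|).bddAbove
    obtain ⟨W, hW⟩ := h1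
    refine ⟨W.toNat, fun g d hd => ?_⟩
    have h2 := hW ⟨(f g, d), ⟨⟨g, rfl⟩, hd⟩, rfl⟩
    have h3 : τ (g * d) = τ g + τ (f g * d) := by
      rw [← hτt, ← mul_assoc, hτ']
    rw [h3, add_sub_cancel_left]
    exact h2.trans (Int.self_le_toNat W)
  have hfr : Finite (Set.range f) := hfrange.to_subtype
  obtain ⟨k₁, k₂, hk, hwin⟩ : ∃ k₁ k₂ : ℕ, k₁ < k₂ ∧
      ∀ (s : Fin (2 * W + 1)) (u : Set.range f), x (t ^ ((k₁ * (W + 1) + s : ℕ) : ℤ) * u) =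
        x (t ^ ((k₂ * (W + 1) + s : ℕ) : ℤ) * u) := by
    obtain ⟨k₁, k₂, hne, h⟩ := Finite.exists_ne_map_eq_of_infinite
      (fun (k : ℕ) (s : Fin (2 * W + 1)) (u : Set.range f) =>
        x (t ^ ((k * (W + 1) + s : ℕ) : ℤ) * u))
    rcases lt_or_gt_of_ne hne with h' | h'
    · exact ⟨k₁, k₂, h', fun s u => congrFun (congrFun h s) u⟩
    · exact ⟨k₂, k₁, h', fun s u => (congrFun (congrFun h s) u).symm⟩
  obtain ⟨i₀, p, hp, hper⟩ : ∃ i₀ p : ℤ, W < p ∧ ∀ n, i₀ - W ≤ n → n ≤ i₀ + W → ∀ g,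
      x (t ^ n * f g) = x (t ^ (n + p) * f g) := by
    refine ⟨k₁ * (W + 1) + W, (k₂ - k₁) * (W + 1), ?_, fun n h1 h2 g => ?_⟩
    · have : (1 : ℤ) ≤ k₂ - k₁ := by lia
      nlinarith
    · have := hwin ⟨(n - k₁ * (W + 1)).toNat, by lia⟩ ⟨f g, g, rfl⟩
      convert this using 3
      · congr 1; push_cast; lia
      · congr 1; push_cast; rw [Int.toNat_of_nonneg (by lia)]; ring
  let r : ℤ → ℤ := fun n => i₀ + (n - i₀) % p
  have hr0 : ∀ n, i₀ ≤ r n ∧ r n < i₀ + p := fun n => by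
    have := Int.emod_nonneg (n - i₀) (b := p) (by lia)
    have := Int.emod_lt_of_pos (n - i₀) (b := p) (by lia)
    simp only [r]; lia
  have hrp : ∀ n c, r (n + p * c) = r n := fun n c => by
    simp only [r]
    rw [show n + p * c - i₀ = n - i₀ + p * c by ring, Int.add_mul_emod_self_left]
  have hrid : ∀ n, i₀ ≤ n → n < i₀ + p → r n = n := fun n h1 h2 => by
    simp only [r]; rw [Int.emod_eq_of_lt (by lia) (by lia)]; ring
  have hxr : ∀ n, i₀ - W ≤ n → n < i₀ + p + W → ∀ g, x (t ^ r n * f g) = x (t ^ n * f g) := by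
    intro n h1 h2 g
    by_cases h3 : n < i₀
    · rw [hper n h1 (by lia), ← hrp n 1, mul_one, hrid _ (by lia) (by lia)]
    by_cases h4 : n < i₀ + p
    · rw [hrid n (by lia) h4]
    · rw [← hrp n (-1), hrid _ (by lia) (by lia), hper _ (by lia) (by lia)]
      congr 3; ring
  have hr : ∀ n, ∃ c, r n = n + p * c := fun n => ⟨-((n - i₀) / p), by
    have := Int.emod_add_mul_ediv (n - i₀) p
    simp only [r]; lia⟩
  refine ⟨fun g => x (t ^ r (τ g) * f g), ?_, ?_⟩
  · intro q hq g hm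
    obtain ⟨c, hc⟩ := hr (τ g⁻¹)
    refine hx q hq (t ^ (p * c) * g⁻¹)⁻¹ fun h => ?_
    rw [← hm h]
    have hd : (h : G) ∈ D := Set.mem_biUnion hq h.2
    have h1 := hW g⁻¹ h hd
    rw [abs_le] at h1
    have h2 := hr0 (τ g⁻¹)
    simp only [shift, inv_inv]
    have h3 := hxr (τ (g⁻¹ * h) + p * c) (by lia) (by lia) (g⁻¹ * h)
    rw [hrp] at h3
    rw [h3]
    congr 1
    conv_lhs => rw [mul_assoc, ← hτ' (g⁻¹ * h)]
    rw [← mul_assoc, ← zpow_add, add_comm]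
  · refine ((Set.finite_Icc (0 : ℤ) p).prod hfrange |>.image
      fun (q : ℤ × G) h => x (t ^ r (τ (t ^ q.1 * q.2 * h)) * f (t ^ q.1 * q.2 * h))).subset ?_
    rintro _ ⟨g, rfl⟩
    refine ⟨(τ g % p, f g), ⟨⟨Int.emod_nonneg _ (by lia), (Int.emod_lt_of_pos _ (by lia)).le⟩,
      g, rfl⟩, funext fun h => ?_⟩
    have h1 : g * h = t ^ (p * (τ g / p)) * (t ^ (τ g % p) * f g * h) := by
      conv_lhs => rw [← hτ' g, ← Int.emod_add_mul_ediv (τ g) p, add_comm, zpow_add]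
      simp only [mul_assoc]
    simp only
    rw [h1, hτt, hft, add_comm, hrp]

theorem isSFTDeg_iff_isZeroDeg (σ : Fin k → G)
    (hvc : ∃ K : Subgroup G, K.FiniteIndex ∧ IsCyclic K) (P : Set (ℕ → ℕ)) :
    IsSFTDeg σ P ↔ IsZeroDeg P := by
  constructor
  · rintro ⟨n, X, hX, hne, -, h⟩
    obtain ⟨y, hy, hfin⟩ := exists_finite_translates hX hne hvc
    exact IsZeroDeg.of_baireLE h ⟨_, ⟨_, ⟨y, hy, rfl⟩, rfl⟩,
      computable_confFun_of_computable_word σ y (computable_word_of_finite_translates σ y hfin)⟩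
  · intro h
    refine ⟨1, Set.univ, ⟨[], by simp⟩, ⟨fun _ => 0, trivial⟩, ?_, baireLE_of_computable_mem h⟩
    exact baireLE_of_computable_mem ⟨_, ⟨_, ⟨fun _ => 0, trivial, rfl⟩, rfl⟩,
      computable_confFun_of_computable_word σ _ (Computable.const _)⟩

end VirtuallyCyclic
end MedvedevFormal

namespace MedvedevFormal

/-! ### Subshifts of finite type have `Π⁰₁` degrees -/

section Pi01

open Nat (pair unpair)

theorem isPi01Cantor_of_prefix {B : List ℕ → Bool} (hB : Computable B) :
    IsPi01Cantor {x | x ∈ cantorSpace ∧ ∀ k, B (pref x k) = false} := by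
  have hc : Computable fun n : ℕ => bif B ((Encodable.decode (α := List ℕ) n).getD []) then
      (Encodable.decode (α := List ℕ) n).getD [] else [2] := by
    have h : Computable fun n : ℕ => (Encodable.decode (α := List ℕ) n).getD [] :=
      Computable.option_getD Computable.decode (Computable.const [])
    exact Computable.cond (hB.comp h) h (Computable.const _)
  refine ⟨_, hc, ?_⟩
  ext x
  rw [Set.mem_sdiff, Set.mem_iUnion, not_exists]
  refine and_congr_right fun hx => ⟨fun h n => ?_, fun h k => ?_⟩
  · generalize (Encodable.decode (α := List ℕ) n).getD [] = w
    intro hn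
    cases hb : B w with
    | false =>
      rw [hb] at hn
      have h0 := hn 0 (by simp)
      have h1 := hx 0
      simp only [cond_false, List.getElem_cons_zero] at h0
      lia
    | true =>
      rw [hb] at hn
      have : pref x w.length = w := by
        refine List.ext_getElem (pref_length _ _) fun i h1 h2 => ?_
        have := hn i h2
        simp only [cond_true] at this
        simp [pref, this]
      have hl := h w.length
      rw [this, hb] at hl
      exact absurd hl (by simp)
  · by_contra hb
    rw [Bool.not_eq_false] at hb
    refine h (Encodable.encode (pref x k)) ?_
    rw [Encodable.encodek, Option.getD_some, hb, cond_true]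
    intro i hi
    simp [pref]

/-- The least `c ≤ N` with `b ⟨m, c⟩ = 1`, and `N + 1` if there is none. -/
def unaryDecode (N : ℕ) (b : ℕ → ℕ) (m : ℕ) : ℕ :=
  (List.range (N + 1)).findIdx fun c => decide (b (pair m c) = 1)

theorem primrec_unaryDecode (N : ℕ) :
    Primrec₂ fun (l : List ℕ) m => unaryDecode N (fun i => l.getD i 0) m := by
  refine Primrec.list_findIdx (Primrec.const _) ?_
  exact (Primrec.eq.decide (α := ℕ)).comp ((Primrec.list_getD 0).comp
    (Primrec.fst.comp Primrec.fst)
    (Primrec₂.natPair.comp (Primrec.snd.comp Primrec.fst) Primrec.snd)) (Primrec.const 1)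

theorem unaryDecode_congr {N : ℕ} {b b' : ℕ → ℕ} {m : ℕ}
    (h : ∀ i ≤ pair m N, b i = b' i) : unaryDecode N b m = unaryDecode N b' m := by
  unfold unaryDecode
  have : ∀ c ∈ List.range (N + 1), b (pair m c) = b' (pair m c) := fun c hc => by
    refine h _ ?_
    rcases (Nat.lt_succ_iff.1 (List.mem_range.1 hc)).lt_or_eq with h | rfl
    · exact (Nat.pair_lt_pair_right m h).le
    · exact le_rfl
  generalize List.range (N + 1) = L at this
  induction L with
  | nil => rfl
  | cons a L ih => simp [List.findIdx_cons, this a, ih fun c hc => this c (by simp [hc])]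

theorem unaryDecode_unary {N : ℕ} {y : ℕ → ℕ} {m : ℕ} (hy : y m ≤ N) :
    unaryDecode N (fun i => if y (unpair i).1 = (unpair i).2 then 1 else 0) m = y m := by
  unfold unaryDecode
  rw [List.findIdx_eq (by simpa using hy)]
  simp only [Nat.unpair_pair, List.getElem_range]
  refine ⟨by simp, fun j hj => ?_⟩
  simp [hj.ne']

theorem unaryDecode_pref {N k m : ℕ} (b : ℕ → ℕ) (h : pair m N < k) :
    unaryDecode N (fun i => (pref b k).getD i 0) m = unaryDecode N b m :=
  unaryDecode_congr fun _ hi => pref_getD b (hi.trans_lt h) 0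

theorem exists_pi01_of_bounded (N : ℕ) {B : List ℕ → Bool} (hB : Computable B)
    (hne : {y : ℕ → ℕ | (∀ n, y n ≤ N) ∧ ∀ k, B (pref y k) = false}.Nonempty) :
    IsPi01Deg {y : ℕ → ℕ | (∀ n, y n ≤ N) ∧ ∀ k, B (pref y k) = false} := by
  let dec : List ℕ → List ℕ := fun l =>
    (List.range (Nat.sqrt l.length - (N + 1))).map (unaryDecode N fun i => l.getD i 0)
  have hdec : Computable dec := by
    refine computable_list_map ?_ (primrec_unaryDecode N).to_comp
    exact (Primrec.list_range.comp (Primrec.nat_sub.comp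
      (Primrec.nat_sqrt.comp Primrec.list_length) (Primrec.const _))).to_comp
  have hdecp : ∀ b k, dec (pref b k) = pref (unaryDecode N b) (Nat.sqrt k - (N + 1)) := by
    intro b k
    simp only [dec, pref_length]
    refine List.map_congr_left fun m hm => unaryDecode_pref b ?_
    have h1 := List.mem_range.1 hm
    have h2 := Nat.sqrt_le' k
    have h3 := Nat.pair_lt_max_add_one_sq m N
    have h4 : (max m N + 1) ^ 2 ≤ (Nat.sqrt k) ^ 2 := Nat.pow_le_pow_left (by lia) 2
    lia
  let B' : List ℕ → Bool := fun l => B (dec l) || (dec l).any fun c => decide (N < c)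
  have hB' : Computable B' := computable_or (hB.comp hdec)
    (computable_list_any hdec (computable_decide_lt (Computable.const N) Computable.snd).to₂)
  have hmap : ∀ b, (b ∈ cantorSpace ∧ ∀ k, B' (pref b k) = false) →
      (∀ n, unaryDecode N b n ≤ N) ∧ ∀ k, B (pref (unaryDecode N b) k) = false := by
    rintro b ⟨-, hb⟩
    have hk : ∀ k, B (pref (unaryDecode N b) k) = false ∧ ∀ n < k, unaryDecode N b n ≤ N := by
      intro k
      have := hb ((k + (N + 1)) ^ 2)
      simp only [B', hdecp, Nat.sqrt_eq', Nat.add_sub_cancel, Bool.or_eq_false_iff,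
        List.any_eq_false, decide_eq_true_eq, not_lt] at this
      refine ⟨this.1, fun n hn => this.2 _ ?_⟩
      exact List.mem_map.2 ⟨n, List.mem_range.2 hn, rfl⟩
    exact ⟨fun n => (hk (n + 1)).2 n (by simp), fun k => (hk k).1⟩
  have hmap' : ∀ y : ℕ → ℕ, ((∀ n, y n ≤ N) ∧ ∀ k, B (pref y k) = false) →
      (fun i => if y (unpair i).1 = (unpair i).2 then 1 else 0) ∈
        {b | b ∈ cantorSpace ∧ ∀ k, B' (pref b k) = false} := by
    rintro y ⟨h1, h2⟩
    refine ⟨fun n => ?_, fun k => ?_⟩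
    · dsimp only
      split_ifs <;> simp
    have h3 : unaryDecode N (fun i => if y (unpair i).1 = (unpair i).2 then 1 else 0) = y :=
      funext fun m => unaryDecode_unary (h1 m)
    simp only [B', hdecp, h3, h2, Bool.false_or, List.any_eq_false, decide_eq_true_eq, not_lt]
    intro c hc
    obtain ⟨m, -, rfl⟩ := List.mem_map.1 hc
    exact h1 m
  refine ⟨_, isPi01Cantor_of_prefix hB', ?_, ?_, ?_⟩
  · obtain ⟨y, hy⟩ := hne
    exact ⟨_, hmap' y hy⟩
  · refine baireLE_of_use _ (primrec_unaryDecode N).to_comp (fun n => pair n N + 1)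
      (Primrec.succ.comp (Primrec₂.natPair.comp Primrec.id (Primrec.const N))).to_comp
      fun b hb => ⟨_, hmap b hb, fun n => unaryDecode_pref b (Nat.lt_succ_self _)⟩
  · refine baireLE_of_use (fun l i => bif decide (l.getD (unpair i).1 0 = (unpair i).2) then 1
      else 0) ?_ (fun n => n + 1) Computable.succ fun y hy => ⟨_, hmap' y hy, fun n => ?_⟩
    · refine Computable.cond (computable_decide_eq ?_ ?_) (Computable.const _) (Computable.const _)
      · exact ((Primrec.list_getD 0).comp Primrec.fst
          (Primrec.fst.comp (Primrec.unpair.comp Primrec.snd))).to_comp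
      · exact (Primrec.snd.comp (Primrec.unpair.comp Primrec.snd)).to_comp
    · rw [pref_getD y (Nat.lt_succ_iff.2 (Nat.unpair_left_le n))]
      by_cases h : y (unpair n).1 = (unpair n).2 <;> simp [h]

theorem BaireEquiv.trans {P Q R : Set (ℕ → ℕ)} (h₁ : BaireEquiv P Q) (h₂ : BaireEquiv Q R) :
    BaireEquiv P R := ⟨h₁.1.trans h₂.1, h₂.2.trans h₁.2⟩

theorem BaireEquiv.symm {P Q : Set (ℕ → ℕ)} (h : BaireEquiv P Q) : BaireEquiv Q P := ⟨h.2, h.1⟩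

end Pi01

section

variable {G : Type*} [Group G] {k : ℕ}

/-- The word over the generators with code `m`. -/
def decodeWord (k : ℕ) (m : ℕ) : List (Fin k × Bool) :=
  (Encodable.decode (α := List (Fin k × Bool)) m).getD []

theorem computable_decodeWord : Computable (decodeWord k) :=
  Computable.option_getD Computable.decode (Computable.const [])

/-- Whether `m` codes a word over the generators. -/
def isWordCode (k : ℕ) (m : ℕ) : Bool :=
  (Encodable.decode (α := List (Fin k × Bool)) m).isSome

theorem computable_isWordCode : Computable (isWordCode k) :=
  Primrec.option_isSome.to_comp.comp Computable.decode

theorem isWordCode_encode (w : List (Fin k × Bool)) : isWordCode k (Encodable.encode w) = true := by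
  simp [isWordCode]

theorem decodeWord_encode (w : List (Fin k × Bool)) : decodeWord k (Encodable.encode w) = w := by
  simp [decodeWord]

theorem confFun_of_isWordCode {n : ℕ} (σ : Fin k → G) (x : G → Fin n) {m : ℕ}
    (h : isWordCode k m = true) :
    confFun (x ∘ cover σ) m = x (wordVal σ (decodeWord k m)) + 1 := by
  rw [confFun_comp_cover]
  obtain ⟨w, hw⟩ := Option.isSome_iff_exists.1 h
  simp [hw, decodeWord]
  rfl

theorem confFun_of_not_isWordCode {n : ℕ} (σ : Fin k → G) (x : G → Fin n) {m : ℕ}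
    (h : isWordCode k m = false) : confFun (x ∘ cover σ) m = 0 := by
  rw [confFun_comp_cover]
  have : Encodable.decode (α := List (Fin k × Bool)) m = none := by simpa [isWordCode] using h
  simp [this]

/-- The prefix `l` of a configuration code violates the defining conditions of the pullback
of a subshift of finite type with coded forbidden patterns `F`. -/
def violates (φ : List (Fin k × Bool) → Bool) (F : List (List (List (Fin k × Bool) × ℕ)))
    (l : List ℕ) : Bool :=
  ((List.range l.length).any fun m => decide (isWordCode k m = decide (l.getD m 0 = 0))) ||
  (((List.range l.length).any fun m => (List.range l.length).any fun m' =>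
    isWordCode k m && (isWordCode k m' && (φ (invWord (decodeWord k m) ++ decodeWord k m') &&
      !decide (l.getD m 0 = l.getD m' 0)))) ||
  F.any fun p => (List.range l.length).any fun m => isWordCode k m &&
    p.all fun q => decide (l[Encodable.encode (decodeWord k m ++ q.1)]? = some q.2))

theorem computable_violates {φ : List (Fin k × Bool) → Bool} (hφ : Computable φ)
    (F : List (List (List (Fin k × Bool) × ℕ))) : Computable (violates φ F) := by
  have hr : Computable fun l : List ℕ => List.range l.length :=
    (Primrec.list_range.comp Primrec.list_length).to_comp
  have hget {α : Type} [Primcodable α] {f : α → List ℕ} {g : α → ℕ} (hf : Computable f)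
      (hg : Computable g) : Computable fun a => (f a).getD (g a) 0 :=
    (Primrec.list_getD 0).to_comp.comp hf hg
  have hdw {α : Type} [Primcodable α] {g : α → ℕ}
      (hg : Computable g) : Computable fun a => decodeWord k (g a) :=
    computable_decodeWord.comp hg
  have hiw {α : Type} [Primcodable α] {g : α → ℕ}
      (hg : Computable g) : Computable fun a => isWordCode k (g a) :=
    computable_isWordCode.comp hg
  have hinv : Computable (invWord (k := k)) := primrec_invWord.to_comp
  refine computable_or ?_ (computable_or ?_ ?_)
  · refine computable_list_any hr ?_
    exact computable_decide_eq (hiw Computable.snd)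
      (computable_decide_eq (hget Computable.fst Computable.snd) (Computable.const 0))
  · refine computable_list_any hr ?_
    have : Computable fun p : List ℕ × ℕ => (List.range p.1.length).any fun m' =>
        isWordCode k p.2 && (isWordCode k m' &&
          (φ (invWord (decodeWord k p.2) ++ decodeWord k m') &&
          !decide (p.1.getD p.2 0 = p.1.getD m' 0))) := by
      refine computable_list_any (hr.comp Computable.fst) ?_
      refine computable_and (hiw (Computable.snd.comp Computable.fst))
        (computable_and (hiw Computable.snd) (computable_and (hφ.comp
          (Computable.list_append.comp (hinv.comp (hdw (Computable.snd.comp Computable.fst)))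
            (hdw Computable.snd))) (computable_not (computable_decide_eq
          (hget (Computable.fst.comp Computable.fst) (Computable.snd.comp Computable.fst))
          (hget (Computable.fst.comp Computable.fst) Computable.snd)))))
    exact this
  · refine computable_list_any (Computable.const F) ?_
    have h1 : Computable₂ fun (p : List ℕ × List (List (Fin k × Bool) × ℕ)) (m : ℕ) =>
        isWordCode k m && p.2.all fun q =>
          decide (p.1[Encodable.encode (decodeWord k m ++ q.1)]? = some q.2) := by
      refine computable_and (hiw Computable.snd) (computable_list_all
        (Computable.snd.comp Computable.fst) ?_)
      refine computable_decide_eq (Computable.list_getElem?.comp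
        (Computable.fst.comp (Computable.fst.comp Computable.fst)) (Computable.encode.comp
          (Computable.list_append.comp (hdw (Computable.snd.comp Computable.fst))
            (Computable.fst.comp Computable.snd)))) (Computable.option_some.comp
          (Computable.snd.comp Computable.snd))
    exact computable_list_any (hr.comp Computable.fst) h1

theorem mSet_pullback_eq {σ : Fin k → G} (hσ : IsSymmGen σ) {n : ℕ}
    {φ : List (Fin k × Bool) → Bool} (hφ : ∀ w, φ w = true ↔ wordVal σ w = 1)
    {X : Set (G → Fin n)} (hX : IsSFT X) : ∃ F : List (List (List (Fin k × Bool) × ℕ)),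
    mSet (pullback (cover σ) X) =
      {y | (∀ m, y m ≤ n) ∧ ∀ j, violates φ F (pref y j) = false} := by
  classical
  obtain ⟨F, rfl⟩ := hX
  choose wd hwd using fun g : G => exists_wordVal_eq (τ := σ) (x := g) (hσ.1 ▸ Subgroup.mem_top g)
  let code : Pattern G (Fin n) → List (List (Fin k × Bool) × ℕ) := fun p =>
    p.dom.attach.toList.map fun (h : {g // g ∈ p.dom}) => (wd h, (p.val h : ℕ) + 1)
  have hφ2 : ∀ v w, φ (invWord v ++ w) = true ↔ wordVal σ v = wordVal σ w := fun v w => by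
    rw [hφ, wordVal_append, wordVal_invWord, inv_mul_eq_one]
  refine ⟨F.map code, Set.Subset.antisymm ?_ ?_⟩
  · rintro _ ⟨_, ⟨x, hx, rfl⟩, rfl⟩
    refine ⟨fun m => ?_, fun j => ?_⟩
    · cases h : isWordCode k m
      · simp [confFun_of_not_isWordCode σ x h]
      · have := (x (wordVal σ (decodeWord k m))).2
        simp only [confFun_of_isWordCode σ x h]; lia
    · rw [violates, Bool.or_eq_false_iff, Bool.or_eq_false_iff]
      simp only [List.any_eq_false, pref_length, List.mem_range]
      refine ⟨fun m hm => ?_, fun m hm => ?_, fun p hp => ?_⟩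
      · rw [pref_getD _ hm]
        cases h : isWordCode k m
        · simp [confFun_of_not_isWordCode σ x h]
        · simp [confFun_of_isWordCode σ x h]
      · simp only [Bool.not_eq_true, List.any_eq_false, List.mem_range]
        intro m' hm'
        rw [pref_getD _ hm, pref_getD _ hm']
        rw [← Bool.not_eq_true]
        intro hall
        simp only [Bool.and_eq_true, hφ2, Bool.not_eq_eq_eq_not, Bool.not_true,
          decide_eq_false_iff_not] at hall
        obtain ⟨h, h', he, hne⟩ := hall
        refine hne ?_
        rw [confFun_of_isWordCode σ x h, confFun_of_isWordCode σ x h', he]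
      · obtain ⟨q, hq, rfl⟩ := List.mem_map.1 hp
        simp only [Bool.not_eq_true, List.any_eq_false, List.mem_range, Bool.and_eq_true, not_and,
          List.all_eq_true, decide_eq_true_eq]
        intro m hm h hall
        refine hx q hq (wordVal σ (decodeWord k m))⁻¹ fun g => ?_
        have h1 := hall (wd g, (q.val g : ℕ) + 1)
          (List.mem_map.2 ⟨g, by simp, rfl⟩)
        rw [pref_getElem?] at h1
        split_ifs at h1 with h2
        have h3 := Option.some.inj h1
        rw [confFun_of_isWordCode σ x (isWordCode_encode _), decodeWord_encode, wordVal_append,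
          hwd] at h3
        simpa [shift, Fin.ext_iff] using h3
  · rintro y ⟨hy, hv⟩
    have hv1 : ∀ m, (isWordCode k m = true) ↔ y m ≠ 0 := by
      intro m
      have := hv (m + 1)
      rw [violates, Bool.or_eq_false_iff] at this
      have := List.any_eq_false.1 this.1 m (by simp [pref_length])
      rw [pref_getD _ (Nat.lt_succ_self _)] at this
      simp only [decide_eq_true_eq] at this
      cases h : isWordCode k m <;> simpa [h] using this
    have hv2 : ∀ i j, isWordCode k i = true → isWordCode k j = true →
        wordVal σ (decodeWord k i) = wordVal σ (decodeWord k j) → y i = y j := by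
      intro i j hi hj hvw
      have := hv (max i j + 1)
      rw [violates, Bool.or_eq_false_iff, Bool.or_eq_false_iff] at this
      have h1 : i < max i j + 1 := by lia
      have h2 : j < max i j + 1 := by lia
      have h3 := List.any_eq_false.1 this.2.1 i (by simp [pref_length])
      simp only [Bool.not_eq_true] at h3
      have h4 := List.any_eq_false.1 h3 j (by simp [pref_length])
      rw [pref_getD _ h1, pref_getD _ h2] at h4
      simpa [hi, hj, (hφ2 _ _).2 hvw] using h4
    have hpos : ∀ w : List (Fin k × Bool), y (Encodable.encode w) - 1 < n := fun w => by
      have h1 := (hv1 _).1 (isWordCode_encode w)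
      have h2 := hy (Encodable.encode w)
      lia
    let x : G → Fin n := fun g => ⟨_, hpos (wd g)⟩
    have hxy : ∀ w : List (Fin k × Bool), (x (wordVal σ w) : ℕ) + 1 = y (Encodable.encode w) := by
      intro w
      have h1 := (hv1 _).1 (isWordCode_encode w)
      have h2 := hv2 _ _ (isWordCode_encode (wd (wordVal σ w))) (isWordCode_encode w)
        (by simp only [decodeWord_encode, hwd])
      simp only [x]
      lia
    refine ⟨x ∘ cover σ, ⟨x, ?_, rfl⟩, funext fun m => ?_⟩
    · intro p hp g hm
      have hB : ∃ j, ∀ w ∈ (code p).map (fun q => Encodable.encode (wd g⁻¹ ++ q.1)), w < j := by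
        obtain ⟨j, hj⟩ := (List.finite_toSet
          ((code p).map (fun q => Encodable.encode (wd g⁻¹ ++ q.1)))).bddAbove
        exact ⟨j + 1, fun w hw => Nat.lt_succ_iff.2 (hj hw)⟩
      obtain ⟨j, hj⟩ := hB
      have := hv (max j (Encodable.encode (wd g⁻¹) + 1))
      rw [violates, Bool.or_eq_false_iff, Bool.or_eq_false_iff] at this
      have h1 := List.any_eq_false.1 this.2.2 _ (List.mem_map.2 ⟨p, hp, rfl⟩)
      simp only [Bool.not_eq_true] at h1
      have h2 := List.any_eq_false.1 h1 (Encodable.encode (wd g⁻¹)) (by simp [pref_length])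
      refine h2 ?_
      simp only [isWordCode_encode, decodeWord_encode, Bool.true_and, List.all_eq_true,
        decide_eq_true_eq]
      intro q hq
      have h3 := hj _ (List.mem_map.2 ⟨q, hq, rfl⟩)
      rw [pref_getElem?, if_pos (by lia), ← hxy, wordVal_append, hwd]
      obtain ⟨h, -, rfl⟩ := List.mem_map.1 hq
      have h4 := hm h
      simp only [shift] at h4
      simp only [hwd, h4]
    · cases h : isWordCode k m
      · rw [confFun_of_not_isWordCode σ x h]
        have := hv1 m
        simp only [h, Bool.false_eq_true, false_iff, ne_eq, not_not] at this
        exact this.symm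
      · rw [confFun_of_isWordCode σ x h, hxy]
        exact hv2 _ _ (isWordCode_encode _) h (by rw [decodeWord_encode])

theorem IsSFTDeg.isPi01Deg {σ : Fin k → G} (hσ : IsSymmGen σ)
    (hvp : ∃ K : Subgroup G, K.FiniteIndex ∧ IsPolycyclic K) {P : Set (ℕ → ℕ)}
    (h : IsSFTDeg σ P) : IsPi01Deg P := by
  obtain ⟨n, X, hX, hne, hP⟩ := h
  obtain ⟨φ, hφ, hφ'⟩ := decidableMembership_of_polycyclic hvp σ ⊥
  obtain ⟨F, hF⟩ := mSet_pullback_eq hσ (φ := φ) (by simpa using hφ') hX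
  have hne' : (mSet (pullback (cover σ) X)).Nonempty := (hne.image _).image _
  rw [hF] at hP hne'
  obtain ⟨Q, hQ, hQne, hQe⟩ := exists_pi01_of_bounded n (computable_violates hφ F) hne'
  exact ⟨Q, hQ, hQne, hP.symm.trans hQe⟩

end
end MedvedevFormal

namespace MedvedevFormal

/-! ### A rigid ternary hierarchy in the plane -/

theorem exists_three_pow_mul {m : ℕ} {x : ℤ} (h : ¬(3 : ℤ) ^ (m + 1) ∣ x) :
    ∃ m' ≤ m, ∃ d : ℤ, ¬3 ∣ d ∧ x = 3 ^ m' * d := by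
  induction m generalizing x with
  | zero => exact ⟨0, le_rfl, x, by simpa using h, by simp⟩
  | succ m ih =>
    by_cases h3 : (3 : ℤ) ∣ x
    · obtain ⟨w, rfl⟩ := h3
      obtain ⟨m', hm', d, hd, rfl⟩ := ih (x := w) fun hw => h (by
        rw [pow_succ']; exact mul_dvd_mul_left 3 hw)
      exact ⟨m' + 1, by lia, d, hd, by rw [pow_succ']; ring⟩
    · exact ⟨0, by lia, x, h3, by simp⟩

/-- Counters `P`, `Q` modulo 9 along rows and columns, incremented at the cells marked by `E`
and `F`, together with labels `c`, `z` of columns and `r`, `y` of rows and local rules that force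
a ternary hierarchy with finest level based at `(a, b)`. -/
structure IsHierarchy (P Q : ℤ → ℤ → ℤ) (E F : ℤ → ℤ → Prop) (c r : ℤ → ℤ) (z y : ℤ → Bool)
    (a b : ℤ) : Prop where
  P_range : ∀ i j, 0 ≤ P i j ∧ P i j < 9
  Q_range : ∀ i j, 0 ≤ Q i j ∧ Q i j < 9
  P_succ : ∀ i j, E (i + 1) j → P (i + 1) j = (P i j + 1) % 9
  P_same : ∀ i j, ¬E (i + 1) j → P (i + 1) j = P i j
  Q_succ : ∀ i j, F i (j + 1) → Q i (j + 1) = (Q i j + 1) % 9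
  Q_same : ∀ i j, ¬F i (j + 1) → Q i (j + 1) = Q i j
  col_base : ∀ i j, ¬3 ∣ i - a → F i j ∧ Q i j = (j - b) % 9 ∧ c i = (i - a) % 9
  row_base : ∀ i j, ¬3 ∣ j - b → E i j ∧ P i j = (i - a) % 9 ∧ r j = (j - b) % 9
  not_F : ∀ i j, E i j → P i j % 3 = 0 → ¬F i j
  not_E : ∀ i j, F i j → Q i j % 3 = 0 → ¬E i j
  cross_iff : ∀ i j, (E i j ∧ P i j % 3 ≠ 0) ↔ (F i j ∧ Q i j % 3 ≠ 0)
  cross : ∀ i j, E i j → P i j % 3 ≠ 0 → P i j = c i ∧ Q i j = r j ∧ z i = y j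
  col_link : ∀ i j, F i j → (Q i j = 3 ∨ Q i j = 6) → P i j % 3 = c i / 3
  row_link : ∀ i j, E i j → (P i j = 3 ∨ P i j = 6) → Q i j % 3 = r j / 3

/-- The columns of level at most `m` are as in the hierarchy based at `(a, b)`. -/
def ColsKnown (Q : ℤ → ℤ → ℤ) (F : ℤ → ℤ → Prop) (c : ℤ → ℤ) (a b : ℤ) (m : ℕ) : Prop :=
  ∀ m' ≤ m, ∀ d : ℤ, ¬3 ∣ d → ∀ j, (F (a + 3 ^ m' * d) j ↔ 3 ^ m' ∣ j - b) ∧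
    Q (a + 3 ^ m' * d) j = (j - b) / 3 ^ m' % 9 ∧ c (a + 3 ^ m' * d) = d % 9

theorem ColsKnown.shift {Q : ℤ → ℤ → ℤ} {F : ℤ → ℤ → Prop} {c : ℤ → ℤ} {a b : ℤ} {m : ℕ}
    (h : ColsKnown Q F c a b m) (s t : ℤ) :
    ColsKnown Q F c (a - 3 ^ (m + 2) * s) (b - 3 ^ (m + 2) * t) m := by
  intro m' hm' d hd j
  obtain ⟨e, rfl⟩ := Nat.exists_eq_add_of_le hm'
  have h9 : (3 : ℤ) ^ (m' + e + 2) = 3 ^ m' * (9 * 3 ^ e) := by ring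
  have h0 : (3 : ℤ) ^ m' ≠ 0 := by positivity
  have hd' : ¬3 ∣ d - 9 * 3 ^ e * s := fun h' => hd (by
    have : (3 : ℤ) ∣ 9 * 3 ^ e * s := ⟨3 * 3 ^ e * s, by ring⟩
    simpa using dvd_add h' this)
  have := h m' hm' _ hd' j
  rw [show a + 3 ^ m' * (d - 9 * 3 ^ e * s) = a - 3 ^ (m' + e + 2) * s + 3 ^ m' * d by
    rw [h9]; ring] at this
  obtain ⟨h1, h2, h3⟩ := this
  have hj : j - (b - 3 ^ (m' + e + 2) * t) = (j - b) + 3 ^ m' * (9 * (3 ^ e * t)) := by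
    rw [h9]; ring
  refine ⟨?_, ?_, ?_⟩
  · rw [h1, hj]
    exact (dvd_add_left (dvd_mul_right _ _)).symm
  · rw [h2, hj, Int.add_mul_ediv_left _ _ h0, Int.add_mul_emod_self_left]
  · rw [h3, mul_assoc, Int.sub_mul_emod_self_left]

section

variable {P Q : ℤ → ℤ → ℤ} {E F : ℤ → ℤ → Prop} {c r : ℤ → ℤ} {z y : ℤ → Bool} {a₀ b₀ : ℤ}

theorem IsHierarchy.symm (h : IsHierarchy P Q E F c r z y a₀ b₀) :
    IsHierarchy (fun i j => Q j i) (fun i j => P j i) (fun i j => F j i) (fun i j => E j i)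
      r c y z b₀ a₀ where
  P_range i j := h.Q_range j i
  Q_range i j := h.P_range j i
  P_succ i j := h.Q_succ j i
  P_same i j := h.Q_same j i
  Q_succ i j := h.P_succ j i
  Q_same i j := h.P_same j i
  col_base i j := h.row_base j i
  row_base i j := h.col_base j i
  not_F i j := h.not_E j i
  not_E i j := h.not_F j i
  cross_iff i j := (h.cross_iff j i).symm
  cross i j h1 h2 := by
    obtain ⟨h3, h4⟩ := (h.cross_iff j i).2 ⟨h1, h2⟩
    obtain ⟨h5, h6, h7⟩ := h.cross j i h3 h4
    exact ⟨h6, h5, h7.symm⟩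
  col_link i j := h.row_link j i
  row_link i j := h.col_link j i

theorem IsHierarchy.not_mark_of_deep (h : IsHierarchy P Q E F c r z y a₀ b₀) {a b : ℤ} {m : ℕ}
    (hr : ColsKnown (fun i j => P j i) (fun i j => E j i) r b a m) {i j : ℤ}
    (hi : 3 ^ (m + 1) ∣ i - a) (hj : ¬3 ^ (m + 1) ∣ j - b) : ¬F i j := by
  obtain ⟨d, hd⟩ := hi
  obtain ⟨m', hm', e, he, hje⟩ := exists_three_pow_mul hj
  obtain ⟨h1, h2, -⟩ := hr m' hm' e he i
  rw [← hje, show b + (j - b) = j by ring] at h1 h2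
  obtain ⟨f, rfl⟩ := Nat.exists_eq_add_of_le hm'
  have hia : i - a = 3 ^ m' * (3 * (3 ^ f * d)) := by
    rw [hd]; ring
  refine h.not_F i j (h1.2 ⟨_, hia⟩) ?_
  have h3 : P i j = (i - a) / 3 ^ m' % 9 := h2
  rw [h3, hia, Int.mul_ediv_cancel_left _ (by positivity)]
  lia

/-- The columns of level `m + 1`, up to an offset in their counter. -/
theorem IsHierarchy.next_column (h : IsHierarchy P Q E F c r z y a₀ b₀) {a b : ℤ} {m : ℕ}
    (hr : ColsKnown (fun i j => P j i) (fun i j => E j i) r b a m) {d : ℤ}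
    (hd : ¬3 ∣ d) : Q (a + 3 ^ (m + 1) * d) b % 3 = 0 ∧
      ∀ j, (F (a + 3 ^ (m + 1) * d) j ↔ 3 ^ (m + 1) ∣ j - b) ∧
        Q (a + 3 ^ (m + 1) * d) j =
          (Q (a + 3 ^ (m + 1) * d) b + (j - b) / 3 ^ (m + 1)) % 9 := by
  set M : ℤ := 3 ^ (m + 1) with hM
  set i := a + M * d with hi
  have hMm : M = 3 * 3 ^ m := by rw [hM, pow_succ']
  have hMpos : 0 < M := by positivity
  have hmpos : (0 : ℤ) < 3 ^ m := by positivity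
  have hoff : ∀ j, ¬M ∣ j - b → ¬F i j := fun j hj =>
    h.not_mark_of_deep hr (by rw [hi, add_sub_cancel_left]; exact dvd_mul_right _ _) hj
  have hhold : ∀ s : ℤ, ∀ e : ℕ, (e : ℤ) < M → Q i (b + M * s + e) = Q i (b + M * s) := by
    intro s e
    induction e with
    | zero => simp
    | succ e ih =>
      intro he
      push_cast at he ⊢
      rw [← ih (by lia), ← add_assoc]
      refine h.Q_same i _ (hoff _ fun ⟨w, hw⟩ => ?_)
      have h1 : (e : ℤ) + 1 = M * (w - s) := by linarith
      have h2 : M ∣ (e : ℤ) + 1 := ⟨_, h1⟩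
      have := Int.le_of_dvd (by lia) h2
      lia
  have hmod : ∀ s : ℤ, Q i (b + M * s) % 3 = s % 3 := by
    intro s
    have h3s : ¬(3 : ℤ) ∣ 3 * s + 1 := by lia
    obtain ⟨h1, h2, h3⟩ := hr m le_rfl (3 * s + 1) h3s i
    have hj : b + 3 ^ m * (3 * s + 1) = b + M * s + (3 ^ m : ℕ) := by
      rw [hMm]; push_cast; ring
    have hia : i - a = 3 ^ m * (3 * d) := by rw [hi, hMm]; ring
    have h4 : P i (b + 3 ^ m * (3 * s + 1)) = (i - a) / 3 ^ m % 9 := h2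
    rw [hia, Int.mul_ediv_cancel_left _ hmpos.ne'] at h4
    have h5 := h.row_link i _ (h1.2 ⟨_, hia⟩) (by lia)
    rw [h3, hj, hhold s _ (by push_cast; lia)] at h5
    lia
  have hstep : ∀ s : ℤ, F i (b + M * (s + 1)) ∧ Q i (b + M * (s + 1)) = (Q i (b + M * s) + 1) % 9 := by
    intro s
    have h1 := hhold s (M.toNat - 1) (by lia)
    have h2 : b + M * (s + 1) = b + M * s + (M.toNat - 1 : ℕ) + 1 := by
      rw [mul_add]
      lia
    have h3 : F i (b + M * (s + 1)) := by
      by_contra hF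
      rw [h2] at hF
      have h4 := h.Q_same i _ hF
      rw [h1, ← h2] at h4
      have h5 := hmod s
      have h6 := hmod (s + 1)
      rw [h4] at h6
      lia
    refine ⟨h3, ?_⟩
    rw [h2] at h3 ⊢
    rw [h.Q_succ i _ h3, h1]
  have hQ : ∀ s : ℤ, Q i (b + M * s) = (Q i b + s) % 9 := by
    intro s
    induction s using Int.induction_on with
    | zero => have := h.Q_range i b; simp; lia
    | succ s ih => rw [(hstep s).2, ih]; lia
    | pred s ih =>
      have h1 := (hstep (-s - 1)).2
      have h2 := h.Q_range i (b + M * (-s - 1))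
      rw [show (-s - 1 + 1 : ℤ) = -s by ring, ih] at h1
      lia
  refine ⟨by simpa using hmod 0, fun j => ⟨⟨fun hF => by_contra fun hj => hoff j hj hF, ?_⟩, ?_⟩⟩
  · rintro ⟨s, hs⟩
    have := (hstep (s - 1)).1
    rwa [sub_add_cancel, ← hs, show b + (j - b) = j by ring] at this
  · have h1 := Int.emod_add_mul_ediv (j - b) M
    have h2 := Int.emod_nonneg (j - b) hMpos.ne'
    have h3 := Int.emod_lt_of_pos (j - b) hMpos
    have h4 := hhold ((j - b) / M) ((j - b) % M).toNat (by lia)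
    rw [← hQ, ← h4]
    congr 1
    lia

theorem IsHierarchy.exists_known (h : IsHierarchy P Q E F c r z y a₀ b₀) (m : ℕ) :
    ∃ a b, ColsKnown Q F c a b m ∧ ColsKnown (fun i j => P j i) (fun i j => E j i) r b a m := by
  induction m with
  | zero =>
    refine ⟨a₀, b₀, fun m' hm' d hd j => ?_, fun m' hm' d hd j => ?_⟩
    · obtain rfl : m' = 0 := by lia
      have := h.col_base (a₀ + d) j (by simpa using hd)
      simpa using this
    · obtain rfl : m' = 0 := by lia
      have := h.row_base j (b₀ + d) (by simpa using hd)
      simpa using this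
  | succ m ih =>
    obtain ⟨a, b, hc, hr⟩ := ih
    set M : ℤ := 3 ^ (m + 1) with hM
    have hMpos : 0 < M := by positivity
    have hcol := fun d hd => h.next_column hr (d := d) hd
    have hrow := fun d hd => h.symm.next_column hc (d := d) hd
    simp only [← hM] at hcol hrow
    have hcross : ∀ d e : ℤ, ¬3 ∣ d → ¬3 ∣ e →
        c (a + M * d) = (P a (b + M * e) + d) % 9 ∧ r (b + M * e) = (Q (a + M * d) b + e) % 9 := by
      intro d e hd he
      obtain ⟨hc0, hc1⟩ := hcol d hd
      obtain ⟨hr0, hr1⟩ := hrow e he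
      obtain ⟨h1, h2⟩ := hc1 (b + M * e)
      obtain ⟨h3, h4⟩ := hr1 (a + M * d)
      rw [add_sub_cancel_left, Int.mul_ediv_cancel_left _ hMpos.ne'] at h2 h4
      rw [add_sub_cancel_left] at h1 h3
      obtain ⟨h5, h6, -⟩ := h.cross (a + M * d) (b + M * e) (h3.2 ⟨_, rfl⟩) (by lia)
      exact ⟨by rw [← h5, h4], by rw [← h6, h2]⟩
    obtain ⟨s, hs⟩ : ∃ s : ℤ, ∀ e : ℤ, ¬3 ∣ e → P a (b + M * e) = 3 * s := by
      refine ⟨P a (b + M * 1) / 3, fun e he => ?_⟩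
      have h1 := (hcross 1 1 (by lia) (by lia)).1
      have h2 := (hcross 1 e (by lia) he).1
      have h3 := (hrow 1 (by lia)).1
      have h4 := h.P_range a (b + M * 1)
      have h5 := h.P_range a (b + M * e)
      lia
    obtain ⟨t, ht⟩ : ∃ t : ℤ, ∀ e : ℤ, ¬3 ∣ e → Q (a + M * e) b = 3 * t := by
      refine ⟨Q (a + M * 1) b / 3, fun e he => ?_⟩
      have h1 := (hcross 1 1 (by lia) (by lia)).2
      have h2 := (hcross e 1 he (by lia)).2
      have h3 := (hcol 1 (by lia)).1
      have h4 := h.Q_range (a + M * 1) b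
      have h5 := h.Q_range (a + M * e) b
      lia
    have h9 : (3 : ℤ) ^ (m + 2) = M * 3 := by rw [hM, pow_succ]
    refine ⟨a - 3 ^ (m + 2) * s, b - 3 ^ (m + 2) * t, ?_, ?_⟩
    · intro m' hm' d hd j
      rcases Nat.lt_or_ge m m' with hlt | hge
      · obtain rfl : m' = m + 1 := by lia
        have hd' : ¬(3 : ℤ) ∣ d - 3 * s := by lia
        have hpt : a - 3 ^ (m + 2) * s + M * d = a + M * (d - 3 * s) := by rw [h9]; ring
        have hj : j - (b - 3 ^ (m + 2) * t) = (j - b) + M * (3 * t) := by rw [h9]; ring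
        obtain ⟨h1, h2⟩ := (hcol _ hd').2 j
        rw [← hM, hpt, hj, h1, h2, ht _ hd', (hcross _ 1 hd' (by lia)).1, hs _ (by lia),
          Int.add_mul_ediv_left _ _ hMpos.ne']
        exact ⟨(dvd_add_left (dvd_mul_right _ _)).symm, by ring_nf, by ring_nf⟩
      · exact hc.shift s t m' hge d hd j
    · intro m' hm' d hd j
      rcases Nat.lt_or_ge m m' with hlt | hge
      · obtain rfl : m' = m + 1 := by lia
        have hd' : ¬(3 : ℤ) ∣ d - 3 * t := by lia
        have hpt : b - 3 ^ (m + 2) * t + M * d = b + M * (d - 3 * t) := by rw [h9]; ring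
        have hj : j - (a - 3 ^ (m + 2) * s) = (j - a) + M * (3 * s) := by rw [h9]; ring
        obtain ⟨h1, h2⟩ := (hrow _ hd').2 j
        rw [← hM, hpt, hj]
        dsimp only
        rw [h1, h2, hs _ hd', (hcross 1 _ (by lia) hd').2, ht _ (by lia),
          Int.add_mul_ediv_left _ _ hMpos.ne']
        exact ⟨(dvd_add_left (dvd_mul_right _ _)).symm, by ring_nf, by ring_nf⟩
      · exact hr.shift t s m' hge d hd j

theorem IsHierarchy.label_eq (h : IsHierarchy P Q E F c r z y a₀ b₀) {a b : ℤ} {m m' : ℕ}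
    (hc : ColsKnown Q F c a b m) (hm : m' ≤ m) {d e : ℤ}
    (hd : ¬3 ∣ d) (he : ¬3 ∣ e) : z (a + 3 ^ m' * d) = y (b + 3 ^ m' * e) := by
  obtain ⟨h1, h2, -⟩ := hc m' hm d hd (b + 3 ^ m' * e)
  rw [add_sub_cancel_left, Int.mul_ediv_cancel_left _ (by positivity)] at h2
  rw [add_sub_cancel_left] at h1
  obtain ⟨h3, h4⟩ := (h.cross_iff _ _).2 ⟨h1.2 ⟨_, rfl⟩, by lia⟩
  exact (h.cross _ _ h3 h4).2.2

end
end MedvedevFormal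

namespace MedvedevFormal

/-! ### Boards -/

/-- The natural number `t` has no ternary digit equal to `1`. -/
def IsFree (t : ℕ) : Prop := ∀ s, t / 3 ^ s % 3 ≠ 1

theorem isFree_zero : IsFree 0 := fun s => by simp

theorem IsFree.three_mul {t : ℕ} (h : IsFree t) : IsFree (3 * t) := fun s => by
  cases s with
  | zero => simp
  | succ s =>
    rw [pow_succ', Nat.mul_div_mul_left _ _ (by norm_num)]
    exact h s

theorem isFree_two_mul_pow (s : ℕ) : IsFree (2 * 3 ^ s) := by
  induction s with
  | zero =>
    intro s
    cases s with
    | zero => simp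
    | succ s =>
      have : 2 * 3 ^ 0 < 3 ^ (s + 1) := by have := Nat.one_le_pow s 3 (by norm_num); rw [pow_succ]; lia
      rw [Nat.div_eq_of_lt this]; simp
  | succ s ih => rw [show 2 * 3 ^ (s + 1) = 3 * (2 * 3 ^ s) by ring]; exact ih.three_mul

theorem infinite_isFree : (Set.ofPred IsFree).Infinite :=
  Set.infinite_of_injective_forall_mem (f := fun s => 2 * 3 ^ s)
    (fun a b h => Nat.pow_right_injective le_rfl (by simpa using h)) isFree_two_mul_pow

/-- The `k`-th natural number without ternary digit `1`. -/
noncomputable def freePos (k : ℕ) : ℕ := Nat.nth IsFree k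

theorem isFree_freePos (k : ℕ) : IsFree (freePos k) := Nat.nth_mem_of_infinite infinite_isFree k

theorem freePos_strictMono : StrictMono freePos := Nat.nth_strictMono infinite_isFree

theorem freePos_zero : freePos 0 = 0 := Nat.nth_zero_of_zero isFree_zero

theorem not_isFree_of_between {k t : ℕ} (h1 : freePos k < t) (h2 : t < freePos (k + 1)) :
    ¬IsFree t := fun h => absurd (Nat.le_nth_of_lt_nth_succ h2 h) (not_le.2 h1)

/-- The level of the `k`-th column of a board. -/
noncomputable def freeLevel (k : ℕ) : ℕ := padicValNat 3 (freePos k)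

theorem exists_freePos_eq {k : ℕ} (hk : 0 < k) :
    ∃ d, ¬3 ∣ d ∧ freePos k = 3 ^ freeLevel k * d := by
  have h0 : freePos k ≠ 0 := by
    have := freePos_strictMono hk
    lia
  have := Fact.mk Nat.prime_three
  obtain ⟨d, hd⟩ := pow_padicValNat_dvd (p := 3) (n := freePos k)
  refine ⟨d, ?_, hd⟩
  rintro ⟨e, rfl⟩
  refine pow_succ_padicValNat_not_dvd (p := 3) h0 ⟨e, ?_⟩
  rw [pow_succ, mul_assoc]
  exact hd

/-- The phase of a bracket transducer is active exactly between matching brackets of the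
lowest relevant level. -/
theorem phase_eq_one_iff {w : ℤ → ℤ} {O C : ℤ → Prop} {a : ℤ} {s : ℕ}
    (hw : ∀ i, 0 ≤ w i ∧ w i < 3) (hO : ∀ i, O (i + 1) → w i ≠ 1 ∧ w (i + 1) ≠ 2)
    (hC : ∀ i, C (i + 1) → w i ≠ 0 ∧ w (i + 1) ≠ 1)
    (hN : ∀ i, ¬O (i + 1) → ¬C (i + 1) → w (i + 1) = w i ∨ w i = 2 ∧ w (i + 1) = 0)
    (hlow : ∀ m < s, ∀ d : ℤ, ¬3 ∣ d → ¬O (a + 3 ^ m * d) ∧ ¬C (a + 3 ^ m * d))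
    (hs1 : ∀ d : ℤ, d % 3 = 1 → O (a + 3 ^ s * d)) (hs2 : ∀ d : ℤ, d % 3 = 2 → C (a + 3 ^ s * d))
    (i : ℤ) : w i = 1 ↔ (i - a) / 3 ^ s % 3 = 1 := by
  set D : ℤ := 3 ^ s with hD
  have hDpos : 0 < D := by positivity
  have hnone : ∀ q : ℤ, ∀ e : ℕ, 0 < e → (e : ℤ) < D → ¬O (a + D * q + e) ∧ ¬C (a + D * q + e) := by
    intro q e he heD
    cases s with
    | zero => simp at hD; lia
    | succ s =>
      obtain ⟨m, hm, d, hd, h⟩ := exists_three_pow_mul (m := s) (x := D * q + e) fun h => by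
        have h2 : D ∣ (e : ℤ) := (dvd_add_right (dvd_mul_right D q)).1 h
        have := Int.le_of_dvd (by lia) h2
        lia
      rw [add_assoc, h]
      exact hlow m (by lia) d hd
  have hblock : ∀ q : ℤ, ∀ e : ℕ, (e : ℤ) < D → (w (a + D * q + e) = 1 ↔ w (a + D * q) = 1) ∧
      (w (a + D * q) = 0 → w (a + D * q + e) = 0) := by
    intro q e
    induction e with
    | zero => simp
    | succ e ih =>
      intro he
      obtain ⟨h1, h2⟩ := ih (by push_cast at he; lia)
      obtain ⟨h3, h4⟩ := hnone q (e + 1) (by lia) he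
      rw [Nat.cast_succ, ← add_assoc] at h3 h4 ⊢
      have := hN _ h3 h4
      lia
  have hlast : ∀ q : ℤ, a + D * (q + 1) = a + D * q + (D.toNat - 1 : ℕ) + 1 := fun q => by
    rw [mul_add]; lia
  have hstart : ∀ q : ℤ, w (a + D * q) = 1 ↔ q % 3 = 1 := by
    intro q
    have hq := hblock q (D.toNat - 1) (by lia)
    have hr := hw (a + D * q)
    have h3 := hlast q
    have h4 := hlast (q - 1)
    rw [sub_add_cancel] at h4
    rcases (by lia : q % 3 = 0 ∨ q % 3 = 1 ∨ q % 3 = 2) with h | h | h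
    · have h1 := hs1 (q + 1) (by lia)
      rw [h3] at h1
      have := hO _ h1
      lia
    · have h1 := hs1 q h
      have h2 := hs2 (q + 1) (by lia)
      rw [h3] at h2
      have h5 := hC _ h2
      rw [h4] at h1
      have h6 := hO _ h1
      rw [← h4] at h6
      lia
    · have h1 := hs2 q h
      rw [h4] at h1
      have h6 := hC _ h1
      rw [← h4] at h6
      lia
  have h1 := Int.emod_add_mul_ediv (i - a) D
  have h2 := Int.emod_nonneg (i - a) hDpos.ne'
  have h3 := Int.emod_lt_of_pos (i - a) hDpos
  have h4 := (hblock ((i - a) / D) ((i - a) % D).toNat (by lia)).1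
  rw [← hstart, ← h4]
  have : a + D * ((i - a) / D) + ((i - a) % D).toNat = i := by lia
  rw [this]

/-- The local rules of a tiling problem on the quadrant: `left` for the tiles of the leftmost
column, `bot` for those of the bottom row (depending on the label of the column), and the
horizontal and vertical adjacency relations. -/
structure QuadrantRules (T : Type*) where
  left : T → Prop
  bot : T → Bool → Prop
  horiz : T → T → Prop
  vert : T → T → Prop

/-- A layer over a hierarchy in which the phases `wr`, `wc` mark boards, on the nodes of which
the tiles `HW`, `VW` solve a tiling problem. -/
structure IsBoardLayer {T : Type*} (R : QuadrantRules T) (P Q : ℤ → ℤ → ℤ) (c r : ℤ → ℤ)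
    (z : ℤ → Bool) (wr wc : ℤ → ℤ → ℤ) (HW VW : ℤ → ℤ → T) : Prop where
  wr_range : ∀ i j, 0 ≤ wr i j ∧ wr i j < 3
  wc_range : ∀ i j, 0 ≤ wc i j ∧ wc i j < 3
  row_open : ∀ i j, Q (i + 1) j % 3 = 1 → c (i + 1) % 3 = 1 → wr i j ≠ 1 ∧ wr (i + 1) j ≠ 2
  row_close : ∀ i j, Q (i + 1) j % 3 = 1 → c (i + 1) % 3 = 2 → wr i j ≠ 0 ∧ wr (i + 1) j ≠ 1
  row_none : ∀ i j, (Q (i + 1) j % 3 = 1 → c (i + 1) % 3 = 0) →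
    wr (i + 1) j = wr i j ∨ wr i j = 2 ∧ wr (i + 1) j = 0
  col_open : ∀ i j, P i (j + 1) % 3 = 1 → r (j + 1) % 3 = 1 → wc i j ≠ 1 ∧ wc i (j + 1) ≠ 2
  col_close : ∀ i j, P i (j + 1) % 3 = 1 → r (j + 1) % 3 = 2 → wc i j ≠ 0 ∧ wc i (j + 1) ≠ 1
  col_none : ∀ i j, (P i (j + 1) % 3 = 1 → r (j + 1) % 3 = 0) →
    wc i (j + 1) = wc i j ∨ wc i j = 2 ∧ wc i (j + 1) = 0
  row_pass : ∀ i j, wr (i + 1) j = 1 → wc (i + 1) j ≠ 1 → HW (i + 1) j = HW i j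
  col_pass : ∀ i j, wc i (j + 1) = 1 → wr i (j + 1) ≠ 1 → VW i (j + 1) = VW i j
  node_eq : ∀ i j, wr i j = 1 → wc i j = 1 → HW i j = VW i j
  node_left : ∀ i j, wr i j = 1 → wc i j = 1 → Q i j % 3 = 1 → c i % 3 = 1 → R.left (HW i j)
  node_horiz : ∀ i j, wr (i + 1) j = 1 → wc (i + 1) j = 1 →
    ¬(Q (i + 1) j % 3 = 1 ∧ c (i + 1) % 3 = 1) → R.horiz (HW i j) (HW (i + 1) j)
  node_bot : ∀ i j, wr i j = 1 → wc i j = 1 → P i j % 3 = 1 → r j % 3 = 1 → R.bot (VW i j) (z i)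
  node_vert : ∀ i j, wr i (j + 1) = 1 → wc i (j + 1) = 1 →
    ¬(P i (j + 1) % 3 = 1 ∧ r (j + 1) % 3 = 1) → R.vert (VW i j) (VW i (j + 1))

section

variable {T : Type*} {R : QuadrantRules T} {P Q : ℤ → ℤ → ℤ} {E F : ℤ → ℤ → Prop} {c r : ℤ → ℤ}
  {z : ℤ → Bool} {wr wc : ℤ → ℤ → ℤ} {HW VW : ℤ → ℤ → T} {a b : ℤ} {N : ℕ}

theorem IsBoardLayer.row_phase (h : IsBoardLayer R P Q c r z wr wc HW VW)
    (hc : ColsKnown Q F c a b N) {j : ℤ} {s : ℕ} (hsN : s ≤ N) (hs : (j - b) / 3 ^ s % 3 = 1)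
    (hlow : ∀ m < s, (j - b) / 3 ^ m % 3 ≠ 1) (i : ℤ) :
    wr i j = 1 ↔ (i - a) / 3 ^ s % 3 = 1 := by
  refine phase_eq_one_iff (w := fun i => wr i j) (O := fun i => Q i j % 3 = 1 ∧ c i % 3 = 1)
    (C := fun i => Q i j % 3 = 1 ∧ c i % 3 = 2) (fun i => h.wr_range i j)
    (fun i hi => h.row_open i j hi.1 hi.2) (fun i hi => h.row_close i j hi.1 hi.2)
    (fun i h1 h2 => h.row_none i j (by lia)) ?_ ?_ ?_ i
  · intro m hm d hd
    obtain ⟨-, h1, -⟩ := hc m (by lia) d hd j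
    have := hlow m hm
    lia
  · intro d hd
    obtain ⟨-, h1, h2⟩ := hc s hsN d (by lia) j
    lia
  · intro d hd
    obtain ⟨-, h1, h2⟩ := hc s hsN d (by lia) j
    lia

theorem IsBoardLayer.col_phase (h : IsBoardLayer R P Q c r z wr wc HW VW)
    (hr : ColsKnown (fun i j => P j i) (fun i j => E j i) r b a N) {i : ℤ} {s : ℕ} (hsN : s ≤ N)
    (hs : (i - a) / 3 ^ s % 3 = 1) (hlow : ∀ m < s, (i - a) / 3 ^ m % 3 ≠ 1) (j : ℤ) :
    wc i j = 1 ↔ (j - b) / 3 ^ s % 3 = 1 := by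
  refine phase_eq_one_iff (w := fun j => wc i j) (O := fun j => P i j % 3 = 1 ∧ r j % 3 = 1)
    (C := fun j => P i j % 3 = 1 ∧ r j % 3 = 2) (fun j => h.wc_range i j)
    (fun j hi => h.col_open i j hi.1 hi.2) (fun j hi => h.col_close i j hi.1 hi.2)
    (fun j h1 h2 => h.col_none i j (by lia)) ?_ ?_ ?_ j
  · intro m hm d hd
    obtain ⟨-, h1, -⟩ := hr m (by lia) d hd i
    have := hlow m hm
    lia
  · intro d hd
    obtain ⟨-, h1, h2⟩ := hr s hsN d (by lia) i
    lia
  · intro d hd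
    obtain ⟨-, h1, h2⟩ := hr s hsN d (by lia) i
    lia

end
end MedvedevFormal

namespace MedvedevFormal

theorem digit_add_pow {n m t : ℕ} (hm : m < n) :
    ((3 : ℤ) ^ n + t) / 3 ^ m % 3 = (t / 3 ^ m % 3 : ℕ) := by
  obtain ⟨e, rfl⟩ := Nat.exists_eq_add_of_lt hm
  rw [show (3 : ℤ) ^ (m + e + 1) + t = t + 3 ^ m * (3 * 3 ^ e) by ring,
    Int.add_mul_ediv_left _ _ (by positivity), Int.add_mul_emod_self_left]
  push_cast
  rfl

theorem digit_add_pow_self {n t : ℕ} (ht : t < 3 ^ n) : ((3 : ℤ) ^ n + t) / 3 ^ n = 1 := by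
  have ht' : (t : ℤ) < 3 ^ n := by exact_mod_cast ht
  rw [Int.add_ediv_of_dvd_left dvd_rfl, Int.ediv_self (by positivity),
    Int.ediv_eq_zero_of_lt (by lia) ht']
  rfl

/-- A number that is not free has a lowest digit `1`. -/
theorem exists_min_digit {n t : ℕ} (ht : t < 3 ^ n) (h : ¬IsFree t) :
    ∃ s < n, t / 3 ^ s % 3 = 1 ∧ ∀ m < s, t / 3 ^ m % 3 ≠ 1 := by
  classical
  have h' : ∃ s, t / 3 ^ s % 3 = 1 := by simpa [IsFree] using h
  refine ⟨Nat.find h', ?_, Nat.find_spec h', fun m hm => Nat.find_min h' hm⟩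
  by_contra! hn
  have h1 := Nat.find_spec h'
  rw [Nat.div_eq_of_lt (ht.trans_le (Nat.pow_le_pow_right (by norm_num) hn))] at h1
  simp at h1

section

variable {T : Type*} {R : QuadrantRules T} {P Q : ℤ → ℤ → ℤ} {E F : ℤ → ℤ → Prop} {c r : ℤ → ℤ}
  {z : ℤ → Bool} {wr wc : ℤ → ℤ → ℤ} {HW VW : ℤ → ℤ → T} {a b : ℤ} {n : ℕ}

theorem IsBoardLayer.row_phase_board (h : IsBoardLayer R P Q c r z wr wc HW VW)
    (hc : ColsKnown Q F c a b n) {t t' : ℕ} (ht : t < 3 ^ n) (ht' : t' < 3 ^ n) (hf : IsFree t) :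
    wr (a + 3 ^ n + t) (b + 3 ^ n + t') = 1 ↔ IsFree t' := by
  have e1 : a + 3 ^ n + (t : ℤ) - a = 3 ^ n + t := by ring
  have e2 : b + 3 ^ n + (t' : ℤ) - b = 3 ^ n + t' := by ring
  by_cases hf' : IsFree t'
  · rw [h.row_phase hc le_rfl (by rw [e2, digit_add_pow_self ht']; rfl) fun m hm => by
      rw [e2, digit_add_pow hm]; have := hf' m; lia, e1, digit_add_pow_self ht]
    simp [hf']
  · obtain ⟨s, hs, h1, h2⟩ := exists_min_digit ht' hf'
    rw [h.row_phase hc hs.le (by rw [e2, digit_add_pow hs]; lia) fun m hm => by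
      rw [e2, digit_add_pow (hm.trans hs)]; have := h2 m hm; lia, e1, digit_add_pow hs]
    have := hf s
    simp only [hf', iff_false]
    lia

theorem IsBoardLayer.row_phase_of_free (h : IsBoardLayer R P Q c r z wr wc HW VW)
    (hc : ColsKnown Q F c a b n) {t t' : ℕ} (ht : t < 3 ^ n) (ht' : t' < 3 ^ n)
    (hf' : IsFree t') : wr (a + 3 ^ n + t) (b + 3 ^ n + t') = 1 := by
  have e1 : a + 3 ^ n + (t : ℤ) - a = 3 ^ n + t := by ring
  have e2 : b + 3 ^ n + (t' : ℤ) - b = 3 ^ n + t' := by ring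
  rw [h.row_phase hc le_rfl (by rw [e2, digit_add_pow_self ht']; rfl) fun m hm => by
    rw [e2, digit_add_pow hm]; have := hf' m; lia, e1, digit_add_pow_self ht]
  rfl

theorem IsBoardLayer.col_phase_board (h : IsBoardLayer R P Q c r z wr wc HW VW)
    (hr : ColsKnown (fun i j => P j i) (fun i j => E j i) r b a n) {t t' : ℕ} (ht : t < 3 ^ n)
    (ht' : t' < 3 ^ n) (hf : IsFree t') :
    wc (a + 3 ^ n + t) (b + 3 ^ n + t') = 1 ↔ IsFree t := by
  have e1 : a + 3 ^ n + (t : ℤ) - a = 3 ^ n + t := by ring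
  have e2 : b + 3 ^ n + (t' : ℤ) - b = 3 ^ n + t' := by ring
  by_cases hf' : IsFree t
  · rw [h.col_phase hr le_rfl (by rw [e1, digit_add_pow_self ht]; rfl) fun m hm => by
      rw [e1, digit_add_pow hm]; have := hf' m; lia, e2, digit_add_pow_self ht']
    simp [hf']
  · obtain ⟨s, hs, h1, h2⟩ := exists_min_digit ht hf'
    rw [h.col_phase hr hs.le (by rw [e1, digit_add_pow hs]; lia) fun m hm => by
      rw [e1, digit_add_pow (hm.trans hs)]; have := h2 m hm; lia, e2, digit_add_pow hs]
    have := hf s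
    simp only [hf', iff_false]
    lia

theorem IsBoardLayer.col_phase_of_free (h : IsBoardLayer R P Q c r z wr wc HW VW)
    (hr : ColsKnown (fun i j => P j i) (fun i j => E j i) r b a n) {t t' : ℕ} (ht : t < 3 ^ n)
    (ht' : t' < 3 ^ n) (hf : IsFree t) : wc (a + 3 ^ n + t) (b + 3 ^ n + t') = 1 := by
  have e1 : a + 3 ^ n + (t : ℤ) - a = 3 ^ n + t := by ring
  have e2 : b + 3 ^ n + (t' : ℤ) - b = 3 ^ n + t' := by ring
  rw [h.col_phase hr le_rfl (by rw [e1, digit_add_pow_self ht]; rfl) fun m hm => by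
    rw [e1, digit_add_pow hm]; have := hf m; lia, e2, digit_add_pow_self ht']
  rfl

theorem ColsKnown.origin (hc : ColsKnown Q F c a b n) {t' : ℕ} (ht' : t' < 3 ^ n) :
    Q (a + 3 ^ n + (0 : ℕ)) (b + 3 ^ n + t') % 3 = 1 ∧ c (a + 3 ^ n + (0 : ℕ)) % 3 = 1 := by
  obtain ⟨-, h1, h2⟩ := hc n le_rfl 1 (by lia) (b + 3 ^ n + t')
  have e2 : b + 3 ^ n + (t' : ℤ) - b = 3 ^ n + t' := by ring
  rw [e2, digit_add_pow_self ht', mul_one] at h1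
  rw [mul_one] at h2
  simp only [Nat.cast_zero, add_zero]
  lia

theorem ColsKnown.interior (hc : ColsKnown Q F c a b n) {t t' : ℕ} (h0 : 0 < t) (ht : t < 3 ^ n)
    (hf : IsFree t') : Q (a + 3 ^ n + t) (b + 3 ^ n + t') % 3 ≠ 1 := by
  cases n with
  | zero => simp at ht; lia
  | succ n =>
    obtain ⟨m, hm, d, hd, h⟩ := exists_three_pow_mul (m := n) (x := 3 ^ (n + 1) + t) fun h => by
      have h1 : ((3 ^ (n + 1) : ℕ) : ℤ) ∣ t := by
        push_cast
        exact (dvd_add_right dvd_rfl).1 h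
      have := Nat.le_of_dvd h0 (Int.natCast_dvd_natCast.1 h1)
      lia
    obtain ⟨-, h1, -⟩ := hc m (by lia) d hd (b + 3 ^ (n + 1) + t')
    rw [← h, ← add_assoc] at h1
    have e2 : b + 3 ^ (n + 1) + (t' : ℤ) - b = 3 ^ (n + 1) + t' := by ring
    have h2 := digit_add_pow (t := t') (show m < n + 1 by lia)
    rw [e2] at h1
    have h3 := hf m
    lia

theorem const_between {f : ℤ → T} {k : ℕ} {a : ℤ}
    (h : ∀ t : ℕ, freePos k < t + 1 → t + 1 < freePos (k + 1) → f (a + (t + 1 : ℕ)) = f (a + t)) :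
    f (a + freePos (k + 1) - 1) = f (a + freePos k) := by
  have key : ∀ e : ℕ, freePos k + e < freePos (k + 1) → f (a + (freePos k + e : ℕ)) = f (a + freePos k) := by
    intro e
    induction e with
    | zero => simp
    | succ e ih => exact fun he => (h _ (by lia) he).trans (ih (by lia))
  have hlt : freePos k < freePos (k + 1) := freePos_strictMono (by lia)
  have := key (freePos (k + 1) - freePos k - 1) (by lia)
  rwa [show a + ((freePos k + (freePos (k + 1) - freePos k - 1) : ℕ) : ℤ) =
    a + freePos (k + 1) - 1 by lia] at this

/-- The tiles on the board of level `n`. -/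
noncomputable def boardTile (HW : ℤ → ℤ → T) (a b : ℤ) (n k l : ℕ) : T :=
  HW (a + 3 ^ n + freePos k) (b + 3 ^ n + freePos l)

theorem IsBoardLayer.boardTile_eq (h : IsBoardLayer R P Q c r z wr wc HW VW) (hc : ColsKnown Q F c a b n)
    (hr : ColsKnown (fun i j => P j i) (fun i j => E j i) r b a n)
    {k l : ℕ} (hk : freePos k < 3 ^ n) (hl : freePos l < 3 ^ n) :
    boardTile HW a b n k l = boardTile VW a b n k l :=
  h.node_eq _ _ (h.row_phase_of_free hc hk hl (isFree_freePos l))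
    (h.col_phase_of_free hr hk hl (isFree_freePos k))

theorem IsBoardLayer.board_left (h : IsBoardLayer R P Q c r z wr wc HW VW) (hc : ColsKnown Q F c a b n)
    (hr : ColsKnown (fun i j => P j i) (fun i j => E j i) r b a n)
    {l : ℕ} (hl : freePos l < 3 ^ n) :
    R.left (boardTile HW a b n 0 l) := by
  have h0 : freePos 0 < 3 ^ n := by rw [freePos_zero]; positivity
  obtain ⟨h1, h2⟩ := hc.origin hl
  rw [← freePos_zero] at h1 h2
  exact h.node_left _ _ (h.row_phase_of_free hc h0 hl (isFree_freePos l))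
    (h.col_phase_of_free hr h0 hl (isFree_freePos 0)) h1 h2

theorem IsBoardLayer.board_bot (h : IsBoardLayer R P Q c r z wr wc HW VW) (hc : ColsKnown Q F c a b n)
    (hr : ColsKnown (fun i j => P j i) (fun i j => E j i) r b a n)
    {k : ℕ} (hk : freePos k < 3 ^ n) :
    R.bot (boardTile HW a b n k 0) (z (a + 3 ^ n + freePos k)) := by
  have h0 : freePos 0 < 3 ^ n := by rw [freePos_zero]; positivity
  obtain ⟨h1, h2⟩ := hr.origin hk
  rw [← freePos_zero] at h1 h2
  rw [h.boardTile_eq hc hr hk h0]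
  exact h.node_bot _ _ (h.row_phase_of_free hc hk h0 (isFree_freePos 0))
    (h.col_phase_of_free hr hk h0 (isFree_freePos k)) h1 h2

theorem IsBoardLayer.board_horiz (h : IsBoardLayer R P Q c r z wr wc HW VW) (hc : ColsKnown Q F c a b n)
    (hr : ColsKnown (fun i j => P j i) (fun i j => E j i) r b a n)
    {k l : ℕ} (hk : freePos (k + 1) < 3 ^ n)
    (hl : freePos l < 3 ^ n) :
    R.horiz (boardTile HW a b n k l) (boardTile HW a b n (k + 1) l) := by
  have hp : 0 < freePos (k + 1) := by
    have := freePos_strictMono (Nat.succ_pos k); lia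
  have e : a + 3 ^ n + (freePos (k + 1) : ℤ) - 1 + 1 = a + 3 ^ n + freePos (k + 1) := by ring
  have := h.node_horiz (a + 3 ^ n + freePos (k + 1) - 1) (b + 3 ^ n + freePos l)
    (by rw [e]; exact h.row_phase_of_free hc hk hl (isFree_freePos l))
    (by rw [e]; exact h.col_phase_of_free hr hk hl (isFree_freePos _))
    (by rw [e]; exact fun h' => hc.interior hp hk (isFree_freePos l) h'.1)
  rw [e, const_between (f := fun i => HW i (b + 3 ^ n + freePos l)) (a := a + 3 ^ n)] at this
  · exact this
  · intro t h1 h2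
    have e' : a + 3 ^ n + ((t + 1 : ℕ) : ℤ) = a + 3 ^ n + t + 1 := by push_cast; ring
    have h3 := h.row_phase_of_free hc (h2.trans hk) hl (isFree_freePos l)
    have h4 := h.col_phase_board hr (h2.trans hk) hl (isFree_freePos l)
    rw [e'] at h3 h4 ⊢
    exact h.row_pass _ _ h3 fun h' => not_isFree_of_between h1 h2 (h4.1 h')

theorem IsBoardLayer.board_vert (h : IsBoardLayer R P Q c r z wr wc HW VW) (hc : ColsKnown Q F c a b n)
    (hr : ColsKnown (fun i j => P j i) (fun i j => E j i) r b a n)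
    {k l : ℕ} (hk : freePos k < 3 ^ n)
    (hl : freePos (l + 1) < 3 ^ n) :
    R.vert (boardTile HW a b n k l) (boardTile HW a b n k (l + 1)) := by
  have hp : 0 < freePos (l + 1) := by
    have := freePos_strictMono (Nat.succ_pos l); lia
  have hlt : freePos l < freePos (l + 1) := freePos_strictMono (by lia)
  rw [h.boardTile_eq hc hr hk hl, h.boardTile_eq hc hr hk (hlt.trans hl)]
  have e : b + 3 ^ n + (freePos (l + 1) : ℤ) - 1 + 1 = b + 3 ^ n + freePos (l + 1) := by ring
  have := h.node_vert (a + 3 ^ n + freePos k) (b + 3 ^ n + freePos (l + 1) - 1)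
    (by rw [e]; exact h.row_phase_of_free hc hk hl (isFree_freePos _))
    (by rw [e]; exact h.col_phase_of_free hr hk hl (isFree_freePos _))
    (by rw [e]; exact fun h' => hr.interior hp hl (isFree_freePos k) h'.1)
  rw [e, const_between (f := fun j => VW (a + 3 ^ n + freePos k) j) (a := b + 3 ^ n)] at this
  · exact this
  · intro t h1 h2
    have e' : b + 3 ^ n + ((t + 1 : ℕ) : ℤ) = b + 3 ^ n + t + 1 := by push_cast; ring
    have h3 := h.col_phase_of_free hr hk (h2.trans hl) (isFree_freePos k)
    have h4 := h.row_phase_board hc hk (h2.trans hl) (isFree_freePos k)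
    rw [e'] at h3 h4 ⊢
    exact h.col_pass _ _ h3 fun h' => not_isFree_of_between h1 h2 (h4.1 h')

end
end MedvedevFormal

namespace MedvedevFormal

/-- The distance from the mark at `(i, j)` to the next higher mark `(i, j + 3 ^ m)` shows that
the column `i` has level `m`. -/
def MarksLevel (F : ℤ → ℤ → Prop) (m : ℕ) (i j : ℤ) : Prop :=
  F i j ∧ F i (j + 3 ^ m) ∧ ∀ m' < m, ¬F i (j + 3 ^ m')

/-- `D` is a solution of the tiling problem on the square of size `N`, with column labels given
by `x`. -/
structure IsPartialSolution {T : Type*} (R : QuadrantRules T) (x : ℕ → Bool) (N : ℕ)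
    (D : ℕ → ℕ → T) : Prop where
  left : ∀ l ≤ N, R.left (D 0 l)
  bot_zero : ∃ b, R.bot (D 0 0) b
  bot : ∀ k ≤ N, 0 < k → R.bot (D k 0) (x (freeLevel k))
  horiz : ∀ k < N, ∀ l ≤ N, R.horiz (D k l) (D (k + 1) l)
  vert : ∀ k ≤ N, ∀ l < N, R.vert (D k l) (D k (l + 1))

section

variable {T : Type*} {R : QuadrantRules T} {P Q : ℤ → ℤ → ℤ} {E F : ℤ → ℤ → Prop} {c r : ℤ → ℤ}
  {z y : ℤ → Bool} {wr wc : ℤ → ℤ → ℤ} {HW VW : ℤ → ℤ → T} {a₀ b₀ : ℤ}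

theorem ColsKnown.marksLevel {a b : ℤ} {m n : ℕ} (hc : ColsKnown Q F c a b n) (hm : m ≤ n) {d : ℤ}
    (hd : ¬3 ∣ d) (e : ℤ) : MarksLevel F m (a + 3 ^ m * d) (b + 3 ^ m * e) := by
  have h := fun j => (hc m hm d hd j).1
  refine ⟨(h _).2 ⟨e, by ring⟩, (h _).2 ⟨e + 1, by ring⟩, fun m' hm' h' => ?_⟩
  rw [h, show b + 3 ^ m * e + 3 ^ m' - b = 3 ^ m * e + 3 ^ m' by ring,
    dvd_add_right (dvd_mul_right _ _)] at h'
  have h1 : (3 : ℤ) ^ m' < 3 ^ m := pow_lt_pow_right₀ (by norm_num) hm'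
  have := Int.le_of_dvd (by positivity) h'
  lia

theorem IsHierarchy.eq_of_marksLevel (h : IsHierarchy P Q E F c r z y a₀ b₀) {a b : ℤ} {m : ℕ}
    (hc : ColsKnown Q F c a b m) (hr : ColsKnown (fun i j => P j i) (fun i j => E j i) r b a m)
    {i j : ℤ} (hl : MarksLevel F m i j) : z i = y (b + 3 ^ m) := by
  obtain ⟨h1, h2, h3⟩ := hl
  have hi : ¬3 ^ (m + 1) ∣ i - a := fun hi => by
    have h4 := not_not.1 (mt (h.not_mark_of_deep hr hi) (not_not.2 h1))
    have h5 := not_not.1 (mt (h.not_mark_of_deep hr hi) (not_not.2 h2))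
    rw [show j + 3 ^ m - b = (j - b) + 3 ^ m by ring, dvd_add_right h4] at h5
    have := Int.le_of_dvd (by positivity) h5
    have h6 : (3 : ℤ) ^ m < 3 ^ (m + 1) := pow_lt_pow_right₀ (by norm_num) (by lia)
    lia
  obtain ⟨m', hm', d, hd, hid⟩ := exists_three_pow_mul hi
  obtain rfl : i = a + 3 ^ m' * d := by lia
  obtain rfl : m' = m := by
    by_contra hne
    refine h3 m' (by lia) ?_
    rw [(hc m' hm' d hd _).1] at h1 ⊢
    rw [show j + 3 ^ m' - b = (j - b) + 3 ^ m' by ring]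
    exact dvd_add h1 dvd_rfl
  simpa using h.label_eq hc le_rfl hd (show ¬(3 : ℤ) ∣ 1 by lia)

theorem IsHierarchy.exists_marksLevel (h : IsHierarchy P Q E F c r z y a₀ b₀) (m : ℕ) :
    ∃ i j : ℕ, MarksLevel F m i j := by
  obtain ⟨a, b, hc, -⟩ := h.exists_known m
  have hm := hc.marksLevel le_rfl (d := 3 * |a| + 1) (by lia) |b|
  have h1 : (1 : ℤ) ≤ 3 ^ m := one_le_pow₀ (by norm_num)
  have h2 : 0 ≤ a + 3 ^ m * (3 * |a| + 1) := by nlinarith [abs_nonneg a, neg_abs_le a]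
  have h3 : 0 ≤ b + 3 ^ m * |b| := by nlinarith [abs_nonneg b, neg_abs_le b]
  exact ⟨(a + 3 ^ m * (3 * |a| + 1)).toNat, (b + 3 ^ m * |b|).toNat, by
    rwa [Int.toNat_of_nonneg h2, Int.toNat_of_nonneg h3]⟩

/-- A hierarchy with a layer of boards carries a point of Cantor space together with arbitrarily
large partial solutions of the tiling problem for it. -/
theorem IsHierarchy.exists_point (h : IsHierarchy P Q E F c r z y a₀ b₀)
    (hb : IsBoardLayer R P Q c r z wr wc HW VW) :
    ∃ x : ℕ → Bool, (∀ m i j, MarksLevel F m i j → z i = x m) ∧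
      (∀ m, ∃ i j : ℕ, MarksLevel F m i j) ∧ ∀ N, ∃ D, IsPartialSolution R x N D := by
  have hx : ∀ m, ∃ v, ∀ i j, MarksLevel F m i j → z i = v := fun m => by
    obtain ⟨a, b, hc, hr⟩ := h.exists_known m
    exact ⟨_, fun i j => h.eq_of_marksLevel hc hr⟩
  choose x hx using hx
  refine ⟨x, hx, h.exists_marksLevel, fun N => ?_⟩
  obtain ⟨n, hn⟩ : ∃ n, freePos N < 3 ^ n := ⟨_, Nat.lt_pow_self (by norm_num)⟩
  obtain ⟨a, b, hc, hr⟩ := h.exists_known n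
  have hle : ∀ k ≤ N, freePos k < 3 ^ n := fun k hk => (freePos_strictMono.monotone hk).trans_lt hn
  refine ⟨boardTile HW a b n, fun l hl => hb.board_left hc hr (hle l hl),
    ⟨_, hb.board_bot hc hr (hle 0 (by lia))⟩, fun k hk h0 => ?_,
    fun k hk l hl => hb.board_horiz hc hr (hle _ hk) (hle l hl),
    fun k hk l hl => hb.board_vert hc hr (hle k hk) (hle _ hl)⟩
  obtain ⟨d, hd, hkd⟩ := exists_freePos_eq h0
  have hlt : freeLevel k < n := by
    have h1 := hle k hk
    have h2 : 3 ^ freeLevel k < 3 ^ n := by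
      have : d ≠ 0 := by rintro rfl; simp at hd
      refine lt_of_le_of_lt ?_ h1
      conv_rhs => rw [hkd]
      exact Nat.le_mul_of_pos_right _ (by lia)
    exact (Nat.pow_lt_pow_iff_right (by norm_num)).1 h2
  obtain ⟨e, rfl⟩ := Nat.exists_eq_add_of_lt hlt
  set s := freeLevel k
  have h1 := hc.marksLevel (m := s) (by lia) (d := 3 * 3 ^ e + d) (by lia) 0
  have h2 := hb.board_bot hc hr (hle k hk)
  rw [show a + 3 ^ s * (3 * 3 ^ e + (d : ℤ)) = a + 3 ^ (s + e + 1) + freePos k by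
    rw [hkd]; push_cast; ring] at h1
  rwa [hx _ _ _ h1] at h2

end
end MedvedevFormal

namespace MedvedevFormal

/-! ### The tiles of the plane -/

/-- The data stored at a cell of the plane. -/
structure Cell (T : Type*) where
  (U V P Q C R : Fin 9)
  (E F Z Y : Bool)
  (WR WC : Fin 3)
  (HW VW : T)

/-- A cell as a tuple. -/
abbrev CellTuple (T : Type*) :=
  ((Fin 9 × Fin 9) × (Fin 9 × Fin 9) × Fin 9 × Fin 9) ×
    ((Bool × Bool) × Bool × Bool) × (Fin 3 × Fin 3) × T × T

section

variable {T : Type*}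

/-- The tuple of entries of a cell. -/
def Cell.toTuple (s : Cell T) : CellTuple T :=
  (((s.U, s.V), (s.P, s.Q), s.C, s.R), ((s.E, s.F), s.Z, s.Y), (s.WR, s.WC), s.HW, s.VW)

/-- The cell with the given entries. -/
def Cell.ofTuple (q : CellTuple T) : Cell T :=
  match q with
  | (((U, V), (P, Q), C, R), ((E, F), Z, Y), (WR, WC), HW, VW) =>
    ⟨U, V, P, Q, C, R, E, F, Z, Y, WR, WC, HW, VW⟩

theorem Cell.ofTuple_toTuple (s : Cell T) : Cell.ofTuple s.toTuple = s := rfl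

instance [Finite T] : Finite (Cell T) :=
  Finite.of_injective Cell.toTuple (Function.LeftInverse.injective Cell.ofTuple_toTuple)

/-- A digit as an integer. -/
def dig {n : ℕ} (d : Fin n) : ℤ := (d : ℕ)

theorem dig_nonneg {n : ℕ} (d : Fin n) : 0 ≤ dig d := Int.natCast_nonneg _

theorem dig_lt {n : ℕ} (d : Fin n) : dig d < n := by simp [dig]

theorem dig_injective {n : ℕ} : Function.Injective (dig (n := n)) := fun a b h => by
  apply Fin.ext
  simpa [dig] using h

/-- The rules for a single cell. -/
structure Cell.Ok (R : QuadrantRules T) (s : Cell T) : Prop where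
  col_base : ¬3 ∣ dig s.U → s.F = true ∧ s.Q = s.V ∧ s.C = s.U
  row_base : ¬3 ∣ dig s.V → s.E = true ∧ s.P = s.U ∧ s.R = s.V
  not_F : s.E = true → dig s.P % 3 = 0 → ¬s.F = true
  not_E : s.F = true → dig s.Q % 3 = 0 → ¬s.E = true
  cross_iff : (s.E = true ∧ dig s.P % 3 ≠ 0) ↔ (s.F = true ∧ dig s.Q % 3 ≠ 0)
  cross : s.E = true → dig s.P % 3 ≠ 0 → s.P = s.C ∧ s.Q = s.R ∧ s.Z = s.Y
  col_link : s.F = true → (dig s.Q = 3 ∨ dig s.Q = 6) → dig s.P % 3 = dig s.C / 3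
  row_link : s.E = true → (dig s.P = 3 ∨ dig s.P = 6) → dig s.Q % 3 = dig s.R / 3
  node_eq : dig s.WR = 1 → dig s.WC = 1 → s.HW = s.VW
  node_left : dig s.WR = 1 → dig s.WC = 1 → dig s.Q % 3 = 1 → dig s.C % 3 = 1 → R.left s.HW
  node_bot : dig s.WR = 1 → dig s.WC = 1 → dig s.P % 3 = 1 → dig s.R % 3 = 1 → R.bot s.VW s.Z

/-- The rules for two horizontally adjacent cells. -/
structure Cell.Horiz (R : QuadrantRules T) (s t : Cell T) : Prop where
  U_succ : dig t.U = (dig s.U + 1) % 9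
  V_same : t.V = s.V
  R_same : t.R = s.R
  Y_same : t.Y = s.Y
  P_succ : t.E = true → dig t.P = (dig s.P + 1) % 9
  P_same : ¬t.E = true → t.P = s.P
  row_open : dig t.Q % 3 = 1 → dig t.C % 3 = 1 → dig s.WR ≠ 1 ∧ dig t.WR ≠ 2
  row_close : dig t.Q % 3 = 1 → dig t.C % 3 = 2 → dig s.WR ≠ 0 ∧ dig t.WR ≠ 1
  row_none : (dig t.Q % 3 = 1 → dig t.C % 3 = 0) →
    dig t.WR = dig s.WR ∨ dig s.WR = 2 ∧ dig t.WR = 0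
  row_pass : dig t.WR = 1 → dig t.WC ≠ 1 → t.HW = s.HW
  node_horiz : dig t.WR = 1 → dig t.WC = 1 → ¬(dig t.Q % 3 = 1 ∧ dig t.C % 3 = 1) →
    R.horiz s.HW t.HW

/-- The rules for two vertically adjacent cells. -/
structure Cell.Vert (R : QuadrantRules T) (s t : Cell T) : Prop where
  V_succ : dig t.V = (dig s.V + 1) % 9
  U_same : t.U = s.U
  C_same : t.C = s.C
  Z_same : t.Z = s.Z
  Q_succ : t.F = true → dig t.Q = (dig s.Q + 1) % 9
  Q_same : ¬t.F = true → t.Q = s.Q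
  col_open : dig t.P % 3 = 1 → dig t.R % 3 = 1 → dig s.WC ≠ 1 ∧ dig t.WC ≠ 2
  col_close : dig t.P % 3 = 1 → dig t.R % 3 = 2 → dig s.WC ≠ 0 ∧ dig t.WC ≠ 1
  col_none : (dig t.P % 3 = 1 → dig t.R % 3 = 0) →
    dig t.WC = dig s.WC ∨ dig s.WC = 2 ∧ dig t.WC = 0
  col_pass : dig t.WC = 1 → dig t.WR ≠ 1 → t.VW = s.VW
  node_vert : dig t.WR = 1 → dig t.WC = 1 → ¬(dig t.P % 3 = 1 ∧ dig t.R % 3 = 1) →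
    R.vert s.VW t.VW

/-- A tiling of the plane satisfying all rules. -/
structure IsTiling (R : QuadrantRules T) (X : ℤ → ℤ → Cell T) : Prop where
  ok : ∀ i j, (X i j).Ok R
  horiz : ∀ i j, (X i j).Horiz R (X (i + 1) j)
  vert : ∀ i j, (X i j).Vert R (X i (j + 1))

theorem eq_zero_of_same {α : Type*} {f : ℤ → α} (h : ∀ i, f (i + 1) = f i) (i : ℤ) : f i = f 0 := by
  induction i using Int.induction_on with
  | zero => rfl
  | succ i ih => rw [h, ih]
  | pred i ih => rw [← ih, ← h (-i - 1), sub_add_cancel]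

theorem counter_eq {f : ℤ → ℤ} (hf : ∀ i, 0 ≤ f i ∧ f i < 9)
    (h : ∀ i, f (i + 1) = (f i + 1) % 9) (i : ℤ) : f i = (i + f 0) % 9 := by
  have hf0 := hf 0
  induction i using Int.induction_on with
  | zero => lia
  | succ i ih => rw [h, ih]; lia
  | pred i ih =>
    have h1 := h (-i - 1)
    rw [sub_add_cancel] at h1
    have h2 := hf (-i - 1)
    lia

variable {R : QuadrantRules T} {X : ℤ → ℤ → Cell T}

theorem IsTiling.U_eq (h : IsTiling R X) (i j : ℤ) :
    dig (X i j).U = (i + dig (X 0 0).U) % 9 := by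
  rw [eq_zero_of_same (f := fun j => (X i j).U) (fun j => (h.vert i j).U_same) j]
  exact counter_eq (f := fun i => dig (X i 0).U) (fun i => ⟨dig_nonneg _, dig_lt _⟩)
    (fun i => (h.horiz i 0).U_succ) i

theorem IsTiling.V_eq (h : IsTiling R X) (i j : ℤ) :
    dig (X i j).V = (j + dig (X 0 0).V) % 9 := by
  rw [eq_zero_of_same (f := fun i => (X i j).V) (fun i => (h.horiz i j).V_same) i]
  exact counter_eq (f := fun j => dig (X 0 j).V) (fun i => ⟨dig_nonneg _, dig_lt _⟩)
    (fun j => (h.vert 0 j).V_succ) j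

theorem IsTiling.C_eq (h : IsTiling R X) (i j : ℤ) : (X i j).C = (X i 0).C :=
  eq_zero_of_same (f := fun j => (X i j).C) (fun j => (h.vert i j).C_same) j

theorem IsTiling.Z_eq (h : IsTiling R X) (i j : ℤ) : (X i j).Z = (X i 0).Z :=
  eq_zero_of_same (f := fun j => (X i j).Z) (fun j => (h.vert i j).Z_same) j

theorem IsTiling.R_eq (h : IsTiling R X) (i j : ℤ) : (X i j).R = (X 0 j).R :=
  eq_zero_of_same (f := fun i => (X i j).R) (fun i => (h.horiz i j).R_same) i

theorem IsTiling.Y_eq (h : IsTiling R X) (i j : ℤ) : (X i j).Y = (X 0 j).Y :=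
  eq_zero_of_same (f := fun i => (X i j).Y) (fun i => (h.horiz i j).Y_same) i

theorem IsTiling.isHierarchy (h : IsTiling R X) :
    IsHierarchy (fun i j => dig (X i j).P) (fun i j => dig (X i j).Q)
      (fun i j => (X i j).E = true) (fun i j => (X i j).F = true) (fun i => dig (X i 0).C)
      (fun j => dig (X 0 j).R) (fun i => (X i 0).Z) (fun j => (X 0 j).Y)
      (-dig (X 0 0).U) (-dig (X 0 0).V) where
  P_range i j := ⟨dig_nonneg _, dig_lt _⟩
  Q_range i j := ⟨dig_nonneg _, dig_lt _⟩
  P_succ i j := (h.horiz i j).P_succ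
  P_same i j hE := congrArg dig ((h.horiz i j).P_same hE)
  Q_succ i j := (h.vert i j).Q_succ
  Q_same i j hE := congrArg dig ((h.vert i j).Q_same hE)
  col_base i j hi := by
    have h1 := h.U_eq i j
    obtain ⟨h2, h3, h4⟩ := (h.ok i j).col_base (by lia)
    rw [h.C_eq] at h4
    refine ⟨h2, ?_, ?_⟩
    · rw [h3, h.V_eq, sub_neg_eq_add]
    · rw [h4, h1, sub_neg_eq_add]
  row_base i j hi := by
    have h1 := h.V_eq i j
    obtain ⟨h2, h3, h4⟩ := (h.ok i j).row_base (by lia)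
    rw [h.R_eq] at h4
    refine ⟨h2, ?_, ?_⟩
    · rw [h3, h.U_eq, sub_neg_eq_add]
    · rw [h4, h1, sub_neg_eq_add]
  not_F i j := (h.ok i j).not_F
  not_E i j := (h.ok i j).not_E
  cross_iff i j := (h.ok i j).cross_iff
  cross i j h1 h2 := by
    obtain ⟨h3, h4, h5⟩ := (h.ok i j).cross h1 h2
    rw [h.C_eq] at h3
    rw [h.R_eq] at h4
    rw [h.Z_eq, h.Y_eq] at h5
    exact ⟨congrArg dig h3, congrArg dig h4, h5⟩
  col_link i j := by
    rw [← h.C_eq i j]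
    exact (h.ok i j).col_link
  row_link i j := by
    rw [← h.R_eq i j]
    exact (h.ok i j).row_link

theorem IsTiling.isBoardLayer (h : IsTiling R X) :
    IsBoardLayer R (fun i j => dig (X i j).P) (fun i j => dig (X i j).Q)
      (fun i => dig (X i 0).C) (fun j => dig (X 0 j).R) (fun i => (X i 0).Z)
      (fun i j => dig (X i j).WR) (fun i j => dig (X i j).WC)
      (fun i j => (X i j).HW) (fun i j => (X i j).VW) where
  wr_range i j := ⟨dig_nonneg _, dig_lt _⟩
  wc_range i j := ⟨dig_nonneg _, dig_lt _⟩
  row_open i j := by rw [← h.C_eq _ j]; exact (h.horiz i j).row_open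
  row_close i j := by rw [← h.C_eq _ j]; exact (h.horiz i j).row_close
  row_none i j := by rw [← h.C_eq _ j]; exact (h.horiz i j).row_none
  col_open i j := by rw [← h.R_eq i]; exact (h.vert i j).col_open
  col_close i j := by rw [← h.R_eq i]; exact (h.vert i j).col_close
  col_none i j := by rw [← h.R_eq i]; exact (h.vert i j).col_none
  row_pass i j := (h.horiz i j).row_pass
  col_pass i j := (h.vert i j).col_pass
  node_eq i j := (h.ok i j).node_eq
  node_left i j := by rw [← h.C_eq _ j]; exact (h.ok i j).node_left
  node_horiz i j := by rw [← h.C_eq _ j]; exact (h.horiz i j).node_horiz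
  node_bot i j := by rw [← h.R_eq i, ← h.Z_eq _ j]; exact (h.ok i j).node_bot
  node_vert i j h1 h2 := by rw [← h.R_eq i]; exact (h.vert i j).node_vert h1 h2

/-- The residue of an integer. -/
def toDig (n : ℕ) [NeZero n] (x : ℤ) : Fin n :=
  ⟨(x % n).toNat, by
    have := Int.emod_lt_of_pos x (b := n) (by simpa using Nat.pos_of_neZero n)
    have h0 := Nat.pos_of_neZero n
    lia⟩

theorem dig_toDig {n : ℕ} [NeZero n] (x : ℤ) : dig (toDig n x) = x % n := by
  have := Int.emod_nonneg x (b := n) (by simpa using NeZero.ne n)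
  simp only [dig, toDig]
  lia

theorem dig_toDig_of_lt {n : ℕ} [NeZero n] {x : ℤ} (h : 0 ≤ x ∧ x < n) : dig (toDig n x) = x := by
  rw [dig_toDig, Int.emod_eq_of_lt h.1 h.2]

theorem toDig_congr {n : ℕ} [NeZero n] {x y : ℤ} (h : x % n = y % n) : toDig n x = toDig n y :=
  dig_injective (by simpa [dig_toDig] using h)

/-- The cell of a plane tiling determined by integer valued data. -/
def cellOf (P Q : ℤ → ℤ → ℤ) (E F : ℤ → ℤ → Bool) (c r : ℤ → ℤ) (z y : ℤ → Bool)
    (wr wc : ℤ → ℤ → ℤ) (HW VW : ℤ → ℤ → T) (i j : ℤ) : Cell T :=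
  ⟨toDig 9 i, toDig 9 j, toDig 9 (P i j), toDig 9 (Q i j), toDig 9 (c i), toDig 9 (r j), E i j,
    F i j, z i, y j, toDig 3 (wr i j), toDig 3 (wc i j), HW i j, VW i j⟩

theorem isTiling_cellOf {P Q : ℤ → ℤ → ℤ} {E F : ℤ → ℤ → Bool} {c r : ℤ → ℤ} {z y : ℤ → Bool}
    {wr wc : ℤ → ℤ → ℤ} {HW VW : ℤ → ℤ → T}
    (h : IsHierarchy P Q (fun i j => E i j = true) (fun i j => F i j = true) c r z y 0 0)
    (hc : ∀ i, 0 ≤ c i ∧ c i < 9) (hr : ∀ j, 0 ≤ r j ∧ r j < 9)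
    (hb : IsBoardLayer R P Q c r z wr wc HW VW) :
    IsTiling R (cellOf P Q E F c r z y wr wc HW VW) := by
  have eP := fun i j => dig_toDig_of_lt (n := 9) (h.P_range i j)
  have eQ := fun i j => dig_toDig_of_lt (n := 9) (h.Q_range i j)
  have ec := fun i => dig_toDig_of_lt (n := 9) (hc i)
  have er := fun i => dig_toDig_of_lt (n := 9) (hr i)
  have ewr := fun i j => dig_toDig_of_lt (n := 3) (hb.wr_range i j)
  have ewc := fun i j => dig_toDig_of_lt (n := 3) (hb.wc_range i j)
  have e9 : ∀ x, dig (toDig 9 x) = x % 9 := dig_toDig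
  refine ⟨fun i j => ?_, fun i j => ?_, fun i j => ?_⟩
  · constructor <;> simp only [cellOf, eP, eQ, ec, er, ewr, ewc]
    · intro hi
      rw [e9] at hi
      obtain ⟨h1, h2, h3⟩ := h.col_base i j (by lia)
      exact ⟨h1, toDig_congr (by rw [h2]; simp), toDig_congr (by rw [h3]; simp)⟩
    · intro hi
      rw [e9] at hi
      obtain ⟨h1, h2, h3⟩ := h.row_base i j (by lia)
      exact ⟨h1, toDig_congr (by rw [h2]; simp), toDig_congr (by rw [h3]; simp)⟩
    · exact h.not_F i j
    · exact h.not_E i j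
    · exact h.cross_iff i j
    · intro h1 h2
      obtain ⟨h3, h4, h5⟩ := h.cross i j h1 h2
      exact ⟨by rw [h3], by rw [h4], h5⟩
    · exact h.col_link i j
    · exact h.row_link i j
    · exact hb.node_eq i j
    · exact hb.node_left i j
    · exact hb.node_bot i j
  · constructor <;> simp only [cellOf, eP, eQ, ec, ewr, ewc]
    · rw [e9, e9]; lia
    · exact h.P_succ i j
    · exact fun hE => congrArg _ (h.P_same i j hE)
    · exact hb.row_open i j
    · exact hb.row_close i j
    · exact hb.row_none i j
    · exact hb.row_pass i j
    · exact hb.node_horiz i j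
  · constructor <;> simp only [cellOf, eP, eQ, er, ewr, ewc]
    · rw [e9, e9]; lia
    · exact h.Q_succ i j
    · exact fun hE => congrArg _ (h.Q_same i j hE)
    · exact hb.col_open i j
    · exact hb.col_close i j
    · exact hb.col_none i j
    · exact hb.col_pass i j
    · exact hb.node_vert i j

end
end MedvedevFormal

namespace MedvedevFormal

/-! ### The tiling carrying a given point -/

/-- The exponent of `3` in an integer. -/
noncomputable def lev (x : ℤ) : ℕ := padicValInt 3 x

theorem lev_three_pow_mul {m : ℕ} {d : ℤ} (hd : ¬3 ∣ d) : lev (3 ^ m * d) = m := by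
  have := Fact.mk Nat.prime_three
  have hd0 : d ≠ 0 := by rintro rfl; simp at hd
  rw [lev, padicValInt.mul (by positivity) hd0,
    padicValInt.eq_zero_of_not_dvd (z := d) (by exact_mod_cast hd), padicValInt, Int.natAbs_pow]
  simp

theorem exists_eq_lev {x : ℤ} (hx : x ≠ 0) : ∃ d : ℤ, ¬3 ∣ d ∧ x = 3 ^ lev x * d := by
  obtain ⟨m, -, d, hd, h⟩ := exists_three_pow_mul (m := x.natAbs) (x := x) fun h => by
    have h1 := Int.natAbs_dvd_natAbs.2 h
    rw [Int.natAbs_pow] at h1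
    have h2 := Nat.le_of_dvd (by lia) h1
    have h3 : x.natAbs + 1 < 3 ^ (x.natAbs + 1) := Nat.lt_pow_self (by norm_num)
    simp at h2
    lia
  have := lev_three_pow_mul (m := m) hd
  rw [← h] at this
  exact ⟨d, hd, by rw [this]; exact h⟩

theorem three_pow_dvd_iff {x : ℤ} (hx : x ≠ 0) (m : ℕ) : 3 ^ m ∣ x ↔ m ≤ lev x := by
  have := Fact.mk Nat.prime_three
  have := padicValInt_dvd_iff (p := 3) m x
  push_cast at this
  simp [this, hx, lev]

theorem lev_eq_zero {x : ℤ} (hx : ¬3 ∣ x) : lev x = 0 := by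
  simpa using lev_three_pow_mul (m := 0) hx

theorem ediv_succ_of_dvd {i : ℤ} {m : ℕ} (h : 3 ^ m ∣ i + 1) :
    (i + 1) / 3 ^ m = i / 3 ^ m + 1 := by
  obtain ⟨q, hq⟩ := h
  have h0 : (0 : ℤ) < 3 ^ m := by positivity
  rw [hq, Int.mul_ediv_cancel_left _ h0.ne', eq_sub_of_add_eq hq,
    show (3 : ℤ) ^ m * q - 1 = -1 + 3 ^ m * q by ring, Int.add_mul_ediv_left _ _ h0.ne']
  rw [show (-1 : ℤ) / 3 ^ m = -1 from Int.ediv_eq_neg_one_of_neg_of_le (by lia) (by lia)]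
  ring

theorem ediv_succ_of_not_dvd {i : ℤ} {m : ℕ} (h : ¬3 ^ m ∣ i + 1) :
    (i + 1) / 3 ^ m = i / 3 ^ m := by
  have h0 : (0 : ℤ) < 3 ^ m := by positivity
  have h1 := Int.emod_add_mul_ediv i (3 ^ m)
  have h2 := Int.emod_nonneg i h0.ne'
  have h3 := Int.emod_lt_of_pos i h0
  have h4 : i % 3 ^ m + 1 ≠ 3 ^ m := fun h4 => h ⟨i / 3 ^ m + 1, by lia⟩
  rw [Int.ediv_eq_iff_of_pos h0]
  rw [mul_comm]
  constructor <;> lia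

theorem emod_succ_of_not_dvd {i : ℤ} {m : ℕ} (h : ¬3 ^ m ∣ i + 1) :
    (i + 1) % 3 ^ m = i % 3 ^ m + 1 := by
  rw [Int.emod_def, Int.emod_def, ediv_succ_of_not_dvd h]
  ring

open Classical in
/-- Marks of the rows. -/
noncomputable def idealE (i j : ℤ) : Bool := decide (j ≠ 0 ∧ 3 ^ lev j ∣ i)

/-- Counters of the rows. -/
noncomputable def idealP (i j : ℤ) : ℤ := if j = 0 then 0 else i / 3 ^ lev j % 9

/-- Labels of the rows. -/
noncomputable def idealR (j : ℤ) : ℤ := if j = 0 then 0 else j / 3 ^ lev j % 9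

theorem idealE_iff {i j : ℤ} : idealE i j = true ↔ j ≠ 0 ∧ 3 ^ lev j ∣ i := by simp [idealE]

theorem idealP_of_ne {i j : ℤ} (hj : j ≠ 0) : idealP i j = i / 3 ^ lev j % 9 := if_neg hj

theorem idealR_of_ne {j : ℤ} (hj : j ≠ 0) : idealR j = j / 3 ^ lev j % 9 := if_neg hj

theorem idealP_range (i j : ℤ) : 0 ≤ idealP i j ∧ idealP i j < 9 := by
  unfold idealP; split_ifs <;> lia

theorem idealR_range (j : ℤ) : 0 ≤ idealR j ∧ idealR j < 9 := by
  unfold idealR; split_ifs <;> lia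

theorem idealP_succ (i j : ℤ) (h : idealE (i + 1) j = true) :
    idealP (i + 1) j = (idealP i j + 1) % 9 := by
  obtain ⟨h1, h2⟩ := idealE_iff.1 h
  rw [idealP_of_ne h1, idealP_of_ne h1, ediv_succ_of_dvd h2]
  lia

theorem idealP_same (i j : ℤ) (h : ¬idealE (i + 1) j = true) :
    idealP (i + 1) j = idealP i j := by
  rw [idealE_iff, not_and] at h
  by_cases hj : j = 0
  · simp [idealP, hj]
  · rw [idealP_of_ne hj, idealP_of_ne hj, ediv_succ_of_not_dvd (h hj)]

theorem ideal_base (i j : ℤ) (h : ¬3 ∣ j) :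
    idealE i j = true ∧ idealP i j = i % 9 ∧ idealR j = j % 9 := by
  have hj : j ≠ 0 := by rintro rfl; simp at h
  rw [idealE_iff, idealP_of_ne hj, idealR_of_ne hj, lev_eq_zero h]
  simp [hj]

theorem ideal_cross_iff (i j : ℤ) :
    (idealE i j = true ∧ idealP i j % 3 ≠ 0) ↔ i ≠ 0 ∧ j ≠ 0 ∧ lev i = lev j := by
  rw [idealE_iff]
  constructor
  · rintro ⟨⟨h1, q, h2⟩, h3⟩
    rw [idealP_of_ne h1, h2, Int.mul_ediv_cancel_left _ (by positivity)] at h3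
    have hq : ¬3 ∣ q := by lia
    refine ⟨?_, h1, by rw [h2, lev_three_pow_mul hq]⟩
    rintro rfl
    have : (3 : ℤ) ^ lev j ≠ 0 := by positivity
    have : q = 0 := by simpa using h2
    lia
  · rintro ⟨h1, h2, h3⟩
    obtain ⟨d, hd, h⟩ := exists_eq_lev h1
    rw [← h3, idealP_of_ne h2]
    refine ⟨⟨h2, _, h⟩, ?_⟩
    rw [← h3, h, lev_three_pow_mul hd, Int.mul_ediv_cancel_left _ (by positivity)]
    lia

theorem ideal_not_mark (i j : ℤ) (h : idealE i j = true) (h0 : idealP i j % 3 = 0) :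
    ¬idealE j i = true := by
  intro h'
  obtain ⟨h1, q, h2⟩ := idealE_iff.1 h
  obtain ⟨h3, h4⟩ := idealE_iff.1 h'
  rw [idealP_of_ne h1, h2, Int.mul_ediv_cancel_left _ (by positivity)] at h0
  rw [three_pow_dvd_iff h1] at h4
  obtain ⟨d, rfl⟩ : 3 ∣ q := by lia
  have := (three_pow_dvd_iff h3 (lev j + 1)).1 ⟨d, by rw [h2, pow_succ, mul_assoc]⟩
  lia

theorem ideal_link (i j : ℤ) (h : idealE i j = true) (h0 : idealP i j = 3 ∨ idealP i j = 6) :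
    idealP j i % 3 = idealR j / 3 := by
  obtain ⟨h1, q, h2⟩ := idealE_iff.1 h
  rw [idealP_of_ne h1, h2, Int.mul_ediv_cancel_left _ (by positivity)] at h0
  obtain ⟨d, rfl⟩ : 3 ∣ q := by lia
  have h3 : ¬3 ∣ d := by lia
  have h4 : lev i = lev j + 1 := by
    rw [h2, ← mul_assoc, ← pow_succ, lev_three_pow_mul h3]
  have hi : i ≠ 0 := by
    have : (3 : ℤ) ^ lev j ≠ 0 := by positivity
    rw [h2]
    simp only [ne_eq, mul_eq_zero, this, false_or]
    lia
  rw [idealP_of_ne hi, idealR_of_ne h1, h4, pow_succ, ← Int.ediv_ediv_of_nonneg (by positivity)]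
  lia

theorem isHierarchy_ideal (x : ℕ → Bool) :
    IsHierarchy idealP (fun i j => idealP j i) (fun i j => idealE i j = true)
      (fun i j => idealE j i = true) idealR idealR (fun i => x (lev i)) (fun j => x (lev j)) 0 0 where
  P_range := idealP_range
  Q_range i j := idealP_range j i
  P_succ := idealP_succ
  P_same := idealP_same
  Q_succ i j := idealP_succ j i
  Q_same i j := idealP_same j i
  col_base i j h := by
    rw [sub_zero] at h ⊢
    rw [sub_zero]
    exact ideal_base j i h
  row_base i j h := by
    rw [sub_zero] at h ⊢
    rw [sub_zero]
    exact ideal_base i j h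
  not_F := ideal_not_mark
  not_E i j := ideal_not_mark j i
  cross_iff i j := by
    rw [ideal_cross_iff, ideal_cross_iff]
    tauto
  cross i j h1 h2 := by
    obtain ⟨hi, hj, h⟩ := (ideal_cross_iff i j).1 ⟨h1, h2⟩
    rw [idealP_of_ne hj, idealP_of_ne hi, idealR_of_ne hi, idealR_of_ne hj, h]
    exact ⟨rfl, rfl, rfl⟩
  col_link i j := ideal_link j i
  row_link := ideal_link

open Classical in
/-- The lowest position of a ternary digit `1`. -/
noncomputable def act (j : ℤ) : Option ℕ :=
  if h : ∃ s : ℕ, j / 3 ^ s % 3 = 1 then some (Nat.find h) else none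

theorem act_eq_some {j : ℤ} {n : ℕ} :
    act j = some n ↔ j / 3 ^ n % 3 = 1 ∧ ∀ m < n, j / 3 ^ m % 3 ≠ 1 := by
  classical
  unfold act
  split_ifs with h
  · rw [Option.some_inj, Nat.find_eq_iff]
  · simp only [false_iff, not_and]
    exact fun h1 => absurd ⟨n, h1⟩ h

theorem exists_act {j : ℤ} {m : ℕ} (h : j / 3 ^ m % 3 = 1) : ∃ n ≤ m, act j = some n := by
  classical
  have h' : ∃ s : ℕ, j / 3 ^ s % 3 = 1 := ⟨m, h⟩
  exact ⟨Nat.find h', Nat.find_min' h' h, by rw [act, dif_pos h']⟩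

/-- Phases of the rows. -/
noncomputable def idealW (i j : ℤ) : ℤ := (act j).elim 0 fun n => i / 3 ^ n % 3

theorem idealW_of_act {i j : ℤ} {n : ℕ} (h : act j = some n) : idealW i j = i / 3 ^ n % 3 := by
  simp [idealW, h]

theorem idealW_eq_one {i j : ℤ} (h : idealW i j = 1) :
    ∃ n, act j = some n ∧ i / 3 ^ n % 3 = 1 := by
  unfold idealW at h
  cases hj : act j with
  | none => simp [hj] at h
  | some n => exact ⟨n, rfl, by simpa [hj] using h⟩

theorem act_eq_of_node {i j : ℤ} (h : idealW i j = 1) (h' : idealW j i = 1) :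
    ∃ n, act i = some n ∧ act j = some n := by
  obtain ⟨n, h1, h2⟩ := idealW_eq_one h
  obtain ⟨n', h3, h4⟩ := idealW_eq_one h'
  have h5 := (act_eq_some.1 h1).2 n'
  have h6 := (act_eq_some.1 h3).2 n
  obtain rfl : n = n' := by
    by_contra hne
    rcases Nat.lt_or_gt_of_ne hne with h | h
    · exact h6 h h2
    · exact h5 h h4
  exact ⟨n, h3, h1⟩

theorem idealR_mod_ne {j : ℤ} (hj : j ≠ 0) : idealR j % 3 ≠ 0 := by
  obtain ⟨d, hd, h⟩ := exists_eq_lev hj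
  rw [idealR_of_ne hj]
  conv_lhs => rw [h, lev_three_pow_mul hd, Int.mul_ediv_cancel_left _ (by positivity)]
  lia

theorem digit_of_lt_lev {x : ℤ} {n : ℕ} (h : 3 ^ (n + 1) ∣ x + 1) :
    (x + 1) / 3 ^ n % 3 = 0 ∧ x / 3 ^ n % 3 = 2 := by
  obtain ⟨q, hq⟩ := h
  have h1 := ediv_succ_of_dvd (i := x) (m := n) ⟨3 * q, by rw [hq]; ring⟩
  rw [hq, pow_succ, mul_assoc, Int.mul_ediv_cancel_left _ (by positivity)] at h1
  rw [hq, pow_succ, mul_assoc, Int.mul_ediv_cancel_left _ (by positivity)]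
  lia

theorem idealP_mod_eq_one {j i : ℤ} (h : idealP j i % 3 = 1) :
    i ≠ 0 ∧ j / 3 ^ lev i % 3 = 1 := by
  unfold idealP at h
  split_ifs at h with hi
  · simp at h
  · exact ⟨hi, by lia⟩

theorem ideal_bracket (i j : ℤ) (h : idealP j (i + 1) % 3 = 1) :
    (idealR (i + 1) % 3 = 1 → idealW i j ≠ 1 ∧ idealW (i + 1) j ≠ 2) ∧
      (idealR (i + 1) % 3 = 2 → idealW i j ≠ 0 ∧ idealW (i + 1) j ≠ 1) := by
  obtain ⟨hi, h1⟩ := idealP_mod_eq_one h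
  obtain ⟨n, hn, ha⟩ := exists_act h1
  rw [idealW_of_act ha, idealW_of_act ha, idealR_of_ne hi]
  rcases hn.lt_or_eq with hn | rfl
  · have := digit_of_lt_lev (x := i) (n := n) ((three_pow_dvd_iff hi _).2 hn)
    lia
  · have := ediv_succ_of_dvd (i := i) (m := lev (i + 1)) ((three_pow_dvd_iff hi _).2 le_rfl)
    lia

theorem ideal_no_bracket (i j : ℤ) (h : idealP j (i + 1) % 3 = 1 → idealR (i + 1) % 3 = 0) :
    idealW (i + 1) j = idealW i j ∨ idealW i j = 2 ∧ idealW (i + 1) j = 0 := by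
  cases ha : act j with
  | none => simp [idealW, ha]
  | some n =>
    rw [idealW_of_act ha, idealW_of_act ha]
    by_cases hi : i + 1 = 0
    · have := digit_of_lt_lev (x := i) (n := n) (by simp [hi])
      lia
    · have h1 := mt h (fun h1 => idealR_mod_ne hi h1)
      rw [idealP_of_ne hi] at h1
      by_cases hn : 3 ^ (n + 1) ∣ i + 1
      · have := digit_of_lt_lev hn
        lia
      · rw [three_pow_dvd_iff hi] at hn
        have hne : n ≠ lev (i + 1) := by
          rintro rfl
          have := (act_eq_some.1 ha).1
          lia
        rw [ediv_succ_of_not_dvd]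
        · simp
        · rw [three_pow_dvd_iff hi]
          lia

end MedvedevFormal

namespace MedvedevFormal

theorem isFree_iff {t : ℕ} : IsFree t ↔ ∀ s < t, t / 3 ^ s % 3 ≠ 1 := by
  refine ⟨fun h s _ => h s, fun h s => ?_⟩
  rcases lt_or_ge s t with hs | hs
  · exact h s hs
  · rw [Nat.div_eq_of_lt (hs.trans_lt (Nat.lt_pow_self (by norm_num)))]
    simp

instance : DecidablePred IsFree := fun _ => decidable_of_iff _ isFree_iff.symm

/-- The index of the last free number that is at most `t`. -/
def nodeIdx (t : ℕ) : ℕ := Nat.count IsFree (t + 1) - 1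

theorem nodeIdx_zero : nodeIdx 0 = 0 := by
  simp [nodeIdx, Nat.count_succ, isFree_zero]

theorem nodeIdx_of_isFree {t : ℕ} (h : IsFree t) : nodeIdx t = Nat.count IsFree t := by
  simp [nodeIdx, Nat.count_succ, h]

theorem freePos_nodeIdx {t : ℕ} (h : IsFree t) : freePos (nodeIdx t) = t := by
  rw [nodeIdx_of_isFree h]
  exact Nat.nth_count h

theorem nodeIdx_succ_of_isFree {t : ℕ} (h : IsFree (t + 1)) : nodeIdx (t + 1) = nodeIdx t + 1 := by
  have : 0 < Nat.count IsFree (t + 1) := by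
    rw [Nat.count_succ', if_pos isFree_zero]
    lia
  rw [nodeIdx_of_isFree h, nodeIdx]
  lia

theorem nodeIdx_succ_of_not_isFree {t : ℕ} (h : ¬IsFree (t + 1)) : nodeIdx (t + 1) = nodeIdx t := by
  rw [nodeIdx, nodeIdx, Nat.count_succ _ (t + 1), if_neg h]
  rfl

/-- The residue of an integer modulo `3 ^ n`, as a natural number. -/
def res (n : ℕ) (i : ℤ) : ℕ := (i % 3 ^ n).toNat

theorem coe_res (n : ℕ) (i : ℤ) : (res n i : ℤ) = i % 3 ^ n :=
  Int.toNat_of_nonneg (Int.emod_nonneg _ (by positivity))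

theorem res_lt (n : ℕ) (i : ℤ) : res n i < 3 ^ n := by
  have h := coe_res n i
  have h1 := Int.emod_lt_of_pos i (b := 3 ^ n) (by positivity)
  rw [← h] at h1
  exact_mod_cast h1

theorem digit_res {n m : ℕ} (hm : m < n) (i : ℤ) :
    (res n i / 3 ^ m % 3 : ℕ) = i / 3 ^ m % 3 := by
  have h := coe_res n i
  have h2 := Int.emod_add_mul_ediv i (3 ^ n)
  obtain ⟨e, rfl⟩ := Nat.exists_eq_add_of_lt hm
  push_cast
  rw [h]
  conv_rhs => rw [← h2, show (3 : ℤ) ^ (m + e + 1) * (i / 3 ^ (m + e + 1)) =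
    3 ^ m * (3 * (3 ^ e * (i / 3 ^ (m + e + 1)))) by ring,
    Int.add_mul_ediv_left _ _ (by positivity), Int.add_mul_emod_self_left]

theorem res_eq_zero {n : ℕ} {i : ℤ} (h : 3 ^ n ∣ i) : res n i = 0 := by
  have := coe_res n i
  rw [Int.emod_eq_zero_of_dvd h] at this
  lia

theorem res_succ {n : ℕ} {i : ℤ} (h : ¬3 ^ n ∣ i + 1) : res n (i + 1) = res n i + 1 := by
  have h1 := coe_res n i
  have h2 := coe_res n (i + 1)
  rw [emod_succ_of_not_dvd h] at h2
  lia

/-- A node column of a board is a column whose position on the board is free. -/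
theorem isFree_res_iff {i : ℤ} {n : ℕ} (h : i / 3 ^ n % 3 = 1) :
    IsFree (res n i) ↔ act i = some n := by
  rw [act_eq_some]
  constructor
  · intro hf
    refine ⟨h, fun m hm => ?_⟩
    rw [← digit_res hm]
    have := hf m
    lia
  · rintro ⟨-, h2⟩ s
    rcases lt_or_ge s n with hs | hs
    · have := h2 s hs
      rw [← digit_res hs] at this
      lia
    · rw [Nat.div_eq_of_lt ((res_lt n i).trans_le (Nat.pow_le_pow_right (by norm_num) hs))]
      simp

theorem freeLevel_nodeIdx {i : ℤ} {n : ℕ} (h : act i = some n) (h0 : 0 < nodeIdx (res n i)) :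
    freeLevel (nodeIdx (res n i)) = lev i := by
  have hf := (isFree_res_iff (act_eq_some.1 h).1).2 h
  have hne : ¬3 ^ n ∣ i := fun hd => by rw [res_eq_zero hd, nodeIdx_zero] at h0; lia
  have hi : i ≠ 0 := by rintro rfl; simp at hne
  obtain ⟨d, hd, hk⟩ := exists_freePos_eq h0
  rw [freePos_nodeIdx hf] at hk
  set s := freeLevel (nodeIdx (res n i))
  have h1 := coe_res n i
  have h2 := Int.emod_add_mul_ediv i (3 ^ n)
  have h3 := res_lt n i
  have hsn : s < n := by
    by_contra! hns
    refine hne ?_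
    rw [← h2, ← h1, hk]
    obtain ⟨e, he⟩ := Nat.exists_eq_add_of_le hns
    rw [he]
    push_cast
    exact dvd_add (Dvd.intro (3 ^ e * (d : ℤ)) (by ring)) (dvd_mul_right _ _)
  obtain ⟨e, he⟩ := Nat.exists_eq_add_of_lt hsn
  have h4 : i = 3 ^ s * (d + 3 * (3 ^ e * (i / 3 ^ n))) := by
    conv_lhs => rw [← h2, ← h1, hk, he]
    push_cast
    rw [he]
    ring
  rw [h4, lev_three_pow_mul]
  lia

section

variable {T : Type*}

/-- A solution of the tiling problem on the quadrant, with column labels given by `x`. -/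
structure IsSolution (R : QuadrantRules T) (x : ℕ → Bool) (D : ℕ → ℕ → T) : Prop where
  left : ∀ l, R.left (D 0 l)
  bot_zero : ∀ b, R.bot (D 0 0) b
  bot : ∀ k, 0 < k → R.bot (D k 0) (x (freeLevel k))
  horiz : ∀ k l, R.horiz (D k l) (D (k + 1) l)
  vert : ∀ k l, R.vert (D k l) (D k (l + 1))

/-- The tiles of the rows. -/
noncomputable def idealH (D : ℕ → ℕ → T) (i j : ℤ) : T :=
  (act j).elim (D 0 0) fun n => D (nodeIdx (res n i)) (nodeIdx (res n j))

/-- The tiles of the columns. -/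
noncomputable def idealV (D : ℕ → ℕ → T) (i j : ℤ) : T :=
  (act i).elim (D 0 0) fun n => D (nodeIdx (res n i)) (nodeIdx (res n j))

theorem idealH_of_act {D : ℕ → ℕ → T} {i j : ℤ} {n : ℕ} (h : act j = some n) :
    idealH D i j = D (nodeIdx (res n i)) (nodeIdx (res n j)) := by simp [idealH, h]

theorem idealV_of_act {D : ℕ → ℕ → T} {i j : ℤ} {n : ℕ} (h : act i = some n) :
    idealV D i j = D (nodeIdx (res n i)) (nodeIdx (res n j)) := by simp [idealV, h]

theorem ideal_pass {i : ℤ} {n : ℕ} (h1 : (i + 1) / 3 ^ n % 3 = 1) (h2 : act (i + 1) ≠ some n) :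
    nodeIdx (res n (i + 1)) = nodeIdx (res n i) := by
  have hf := (isFree_res_iff h1).not.2 h2
  have hd : ¬3 ^ n ∣ i + 1 := fun hd => hf (by rw [res_eq_zero hd]; exact isFree_zero)
  rw [res_succ hd] at hf ⊢
  exact nodeIdx_succ_of_not_isFree hf

theorem ideal_step {i j : ℤ} {n : ℕ} (h1 : act (i + 1) = some n) (h2 : act j = some n)
    (h : ¬(idealP j (i + 1) % 3 = 1 ∧ idealR (i + 1) % 3 = 1)) :
    nodeIdx (res n (i + 1)) = nodeIdx (res n i) + 1 := by
  have hi := (act_eq_some.1 h1).1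
  have hf := (isFree_res_iff hi).2 h1
  have hd : ¬3 ^ n ∣ i + 1 := by
    rintro ⟨q, hq⟩
    rw [hq, Int.mul_ediv_cancel_left _ (by positivity)] at hi
    have hl : lev (i + 1) = n := by rw [hq, lev_three_pow_mul (by lia)]
    have h0 : i + 1 ≠ 0 := by
      have : (3 : ℤ) ^ n ≠ 0 := by positivity
      rw [hq]
      simp only [ne_eq, mul_eq_zero, this, false_or]
      lia
    refine h ⟨?_, ?_⟩
    · rw [idealP_of_ne h0, hl]
      have := (act_eq_some.1 h2).1
      lia
    · rw [idealR_of_ne h0, hl, hq, Int.mul_ediv_cancel_left _ (by positivity)]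
      lia
  rw [res_succ hd] at hf ⊢
  exact nodeIdx_succ_of_isFree hf

theorem ideal_left {i j : ℤ} {n : ℕ} (h2 : act j = some n) (h : idealP j i % 3 = 1) :
    nodeIdx (res n i) = 0 := by
  obtain ⟨hi, h1⟩ := idealP_mod_eq_one h
  obtain ⟨n', hn, ha⟩ := exists_act h1
  obtain rfl : n' = n := by simpa [h2] using ha.symm
  rw [res_eq_zero ((three_pow_dvd_iff hi _).2 hn), nodeIdx_zero]

theorem isBoardLayer_ideal {R : QuadrantRules T} {x : ℕ → Bool} {D : ℕ → ℕ → T}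
    (h : IsSolution R x D) :
    IsBoardLayer R idealP (fun i j => idealP j i) idealR idealR (fun i => x (lev i)) idealW
      (fun i j => idealW j i) (idealH D) (idealV D) where
  wr_range i j := by
    unfold idealW
    rcases act j with _ | n
    · simp
    · simp only [Option.elim]
      lia
  wc_range i j := by
    unfold idealW
    rcases act i with _ | n
    · simp
    · simp only [Option.elim]
      lia
  row_open i j h1 := (ideal_bracket i j h1).1
  row_close i j h1 := (ideal_bracket i j h1).2
  row_none := ideal_no_bracket
  col_open i j h1 := (ideal_bracket j i h1).1
  col_close i j h1 := (ideal_bracket j i h1).2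
  col_none i j := ideal_no_bracket j i
  row_pass i j h1 h2 := by
    obtain ⟨n, hn, h3⟩ := idealW_eq_one h1
    rw [idealH_of_act hn, idealH_of_act hn, ideal_pass h3]
    exact fun h4 => h2 (by rw [idealW_of_act h4]; exact (act_eq_some.1 hn).1)
  col_pass i j h1 h2 := by
    obtain ⟨n, hn, h3⟩ := idealW_eq_one h1
    rw [idealV_of_act hn, idealV_of_act hn, ideal_pass h3]
    exact fun h4 => h2 (by rw [idealW_of_act h4]; exact (act_eq_some.1 hn).1)
  node_eq i j h1 h2 := by
    obtain ⟨n, h3, h4⟩ := act_eq_of_node h1 h2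
    rw [idealH_of_act h4, idealV_of_act h3]
  node_left i j h1 h2 h3 _ := by
    obtain ⟨n, h4, h5⟩ := act_eq_of_node h1 h2
    rw [idealH_of_act h5, ideal_left h5 h3]
    exact h.left _
  node_horiz i j h1 h2 h3 := by
    obtain ⟨n, h4, h5⟩ := act_eq_of_node h1 h2
    rw [idealH_of_act h5, idealH_of_act h5, ideal_step h4 h5 h3]
    exact h.horiz _ _
  node_bot i j h1 h2 h3 _ := by
    obtain ⟨n, h4, h5⟩ := act_eq_of_node h1 h2
    rw [idealV_of_act h4, ideal_left h4 h3]
    rcases Nat.eq_zero_or_pos (nodeIdx (res n i)) with h0 | h0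
    · rw [h0]
      exact h.bot_zero _
    · have := h.bot _ h0
      rwa [freeLevel_nodeIdx h4 h0] at this
  node_vert i j h1 h2 h3 := by
    obtain ⟨n, h4, h5⟩ := act_eq_of_node h1 h2
    rw [idealV_of_act h4, idealV_of_act h4, ideal_step h5 h4 h3]
    exact h.vert _ _

/-- The tiling of the plane that carries the point `x` and the solution `D`. -/
noncomputable def idealTiling (x : ℕ → Bool) (D : ℕ → ℕ → T) : ℤ → ℤ → Cell T :=
  cellOf idealP (fun i j => idealP j i) idealE (fun i j => idealE j i) idealR idealR
    (fun i => x (lev i)) (fun j => x (lev j)) idealW (fun i j => idealW j i) (idealH D) (idealV D)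

theorem isTiling_ideal {R : QuadrantRules T} {x : ℕ → Bool} {D : ℕ → ℕ → T}
    (h : IsSolution R x D) : IsTiling R (idealTiling x D) :=
  isTiling_cellOf (isHierarchy_ideal x) idealR_range idealR_range (isBoardLayer_ideal h)

end
end MedvedevFormal

namespace MedvedevFormal

/-! ### Row machines -/

/-- A one-way cellular tape with a control that reads the cell `0`. -/
structure RowMachine (C A : Type*) where
  boot : C
  step : C → A → C
  upd : C → A → Option A → A → A → A
  reject : C → Bool
  ini : Bool → A

namespace RowMachine

variable {C A : Type*} (M : RowMachine C A)

/-- The control and the tape after a given number of steps, started on the input `Z`. -/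
def run (Z : ℕ → Bool) : ℕ → C × (ℕ → A)
  | 0 => (M.boot, fun k => M.ini (Z k))
  | l + 1 =>
    let s := run Z l
    (M.step s.1 (s.2 0), fun k =>
      M.upd s.1 (s.2 0) (if k = 0 then none else some (s.2 (k - 1))) (s.2 k) (s.2 (k + 1)))

/-- Tiles of the space-time diagram: leftmost flag, control, cell `0`, and the previous,
current and next cells. -/
abbrev Tile (C A : Type*) := Bool × C × A × A × A × A

/-- The tiling problem whose solutions are the space-time diagrams without rejecting control. -/
def rules : QuadrantRules (Tile C A) where
  left T := T.1 = true ∧ T.2.2.1 = T.2.2.2.2.1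
  bot T b := T.2.1 = M.boot ∧ T.2.2.2.2.1 = M.ini (!T.1 && b)
  horiz T T' := T'.1 = false ∧ T'.2.1 = T.2.1 ∧ T'.2.2.1 = T.2.2.1 ∧
    T'.2.2.2.1 = T.2.2.2.2.1 ∧ T.2.2.2.2.2 = T'.2.2.2.2.1
  vert T T' := M.reject T.2.1 = false ∧ T'.2.1 = M.step T.2.1 T.2.2.1 ∧
    T'.2.2.2.2.1 = M.upd T.2.1 T.2.2.1 (if T.1 then none else some T.2.2.2.1)
      T.2.2.2.2.1 T.2.2.2.2.2

/-- The input of the row machine determined by a point `x`. -/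
noncomputable def input (x : ℕ → Bool) (k : ℕ) : Bool := if k = 0 then false else x (freeLevel k)

/-- The space-time diagram. -/
def diagram (Z : ℕ → Bool) (k l : ℕ) : Tile C A :=
  let s := M.run Z l
  (decide (k = 0), s.1, s.2 0, s.2 (k - 1), s.2 k, s.2 (k + 1))

variable {M} in
theorem reject_eq_false {x : ℕ → Bool} (h : ∀ N, ∃ D, IsPartialSolution M.rules x N D) (l : ℕ) :
    M.reject (M.run (input x) l).1 = false := by
  obtain ⟨D, hD⟩ := h (l + 1)
  set N := l + 1 with hN
  have left : ∀ l ≤ N, (D 0 l).1 = true ∧ (D 0 l).2.2.1 = (D 0 l).2.2.2.2.1 := hD.left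
  have horiz : ∀ k < N, ∀ l ≤ N, _ := hD.horiz
  simp only [rules] at horiz
  have vert : ∀ k ≤ N, ∀ l < N, _ := hD.vert
  simp only [rules] at vert
  have row : ∀ l ≤ N, ∀ k ≤ N, (D k l).1 = decide (k = 0) ∧ (D k l).2.1 = (D 0 l).2.1 ∧
      (D k l).2.2.1 = (D 0 l).2.2.2.2.1 := by
    intro l hl k
    induction k with
    | zero => intro _; simpa using left l hl
    | succ k ih =>
      intro hk
      obtain ⟨h1, h2, h3, -, -⟩ := horiz k (by lia) l hl
      obtain ⟨-, h5, h6⟩ := ih (by lia)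
      exact ⟨by simp [h1], h2.trans h5, h3.trans h6⟩
  have key : ∀ l ≤ N, (D 0 l).2.1 = (M.run (input x) l).1 ∧
      ∀ k, k + l ≤ N → (D k l).2.2.2.2.1 = (M.run (input x) l).2 k := by
    intro l
    induction l with
    | zero =>
      intro _
      obtain ⟨b, h1, h2⟩ := hD.bot_zero
      refine ⟨h1, fun k hk => ?_⟩
      rcases Nat.eq_zero_or_pos k with rfl | h0
      · rw [h2, (left 0 (by lia)).1]
        simp [run, input]
      · obtain ⟨-, h3⟩ := hD.bot k hk h0
        rw [h3, (row 0 (by lia) k hk).1]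
        simp [run, input, h0.ne']
    | succ l ih =>
      intro hl
      obtain ⟨h1, h2⟩ := ih (by lia)
      have h3 : (D 0 l).2.2.2.2.1 = (M.run (input x) l).2 0 := h2 0 (by lia)
      refine ⟨?_, fun k hk => ?_⟩
      · rw [(vert 0 (by lia) l (by lia)).2.1, (row l (by lia) 0 (by lia)).2.2, h1, h3]
        rfl
      · obtain ⟨h4, h5, h6⟩ := row l (by lia) k (by lia)
        rw [(vert k (by lia) l (by lia)).2.2, h4, h5, h6, h1, h3, h2 k (by lia)]
        rw [(horiz k (by lia) l (by lia)).2.2.2.2, h2 (k + 1) (by lia)]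
        rcases k with _ | k
        · rfl
        · rw [(horiz k (by lia) l (by lia)).2.2.2.1, h2 k (by lia)]
          rfl
  rw [← (key l (by lia)).1]
  exact (vert 0 (by lia) l (by lia)).1

variable {M} in
theorem isSolution {x : ℕ → Bool} (h : ∀ l, M.reject (M.run (input x) l).1 = false) :
    IsSolution M.rules x (M.diagram (input x)) where
  left l := by simp [rules, diagram]
  bot_zero b := by simp [rules, diagram, run, input]
  bot k hk := by simp [rules, diagram, run, input, hk.ne']
  horiz k l := by simp [rules, diagram]
  vert k l := by
    refine ⟨h l, rfl, ?_⟩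
    rcases k with _ | k <;> simp [diagram, run]

end RowMachine
end MedvedevFormal

namespace MedvedevFormal

/-! ### Stack machines with an input tape -/

/-- Actions on a family of stacks and a one-way input tape. -/
inductive StackOp (K Γ : Type*)
  | skip
  | push (κ : K) (γ : Γ)
  | pop (κ : K)
  | advance

/-- A deterministic machine acting on stacks and an input tape; it reads all their heads. -/
structure StackMachine (C K Γ : Type*) where
  start : C
  reject : C
  step : C → (K → Option Γ) × Bool → C × StackOp K Γ

namespace StackMachine

variable {C K Γ : Type*}

/-- The heads of stacks and input tape. -/
def heads (S : K → List Γ) (Z : ℕ → Bool) (k : ℕ) : (K → Option Γ) × Bool :=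
  (fun κ => (S κ)[k]?, Z k)

variable [DecidableEq K]

/-- The effect of an action. -/
def apply : StackOp K Γ → (K → List Γ) × (ℕ → Bool) → (K → List Γ) × (ℕ → Bool)
  | .skip, s => s
  | .push κ γ, s => (Function.update s.1 κ (γ :: s.1 κ), s.2)
  | .pop κ, s => (Function.update s.1 κ (s.1 κ).tail, s.2)
  | .advance, s => (s.1, fun n => s.2 (n + 1))

variable (M : StackMachine C K Γ)

/-- One step of computation. -/
def next (s : C × (K → List Γ) × (ℕ → Bool)) : C × (K → List Γ) × (ℕ → Bool) :=
  let p := M.step s.1 (heads s.2.1 s.2.2 0)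
  (p.1, apply p.2 s.2)

/-- The configuration `t` is reached from `s`. -/
def Leads (s t : C × (K → List Γ) × (ℕ → Bool)) : Prop := ∃ n, M.next^[n] s = t

variable {M} in
theorem Leads.trans {r s t} (h1 : M.Leads r s) (h2 : M.Leads s t) : M.Leads r t := by
  obtain ⟨m, rfl⟩ := h1
  obtain ⟨n, rfl⟩ := h2
  exact ⟨n + m, Function.iterate_add_apply _ _ _ _⟩

variable {M} in
theorem Leads.refl (s) : M.Leads s s := ⟨0, rfl⟩

variable {M} in
theorem Leads.head {s t} (h : M.Leads (M.next s) t) : M.Leads s t :=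
  Leads.trans ⟨1, rfl⟩ h

/-- The cellular tape simulating a stack machine. -/
def updCell (o : StackOp K Γ) (p : Option ((K → Option Γ) × Bool)) (c n : (K → Option Γ) × Bool) :
    (K → Option Γ) × Bool :=
  match o with
  | .skip => c
  | .push κ γ => (Function.update c.1 κ (p.elim (some γ) fun q => q.1 κ), c.2)
  | .pop κ => (Function.update c.1 κ (n.1 κ), c.2)
  | .advance => (c.1, n.2)

theorem heads_apply (o : StackOp K Γ) (s : (K → List Γ) × (ℕ → Bool)) (k : ℕ) :
    heads (apply o s).1 (apply o s).2 k =
      updCell o (if k = 0 then none else some (heads s.1 s.2 (k - 1))) (heads s.1 s.2 k)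
        (heads s.1 s.2 (k + 1)) := by
  cases o with
  | skip => rfl
  | push κ γ =>
    refine Prod.ext (funext fun κ' => ?_) rfl
    by_cases h : κ' = κ
    · subst h
      rcases k with _ | k <;> simp [heads, apply, updCell]
    · simp [heads, apply, updCell, h]
  | pop κ =>
    refine Prod.ext (funext fun κ' => ?_) rfl
    by_cases h : κ' = κ
    · subst h
      simp [heads, apply, updCell]
    · simp [heads, apply, updCell, h]
  | advance => rfl

open Classical in
/-- A stack machine that stays in a finite set of controls is simulated by a row machine. -/
theorem exists_rowMachine [Finite K] [Finite Γ] {S : Set C} (hS : S.Finite) (h0 : M.start ∈ S)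
    (hstep : ∀ c ∈ S, ∀ h, (M.step c h).1 ∈ S) :
    ∃ (c a : ℕ) (R : RowMachine (Fin c) (Fin a)), ∀ Z l,
      R.reject (R.run Z l).1 = true ↔ (M.next^[l] (M.start, fun _ => [], Z)).1 = M.reject := by
  have := hS.to_subtype
  obtain ⟨c, ⟨e⟩⟩ := Finite.exists_equiv_fin S
  obtain ⟨a, ⟨d⟩⟩ := Finite.exists_equiv_fin ((K → Option Γ) × Bool)
  let f : C → Fin c := fun x => if h : x ∈ S then e ⟨x, h⟩ else e ⟨_, h0⟩
  let g : Fin c → C := fun x => (e.symm x).1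
  have hfg : ∀ x ∈ S, g (f x) = x := fun x hx => by simp [f, g, hx]
  let R : RowMachine (Fin c) (Fin a) :=
    { boot := f M.start
      step := fun x h => f (M.step (g x) (d.symm h)).1
      upd := fun x h p q r =>
        d (updCell (M.step (g x) (d.symm h)).2 (p.map d.symm) (d.symm q) (d.symm r))
      reject := fun x => decide (g x = M.reject)
      ini := fun b => d (fun _ => none, b) }
  refine ⟨c, a, R, fun Z l => ?_⟩
  have key : (M.next^[l] (M.start, fun _ => [], Z)).1 ∈ S ∧
      R.run Z l = (f (M.next^[l] (M.start, fun _ => [], Z)).1,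
        fun k => d (heads (M.next^[l] (M.start, fun _ => [], Z)).2.1
          (M.next^[l] (M.start, fun _ => [], Z)).2.2 k)) := by
    induction l with
    | zero => exact ⟨h0, rfl⟩
    | succ l ih =>
      rw [Function.iterate_succ_apply']
      set s := M.next^[l] (M.start, fun _ => [], Z)
      refine ⟨hstep _ ih.1 _, ?_⟩
      rw [RowMachine.run, ih.2]
      refine Prod.ext ?_ (funext fun k => ?_)
      · simp [R, hfg _ ih.1, next]
      · simp only [R, hfg _ ih.1, next, Equiv.symm_apply_apply, heads_apply]
        congr 2
        split_ifs <;> simp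
  rw [key.2]
  simp [R, hfg _ key.1]

end StackMachine

/-! ### Iterating a computable function along the input -/

open Turing PartrecToTM2
open TM2.Stmt hiding halt

/-- Controls of the machine that iterates a function along its input. -/
inductive IterCtl
  | boot
  | feed
  | bit (b : Bool)
  | put (b : Bool)
  | check
  | rej
  | run (q : Stmt') (v : Option Γ')

/-- The iteration machine of the program with entry point `e`. -/
def iterStep (e : Λ') : IterCtl → (K' → Option Γ') × Bool → IterCtl × StackOp K' Γ'
  | .boot, _ => (.feed, .push .main .cons)
  | .feed, h => (.bit h.2, .advance)
  | .bit b, _ => (.put b, .push .main .cons)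
  | .put b, _ => (.run (tr e) none, if b then .push .main .bit1 else .skip)
  | .check, h => (if h.1 .main = some .cons then .rej else .feed, .skip)
  | .rej, _ => (.rej, .skip)
  | .run (push κ f q) v, _ => (.run q v, .push κ (f v))
  | .run (peek κ f q) v, h => (.run q (f v (h.1 κ)), .skip)
  | .run (pop κ f q) v, h => (.run q (f v (h.1 κ)), .pop κ)
  | .run (load f q) v, _ => (.run q (f v), .skip)
  | .run (branch p q₁ q₂) v, _ => (.run (cond (p v) q₁ q₂) v, .skip)
  | .run (goto l) v, _ => (.run (tr (l v)) v, .skip)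
  | .run TM2.Stmt.halt _, _ => (.check, .skip)

/-- The machine that rejects when the iterated function takes the value `0`. -/
def iterMachine (e : Λ') : StackMachine IterCtl K' Γ' where
  start := .boot
  reject := .rej
  step := iterStep e

instance : Finite K' :=
  Finite.of_injective (fun κ : K' => (decide (κ = .main), decide (κ = .rev), decide (κ = .aux)))
    fun a b => by cases a <;> cases b <;> simp

/-- The configuration that continues a computation of the program. -/
def resume (c : Cfg') (Z : ℕ → Bool) : IterCtl × (K' → List Γ') × (ℕ → Bool) :=
  (match c.l with
    | some l => .run (tr l) c.var
    | none => .check, c.stk, Z)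

theorem leads_stepAux (e : Λ') (q : Stmt') (v : Option Γ') (S : K' → List Γ') (Z : ℕ → Bool) :
    (iterMachine e).Leads (.run q v, S, Z) (resume (TM2.stepAux q v S) Z) := by
  induction q generalizing v S with
  | push κ f q ih => exact StackMachine.Leads.head (ih _ _)
  | peek κ f q ih =>
    refine StackMachine.Leads.head ?_
    have := ih (f v (S κ).head?) S
    rw [List.head?_eq_getElem?] at this
    rw [TM2.stepAux, List.head?_eq_getElem?]
    exact this
  | pop κ f q ih =>
    refine StackMachine.Leads.head ?_
    have := ih (f v (S κ).head?) (Function.update S κ (S κ).tail)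
    rw [List.head?_eq_getElem?] at this
    rw [TM2.stepAux, List.head?_eq_getElem?]
    exact this
  | load f q ih => exact StackMachine.Leads.head (ih _ _)
  | branch p q₁ q₂ ih₁ ih₂ =>
    refine StackMachine.Leads.head ?_
    rw [TM2.stepAux]
    change (iterMachine e).Leads (.run (cond (p v) q₁ q₂) v, S, Z) _
    cases p v
    · exact ih₂ _ _
    · exact ih₁ _ _
  | goto l => exact StackMachine.Leads.head (.refl _)
  | halt => exact StackMachine.Leads.head (.refl _)

theorem leads_of_reaches (e : Λ') {c c' : Cfg'} (h : StateTransition.Reaches (TM2.step tr) c c')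
    (Z : ℕ → Bool) : (iterMachine e).Leads (resume c Z) (resume c' Z) := by
  induction h with
  | refl => exact .refl _
  | @tail b c' _ h ih =>
    refine ih.trans ?_
    rcases b with ⟨_ | l, v, S⟩
    · cases h
    · obtain rfl : TM2.stepAux (tr l) v S = c' := Option.some.inj h
      exact leads_stepAux e _ v S Z

theorem finite_iterCtl (c : ToPartrec.Code) : ∃ S : Set IterCtl, S.Finite ∧
    (iterMachine (trNormal c .halt)).start ∈ S ∧
    ∀ x ∈ S, ∀ h, ((iterMachine (trNormal c .halt)).step x h).1 ∈ S := by
  classical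
  set L := codeSupp c .halt
  have hL := tr_supports c .halt
  let Q : Set Stmt' := {q | some q ∈ TM2.stmts tr L}
  have hQ : Q.Finite :=
    Set.Finite.preimage (Option.some_injective _).injOn (Finset.finite_toSet (TM2.stmts tr L))
  have htr : ∀ l ∈ L, tr l ∈ Q := fun l hl =>
    Finset.some_mem_insertNone.2 (Finset.mem_biUnion.2 ⟨l, hl, TM2.stmts₁_self⟩)
  have hsub : ∀ q ∈ Q, ∀ q' ∈ TM2.stmts₁ q, q' ∈ Q := fun q hq q' h => TM2.stmts_trans h hq
  let S : Set IterCtl := {.boot, .feed, .check, .rej} ∪ Set.range .bit ∪ Set.range .put ∪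
    Set.image2 .run Q Set.univ
  have hrun : ∀ q ∈ Q, ∀ v, IterCtl.run q v ∈ S := fun q hq v =>
    Or.inr (Set.mem_image2_of_mem hq trivial)
  have hsp : ({.boot, .feed, .check, .rej} : Set IterCtl) ⊆ S := fun x hx => .inl (.inl (.inl hx))
  refine ⟨S, ?_, by simp [S, iterMachine], ?_⟩
  · exact (((Set.toFinite _).union (Set.finite_range _)).union (Set.finite_range _)).union
      (hQ.image2 _ Set.finite_univ)
  · rintro x (((hx | ⟨b, rfl⟩) | ⟨b, rfl⟩) | ⟨q, hq, v, -, rfl⟩) h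
    · rcases hx with rfl | rfl | rfl | rfl
      · exact hsp (by simp [iterMachine, iterStep])
      · exact .inl (.inl (.inr ⟨h.2, rfl⟩))
      · refine hsp ?_
        simp only [iterMachine, iterStep]
        split_ifs <;> simp
      · exact hsp (by simp [iterMachine, iterStep])
    · exact .inl (.inr ⟨b, rfl⟩)
    · exact hrun _ (htr _ hL.1) _
    · have h1 := hsub q hq
      cases q with
      | push κ f q => exact hrun _ (h1 _ (by simp [TM2.stmts₁, TM2.stmts₁_self])) _
      | peek κ f q => exact hrun _ (h1 _ (by simp [TM2.stmts₁, TM2.stmts₁_self])) _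
      | pop κ f q => exact hrun _ (h1 _ (by simp [TM2.stmts₁, TM2.stmts₁_self])) _
      | load f q => exact hrun _ (h1 _ (by simp [TM2.stmts₁, TM2.stmts₁_self])) _
      | branch p q₁ q₂ =>
        refine hrun _ ?_ _
        cases p v
        · exact h1 q₂ (by simp [TM2.stmts₁, TM2.stmts₁_self])
        · exact h1 q₁ (by simp [TM2.stmts₁, TM2.stmts₁_self])
      | goto l =>
        obtain ⟨l', hl', h2⟩ := Finset.mem_biUnion.1 (Finset.some_mem_insertNone.1 hq)
        exact hrun _ (htr _ (TM2.stmts₁_supportsStmt_mono h2 (hL.2 l' hl') v)) _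
      | halt => exact hsp (by simp [iterMachine, iterStep])

/-- The sequence of values of the iteration. -/
def iterSeq (g : ℕ → ℕ → ℕ) (Z : ℕ → Bool) : ℕ → ℕ
  | 0 => 0
  | k + 1 => g (Z k).toNat (iterSeq g Z k)

/-- The configuration that starts the evaluation of `c` on `v`. -/
def evalCfg (c : ToPartrec.Code) (v : List ℕ) : PartrecToTM2.Cfg' :=
  ⟨some (trNormal c .halt), none, K'.elim (trList v) [] [] []⟩

theorem leads_cycle {c : ToPartrec.Code} {g : ℕ → ℕ → ℕ}
    (hc : ∀ a b, c.eval [a, b] = Part.some [g a b]) (s : ℕ) (Z : ℕ → Bool) :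
    (iterMachine (trNormal c .halt)).Leads (.feed, K'.elim (trList [s]) [] [] [], Z)
      (.check, K'.elim (trList [g (Z 0).toNat s]) [] [] [], fun n => Z (n + 1)) := by
  have h1 : StateTransition.eval (TM2.step tr) (evalCfg c [(Z 0).toNat, s]) = _ := tr_eval c _
  rw [hc] at h1
  have h2 : PartrecToTM2.halt [g (Z 0).toNat s] ∈
      StateTransition.eval (TM2.step tr) (evalCfg c [(Z 0).toNat, s]) := by
    rw [h1]
    exact Part.mem_map _ (Part.mem_some _)
  have h3 := leads_of_reaches (trNormal c .halt) (StateTransition.mem_eval.1 h2).1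
    fun n => Z (n + 1)
  refine StackMachine.Leads.head (StackMachine.Leads.head (StackMachine.Leads.head ?_))
  have h4 : (iterMachine (trNormal c .halt)).next ((iterMachine (trNormal c .halt)).next
      ((iterMachine (trNormal c .halt)).next (.feed, K'.elim (trList [s]) [] [] [], Z))) =
      resume (evalCfg c [(Z 0).toNat, s]) fun n => Z (n + 1) := by
    simp only [StackMachine.next, iterMachine, iterStep, resume, evalCfg,
      StackMachine.apply, StackMachine.heads]
    cases Z 0
    · simp [K'.elim_update_main, trList]
    · have : trNat 1 = [.bit1] := by simp [trNat, trNum, trPosNum]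
      simp [K'.elim_update_main, trList, this]
  rw [h4]
  exact h3

theorem rej_absorbing (e : Λ') {s} (h : s.1 = IterCtl.rej) (n : ℕ) :
    ((iterMachine e).next^[n] s).1 = .rej := by
  induction n with
  | zero => exact h
  | succ n ih =>
    rw [Function.iterate_succ_apply']
    simp only [StackMachine.next, ih]
    rfl

theorem trList_head_eq_cons (n : ℕ) : (trList [n])[0]? = some .cons ↔ n = 0 := by
  rcases Nat.eq_zero_or_pos n with rfl | hn
  · simp [trList]
  · have h0 : trNat n ≠ [] := by
      rw [trNat]
      obtain ⟨p, hp⟩ : ∃ p, (n : Num) = .pos p := by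
        rcases h : (n : Num) with _ | p
        · have := congrArg (fun a : Num => (a : ℕ)) h
          simp at this
          lia
        · exact ⟨p, rfl⟩
      rw [hp, trNum]
      cases p <;> simp [trPosNum]
    have h1 := trNat_natEnd n
    rcases h2 : trNat n with _ | ⟨x, l⟩
    · exact absurd h2 h0
    · have h3 := h1 x (by simp [h2])
      simp only [trList, h2, List.cons_append, List.getElem?_cons_zero, Option.some.injEq, hn.ne',
        iff_false]
      rintro rfl
      simp [natEnd] at h3

theorem iterMachine_rejects_iff {c : ToPartrec.Code} {g : ℕ → ℕ → ℕ}
    (hc : ∀ a b, c.eval [a, b] = Part.some [g a b]) (Z : ℕ → Bool) :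
    (∀ l, ((iterMachine (trNormal c .halt)).next^[l] (.boot, fun _ => [], Z)).1 ≠ .rej) ↔
      ∀ k, iterSeq g Z (k + 1) ≠ 0 := by
  set M := iterMachine (trNormal c .halt)
  let s0 : IterCtl × (K' → List Γ') × (ℕ → Bool) := (.boot, fun _ => [], Z)
  let F : ℕ → IterCtl × (K' → List Γ') × (ℕ → Bool) := fun k =>
    (.feed, K'.elim (trList [iterSeq g Z k]) [] [] [], fun n => Z (n + k))
  have hboot : M.Leads s0 (F 0) := by
    refine StackMachine.Leads.head ?_
    suffices M.next s0 = F 0 by rw [this]; exact .refl _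
    have : (fun _ : K' => ([] : List Γ')) = K'.elim [] [] [] [] := by
      funext κ
      cases κ <;> rfl
    simp only [F, StackMachine.next, s0, M, iterMachine, iterStep, StackMachine.apply, iterSeq,
      this, K'.elim_update_main]
    simp [trList]
  have hcheck : ∀ k, ∃ s, M.Leads (F k) s ∧
      M.next s = if iterSeq g Z (k + 1) = 0 then (.rej, s.2) else F (k + 1) := by
    intro k
    refine ⟨_, leads_cycle hc (iterSeq g Z k) fun n => Z (n + k), ?_⟩
    have e1 : g (Z (0 + k)).toNat (iterSeq g Z k) = iterSeq g Z (k + 1) := by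
      rw [Nat.zero_add]
      rfl
    simp only [e1, StackMachine.next, M, iterMachine, iterStep, StackMachine.heads,
      StackMachine.apply, K'.elim_main, trList_head_eq_cons]
    split_ifs
    · rfl
    · simp only [F, add_assoc, add_comm 1]
  change (∀ l, (M.next^[l] s0).1 ≠ .rej) ↔ _
  constructor
  · intro h
    have h1 : ∀ k, M.Leads s0 (F k) := by
      intro k
      induction k with
      | zero => exact hboot
      | succ k ih =>
        obtain ⟨s, h1, h2⟩ := hcheck k
        have h3 : M.Leads s0 (M.next s) := (ih.trans h1).trans ⟨1, rfl⟩
        rw [h2] at h3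
        split_ifs at h3 with h4
        · obtain ⟨n, hn⟩ := h3
          exact absurd (congrArg Prod.fst hn) (h n)
        · exact h3
    intro k hk
    obtain ⟨s, h2, h3⟩ := hcheck k
    rw [if_pos hk] at h3
    obtain ⟨n, hn⟩ := ((h1 k).trans h2).trans (⟨1, h3⟩ : M.Leads s (.rej, s.2))
    exact h n (congrArg Prod.fst hn)
  · intro h
    have h1 : ∀ k, ∃ n ≥ k, M.next^[n] s0 = F k := by
      intro k
      induction k with
      | zero =>
        obtain ⟨n, hn⟩ := hboot
        exact ⟨n, Nat.zero_le _, hn⟩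
      | succ k ih =>
        obtain ⟨n, hn, h1⟩ := ih
        obtain ⟨s, ⟨m, h2⟩, h3⟩ := hcheck k
        rw [if_neg (h k)] at h3
        refine ⟨(m + n) + 1, by lia, ?_⟩
        rw [Function.iterate_succ_apply', Function.iterate_add_apply, h1, h2, h3]
    intro l hl
    obtain ⟨n, hn, h2⟩ := h1 l
    have h3 := rej_absorbing (trNormal c .halt) hl (n - l)
    rw [← Function.iterate_add_apply, Nat.sub_add_cancel hn, h2] at h3
    cases h3

/-- A computable function can be iterated along an input by a row machine. -/
theorem exists_rowMachine_iterSeq {g : ℕ → ℕ → ℕ} (hg : Computable₂ g) :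
    ∃ (c a : ℕ) (R : RowMachine (Fin c) (Fin a)), ∀ Z,
      (∀ l, R.reject (R.run Z l).1 = false) ↔ ∀ k, iterSeq g Z (k + 1) ≠ 0 := by
  obtain ⟨c, hc⟩ := ToPartrec.Code.exists_code
    ((Nat.Partrec'.part_iff₂ (f := fun a b => Part.some (g a b))).2 (Computable.partrec hg))
  have hc' : ∀ a b, c.eval [a, b] = Part.some [g a b] := fun a b => by
    have := hc ⟨[a, b], rfl⟩
    rw [this]
    rfl
  obtain ⟨S, hS, h0, hstep⟩ := finite_iterCtl c
  obtain ⟨n, a, R, hR⟩ := StackMachine.exists_rowMachine _ hS h0 hstep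
  refine ⟨n, a, R, fun Z => ?_⟩
  rw [← iterMachine_rejects_iff hc' Z]
  refine forall_congr' fun l => ?_
  rw [← Bool.not_eq_true, hR]
  rfl

end MedvedevFormal

namespace MedvedevFormal

/-! ### Computability of the board combinatorics -/

section
variable {α : Type*} [Primcodable α] {f g : α → ℕ}

theorem computable_add (hf : Computable f) (hg : Computable g) : Computable fun a => f a + g a :=
  Primrec.nat_add.to_comp.comp hf hg

theorem computable_sub (hf : Computable f) (hg : Computable g) : Computable fun a => f a - g a :=
  Primrec.nat_sub.to_comp.comp hf hg

theorem computable_mul (hf : Computable f) (hg : Computable g) : Computable fun a => f a * g a :=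
  Primrec.nat_mul.to_comp.comp hf hg

theorem computable_div (hf : Computable f) (hg : Computable g) : Computable fun a => f a / g a :=
  Primrec.nat_div.to_comp.comp hf hg

theorem computable_mod (hf : Computable f) (hg : Computable g) : Computable fun a => f a % g a :=
  Primrec.nat_mod.to_comp.comp hf hg

theorem computable_pow (hf : Computable f) (hg : Computable g) : Computable fun a => f a ^ g a :=
  (Computable.nat_rec hg (Computable.const 1)
    (h := fun a p => p.2 * f a)
    (computable_mul (Computable.snd.comp Computable.snd) (hf.comp Computable.fst)).to₂).of_eq
    fun a => by induction g a <;> simp_all [pow_succ]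

theorem computable_cond_decide {β : Type*} [Primcodable β] {p : α → Prop} [DecidablePred p]
    {u v : α → β} (hp : Computable fun a => decide (p a)) (hu : Computable u) (hv : Computable v) :
    Computable fun a => if p a then u a else v a :=
  (Computable.cond hp hu hv).of_eq fun a => by by_cases h : p a <;> simp [h]

/-- The ternary digit of `f a` at position `g a`. -/
theorem computable_digit (hf : Computable f) (hg : Computable g) :
    Computable fun a => f a / 3 ^ g a % 3 :=
  computable_mod (computable_div hf (computable_pow (Computable.const 3) hg)) (Computable.const 3)

end

theorem computable_isFree : Computable fun t => decide (IsFree t) := by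
  have h : Computable fun t : ℕ =>
      (List.range t).all fun s => !decide (t / 3 ^ s % 3 = 1) :=
    computable_list_all Primrec.list_range.to_comp
      (computable_not (computable_decide_eq (computable_digit Computable.fst Computable.snd)
        (Computable.const 1))).to₂
  refine h.of_eq fun t => ?_
  rw [Bool.eq_iff_iff]
  simp [isFree_iff]

theorem computable_count_isFree : Computable fun t => Nat.count IsFree t := by
  refine (Computable.nat_rec (f := id) (g := fun _ => 0)
    (h := fun _ p => p.2 + if IsFree p.1 then 1 else 0) Computable.id (Computable.const 0)
    (computable_add (Computable.snd.comp Computable.snd) (computable_cond_decide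
      (computable_isFree.comp (Computable.fst.comp Computable.snd)) (Computable.const 1)
      (Computable.const 0))).to₂).of_eq fun t => ?_
  induction t with
  | zero => simp
  | succ t ih => simp_all [Nat.count_succ]

theorem computable_nodeIdx : Computable nodeIdx :=
  computable_sub (computable_count_isFree.comp Computable.succ) (Computable.const 1)

theorem exists_isFree_count_eq (k : ℕ) :
    ∃ t, (decide (IsFree t) && decide (Nat.count IsFree t = k)) = true :=
  ⟨freePos k, by
    rw [Bool.and_eq_true, decide_eq_true_eq, decide_eq_true_eq]
    exact ⟨isFree_freePos k, Nat.count_nth_of_infinite infinite_isFree k⟩⟩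

theorem computable_freePos : Computable freePos := by
  refine (computable_nat_find (p := fun k t => decide (IsFree t) && decide (Nat.count IsFree t = k))
    (computable_and (computable_isFree.comp Computable.snd) (computable_decide_eq
      (computable_count_isFree.comp Computable.snd) Computable.fst)).to₂
    exists_isFree_count_eq).of_eq fun k => ?_
  have h := Nat.find_spec (exists_isFree_count_eq k)
  rw [Bool.and_eq_true, decide_eq_true_eq, decide_eq_true_eq] at h
  exact (Nat.nth_count h.1).symm.trans (congrArg freePos h.2)

theorem exists_not_pow_dvd (n : ℕ) : ∃ s, (decide (n = 0) || !decide (n % 3 ^ (s + 1) = 0)) = true := by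
  rcases Nat.eq_zero_or_pos n with rfl | h
  · simp
  · refine ⟨n, ?_⟩
    have : n < 3 ^ (n + 1) := (Nat.lt_pow_self (by norm_num)).trans (Nat.pow_lt_pow_right (by norm_num) (by lia))
    simp [Nat.mod_eq_of_lt this]

theorem computable_padicValNat_three : Computable (padicValNat 3) := by
  refine (computable_nat_find
    (p := fun n s => decide (n = 0) || !decide (n % 3 ^ (s + 1) = 0))
    (computable_or (computable_decide_eq Computable.fst (Computable.const 0))
      (computable_not (computable_decide_eq (computable_mod Computable.fst (computable_pow
        (Computable.const 3) (Computable.succ.comp Computable.snd))) (Computable.const 0)))).to₂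
    exists_not_pow_dvd).of_eq fun n => ?_
  have := Fact.mk Nat.prime_three
  rcases Nat.eq_zero_or_pos n with rfl | h
  · simp
  · rw [Nat.find_eq_iff]
    simp only [Bool.or_eq_true, h.ne', decide_false, Bool.not_eq_true', decide_eq_false_iff_not,
      ← Nat.dvd_iff_mod_eq_zero, Bool.false_eq_true, false_or, not_not]
    exact ⟨pow_succ_padicValNat_not_dvd h.ne', fun m hm => (pow_dvd_pow 3 (by lia)).trans
      pow_padicValNat_dvd⟩

theorem computable_freeLevel : Computable freeLevel :=
  computable_padicValNat_three.comp computable_freePos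

theorem exists_freeLevel_eq (s : ℕ) : ∃ k, 0 < k ∧ freeLevel k = s := by
  have h : freePos (nodeIdx (2 * 3 ^ s)) = 2 * 3 ^ s := freePos_nodeIdx (isFree_two_mul_pow s)
  refine ⟨nodeIdx (2 * 3 ^ s), Nat.pos_of_ne_zero fun h0 => ?_, ?_⟩
  · rw [h0, freePos_zero] at h
    have := Nat.pow_pos (n := s) (show 0 < 3 by norm_num)
    lia
  · have := Fact.mk Nat.prime_three
    rw [freeLevel, h, padicValNat.mul (by norm_num) (by positivity), padicValNat.prime_pow,
      padicValNat.eq_zero_of_not_dvd (by norm_num), zero_add]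

/-! ### Checking an effectively closed set along the input -/

theorem exists_iterSeq_iff {bad : List Bool → Bool} (hbad : Computable bad) :
    ∃ g : ℕ → ℕ → ℕ, Computable₂ g ∧ ∀ Z, (∀ k, iterSeq g Z (k + 1) ≠ 0) ↔
      ∀ k, bad ((List.range (k + 1)).map Z) = false := by
  let dec : ℕ → List Bool := fun s => if s = 0 then [] else
    ((Encodable.decode (α := List Bool) (s - 1)).getD [])
  have hdec : Computable dec := computable_cond_decide
    (computable_decide_eq Computable.id (Computable.const 0)) (Computable.const _)
    (Computable.option_getD (Computable.decode.comp
      (computable_sub Computable.id (Computable.const 1))) (Computable.const []))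
  let nxt : ℕ → ℕ → List Bool := fun b s => dec s ++ [decide (b = 1)]
  have hnxt : Computable₂ nxt := Computable.list_append.comp (hdec.comp Computable.snd)
    (Computable.list_cons.comp (computable_decide_eq Computable.fst (Computable.const 1))
      (Computable.const []))
  let g : ℕ → ℕ → ℕ := fun b s =>
    if bad (nxt b s) = true then 0 else Encodable.encode (nxt b s) + 1
  refine ⟨g, computable_cond_decide (p := fun q : ℕ × ℕ => bad (nxt q.1 q.2) = true)
    ((hbad.comp hnxt).of_eq fun a => by simp) (Computable.const 0)
    (Computable.succ.comp (Computable.encode.comp hnxt)), fun Z => ?_⟩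
  have hsucc : ∀ k, dec (iterSeq g Z k) = (List.range k).map Z →
      nxt (Z k).toNat (iterSeq g Z k) = (List.range (k + 1)).map Z := by
    intro k hk
    simp only [nxt, hk, List.range_succ, List.map_append, List.map_cons, List.map_nil]
    cases Z k <;> simp
  have hstep : ∀ k, dec (iterSeq g Z k) = (List.range k).map Z → 
      (iterSeq g Z (k + 1) ≠ 0 ↔ bad ((List.range (k + 1)).map Z) = false) ∧
      (iterSeq g Z (k + 1) ≠ 0 → dec (iterSeq g Z (k + 1)) = (List.range (k + 1)).map Z) := by
    intro k hk
    rw [iterSeq]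
    simp only [g, hsucc k hk]
    split_ifs with h <;> simp [h, dec]
  constructor
  · intro h
    have h1 : ∀ k, dec (iterSeq g Z k) = (List.range k).map Z := by
      intro k
      induction k with
      | zero => simp [iterSeq, dec]
      | succ k ih => exact (hstep k ih).2 (h k)
    exact fun k => (hstep k (h1 k)).1.1 (h k)
  · intro h
    have h1 : ∀ k, dec (iterSeq g Z k) = (List.range k).map Z := by
      intro k
      induction k with
      | zero => simp [iterSeq, dec]
      | succ k ih => exact (hstep k ih).2 ((hstep k ih).1.2 (h k))
    exact fun k => (hstep k (h1 k)).1.2 (h k)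

/-- An effectively closed set is the set of points whose run is never rejected by some row
machine. -/
theorem exists_rowMachine_of_isPi01Cantor {P : Set (ℕ → ℕ)} (hP : IsPi01Cantor P) :
    ∃ (c a : ℕ) (R : RowMachine (Fin c) (Fin a)), ∀ x : ℕ → Bool,
      (∀ l, R.reject (R.run (RowMachine.input x) l).1 = false) ↔ (fun n => (x n).toNat) ∈ P := by
  obtain ⟨f, hf, rfl⟩ := hP
  let bad : List Bool → Bool := fun L => (List.range L.length).any fun m =>
    (List.range (f m).length).all fun i => (List.range L.length).any fun k =>
      (decide (0 < k) && decide (freeLevel k = i)) &&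
        decide (((L[k]?).map Bool.toNat) = (f m)[i]?)
  have hbad : Computable bad := by
    refine computable_list_any (Primrec.list_range.to_comp.comp Computable.list_length) ?_
    refine computable_list_all (f := fun q : List Bool × ℕ => List.range (f q.2).length)
      (Primrec.list_range.to_comp.comp (Computable.list_length.comp (hf.comp Computable.snd))) ?_
    refine computable_list_any
      (f := fun q : (List Bool × ℕ) × ℕ => List.range q.1.1.length)
      (Primrec.list_range.to_comp.comp (Computable.list_length.comp
        (Computable.fst.comp Computable.fst))) ?_
    have hk : Computable fun q : ((List Bool × ℕ) × ℕ) × ℕ => q.2 := Computable.snd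
    have hi : Computable fun q : ((List Bool × ℕ) × ℕ) × ℕ => q.1.2 :=
      Computable.snd.comp Computable.fst
    have hm : Computable fun q : ((List Bool × ℕ) × ℕ) × ℕ => q.1.1.2 :=
      Computable.snd.comp (Computable.fst.comp Computable.fst)
    have hL : Computable fun q : ((List Bool × ℕ) × ℕ) × ℕ => q.1.1.1 :=
      Computable.fst.comp (Computable.fst.comp Computable.fst)
    refine computable_and (computable_and (computable_decide_lt (Computable.const 0) hk)
      (computable_decide_eq (computable_freeLevel.comp hk) hi)) (computable_decide_eq
        (Computable.option_map (Computable.list_getElem?.comp hL hk)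
          ((Primrec.dom_finite Bool.toNat).to_comp.comp Computable.snd).to₂)
        (Computable.list_getElem?.comp (hf.comp hm) hi))
  obtain ⟨g, hg, h1⟩ := exists_iterSeq_iff hbad
  obtain ⟨c, a, R, h2⟩ := exists_rowMachine_iterSeq hg
  refine ⟨c, a, R, fun x => ?_⟩
  rw [h2, h1]
  have hbad_iff : ∀ n, bad ((List.range n).map (RowMachine.input x)) = true ↔
      ∃ m < n, ∀ i < (f m).length, ∃ k < n, 0 < k ∧ freeLevel k = i ∧
        (f m)[i]? = some (x i).toNat := by
    intro n
    simp only [bad, List.length_map, List.length_range, List.any_eq_true, List.all_eq_true,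
      List.mem_range, Bool.and_eq_true, decide_eq_true_eq, and_assoc]
    refine exists_congr fun m => and_congr_right fun _ => forall₂_congr fun i hi =>
      exists_congr fun k => and_congr_right fun hk => and_congr_right fun h0 =>
        and_congr_right fun h3 => ?_
    simp [hk, RowMachine.input, h0.ne', h3, eq_comm]
  constructor
  · refine fun h => ⟨fun n => by cases h : x n <;> simp [h], fun hx => ?_⟩
    obtain ⟨m, hm⟩ := Set.mem_iUnion.1 hx
    choose k hk using exists_freeLevel_eq
    obtain ⟨n, hn⟩ : ∃ n, ∀ i < (f m).length, k i < n :=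
      ⟨(Finset.range (f m).length).sup k + 1, fun i hi =>
        Nat.lt_succ_of_le (Finset.le_sup (f := k) (Finset.mem_range.2 hi))⟩
    have h3 := h (max m n)
    rw [← Bool.not_eq_true, hbad_iff] at h3
    refine h3 ⟨m, by lia, fun i hi => ⟨k i, by have := hn i hi; lia, (hk i).1, (hk i).2, ?_⟩⟩
    rw [List.getElem?_eq_getElem hi]
    exact congrArg some (hm i hi).symm
  · rintro ⟨-, hx⟩ n
    rw [← Bool.not_eq_true, hbad_iff]
    rintro ⟨m, -, hm⟩
    refine hx (Set.mem_iUnion.2 ⟨m, fun i hi => ?_⟩)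
    obtain ⟨k, -, -, -, h3⟩ := hm i hi
    rw [List.getElem?_eq_getElem hi] at h3
    exact (Option.some.inj h3).symm

end MedvedevFormal

namespace MedvedevFormal

/-! ### Reduction of the coordinates modulo a power of `3` -/

section

variable {n : ℕ} {i i' j j' : ℤ}

theorem dvd_iff_of_modEq (h : i ≡ i' [ZMOD 3 ^ n]) {m : ℕ} (hm : m ≤ n) :
    3 ^ m ∣ i ↔ 3 ^ m ∣ i' :=
  (h.of_dvd (pow_dvd_pow 3 hm)).dvd_iff

theorem div_modEq (h : i ≡ i' [ZMOD 3 ^ n]) {m e : ℕ} (hm : m + e ≤ n) :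
    i / 3 ^ m ≡ i' / 3 ^ m [ZMOD 3 ^ e] := by
  obtain ⟨q, hq⟩ := (h.of_dvd (pow_dvd_pow 3 hm)).symm.dvd
  rw [sub_eq_iff_eq_add'] at hq
  rw [hq, pow_add, mul_assoc, Int.add_mul_ediv_left _ _ (by positivity)]
  simp [Int.ModEq]

theorem lev_eq_of_modEq (h : i ≡ i' [ZMOD 3 ^ n]) (h0 : i ≠ 0) (hl : lev i < n) :
    i' ≠ 0 ∧ lev i' = lev i := by
  have h1 := mt ((dvd_iff_of_modEq h le_rfl).2) (by rw [three_pow_dvd_iff h0]; lia)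
  have h0' : i' ≠ 0 := by rintro rfl; simp at h1
  refine ⟨h0', eq_of_forall_le_iff fun m => ?_⟩
  rcases le_or_gt m n with hm | hm
  · rw [← three_pow_dvd_iff h0, ← three_pow_dvd_iff h0', dvd_iff_of_modEq h hm]
  · rw [three_pow_dvd_iff h0'] at h1
    lia

theorem res_modEq (n : ℕ) (i : ℤ) : i ≡ (res n i : ℤ) [ZMOD 3 ^ n] := by
  rw [coe_res]
  exact (Int.mod_modEq _ _).symm

theorem res_eq_of_modEq (h : i ≡ i' [ZMOD 3 ^ n]) {m : ℕ} (hm : m ≤ n) : res m i = res m i' := by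
  rw [res, res, (h.of_dvd (pow_dvd_pow 3 hm)).eq]

theorem lev_lt_of_abs_lt {M : ℕ} (h0 : i ≠ 0) (h : |i| < 3 ^ M) : lev i < M := by
  by_contra hl
  have := Int.le_of_dvd (by positivity)
    ((dvd_abs _ _).2 ((three_pow_dvd_iff h0 M).2 (not_lt.1 hl)))
  lia

theorem digit_ne_one_of_abs_lt {M m : ℕ} (h : |i| < 3 ^ M) (hm : M ≤ m) : i / 3 ^ m % 3 ≠ 1 := by
  have h1 : (3 : ℤ) ^ M ≤ 3 ^ m := pow_le_pow_right₀ (by norm_num) hm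
  obtain ⟨h2, h3⟩ := abs_lt.1 h
  rcases le_or_gt 0 i with h0 | h0
  · rw [Int.ediv_eq_zero_of_lt h0 (by lia)]
    simp
  · rw [Int.ediv_eq_neg_one_of_neg_of_le h0 (by lia)]
    simp

theorem act_lt_of_abs_lt {M m : ℕ} (h : |i| < 3 ^ M) (ha : act i = some m) : m < M := by
  by_contra hm
  exact digit_ne_one_of_abs_lt h (not_lt.1 hm) (act_eq_some.1 ha).1

/-- A bounded integer and its residue modulo `3 ^ (M + 2)`. -/
structure IsResidue (M : ℕ) (i i' : ℤ) : Prop where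
  abs_lt : |i| < 3 ^ M
  modEq : i ≡ i' [ZMOD 3 ^ (M + 2)]
  nonneg : 0 ≤ i'
  lt : i' < 3 ^ (M + 2)

variable {M : ℕ}

theorem isResidue_res (h : |i| < 3 ^ M) : IsResidue M i (res (M + 2) i) where
  abs_lt := h
  modEq := res_modEq _ _
  nonneg := by positivity
  lt := by exact_mod_cast res_lt _ _

namespace IsResidue

theorem digit (h : IsResidue M i i') {m : ℕ} (hm : m < M + 2) : i / 3 ^ m % 3 = i' / 3 ^ m % 3 := by
  simpa [Int.ModEq] using div_modEq h.modEq (m := m) (e := 1) hm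

theorem digit_ge (h : IsResidue M i i') {m : ℕ} (hm : M + 2 ≤ m) : i' / 3 ^ m % 3 = 0 := by
  rw [Int.ediv_eq_zero_of_lt h.nonneg (h.lt.trans_le (pow_le_pow_right₀ (by norm_num) hm))]
  simp

theorem act_eq (h : IsResidue M i i') : act i = act i' := by
  have key : ∀ m, i / 3 ^ m % 3 = 1 ↔ i' / 3 ^ m % 3 = 1 := fun m => by
    rcases lt_or_ge m (M + 2) with hm | hm
    · rw [h.digit hm]
    · have h1 := digit_ne_one_of_abs_lt h.abs_lt (m := m) (by lia)
      have h2 := h.digit_ge hm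
      lia
  exact Option.ext fun m => by simp only [act_eq_some, ne_eq, key]

theorem eq_zero_iff (h : IsResidue M i i') : i = 0 ↔ i' = 0 := by
  refine ⟨?_, fun h1 => ?_⟩
  · rintro rfl
    have h1 := h.modEq.symm
    rwa [Int.ModEq, Int.emod_eq_of_lt h.nonneg h.lt, Int.zero_emod] at h1
  · by_contra h0
    exact (lev_eq_of_modEq h.modEq h0 ((lev_lt_of_abs_lt h0 h.abs_lt).trans (by lia))).1 h1

theorem lev_lt (h : IsResidue M i i') (h0 : i ≠ 0) : lev i < M := lev_lt_of_abs_lt h0 h.abs_lt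

theorem lev_eq (h : IsResidue M i i') : lev i = lev i' := by
  by_cases h0 : i = 0
  · rw [h0, h.eq_zero_iff.1 h0]
  · exact (lev_eq_of_modEq h.modEq h0 ((h.lev_lt h0).trans (by lia))).2.symm

theorem div_mod_nine (h : IsResidue M i i') {m : ℕ} (hm : m ≤ M) :
    i / 3 ^ m % 9 = i' / 3 ^ m % 9 := by
  simpa [Int.ModEq] using div_modEq h.modEq (m := m) (e := 2) (by lia)

theorem idealE_eq (hi : IsResidue M i i') (hj : IsResidue M j j') :
    idealE i j = idealE i' j' := by
  rw [Bool.eq_iff_iff, idealE_iff, idealE_iff, ← hj.lev_eq, ne_eq, hj.eq_zero_iff]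
  refine and_congr_right fun h0 => dvd_iff_of_modEq hi.modEq ?_
  have := hj.lev_lt (mt hj.eq_zero_iff.1 h0)
  lia

theorem idealP_eq (hi : IsResidue M i i') (hj : IsResidue M j j') :
    idealP i j = idealP i' j' := by
  by_cases h0 : j = 0
  · rw [idealP, idealP, if_pos h0, if_pos (hj.eq_zero_iff.1 h0)]
  · rw [idealP_of_ne h0, idealP_of_ne (mt hj.eq_zero_iff.2 h0), ← hj.lev_eq,
      hi.div_mod_nine (hj.lev_lt h0).le]

theorem idealR_eq (hj : IsResidue M j j') : idealR j = idealR j' := hj.idealP_eq hj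

theorem idealW_eq (hi : IsResidue M i i') (hj : IsResidue M j j') :
    idealW i j = idealW i' j' := by
  rw [idealW, idealW, ← hj.act_eq]
  cases h : act j with
  | none => rfl
  | some m => exact hi.digit ((act_lt_of_abs_lt hj.abs_lt h).trans (by lia))

theorem idealH_eq {T : Type*} (D : ℕ → ℕ → T) (hi : IsResidue M i i') (hj : IsResidue M j j') :
    idealH D i j = idealH D i' j' := by
  rw [idealH, idealH, ← hj.act_eq]
  cases h : act j with
  | none => rfl
  | some m =>
    have hm : m ≤ M + 2 := (act_lt_of_abs_lt hj.abs_lt h).le.trans (by lia)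
    simp only [Option.elim_some, res_eq_of_modEq hi.modEq hm, res_eq_of_modEq hj.modEq hm]

theorem idealV_eq {T : Type*} (D : ℕ → ℕ → T) (hi : IsResidue M i i') (hj : IsResidue M j j') :
    idealV D i j = idealV D i' j' := by
  rw [idealV, idealV, ← hi.act_eq]
  cases h : act i with
  | none => rfl
  | some m =>
    have hm : m ≤ M + 2 := (act_lt_of_abs_lt hi.abs_lt h).le.trans (by lia)
    simp only [Option.elim_some, res_eq_of_modEq hi.modEq hm, res_eq_of_modEq hj.modEq hm]

theorem toDig_nine_eq (hi : IsResidue M i i') : toDig 9 i = toDig 9 i' :=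
  toDig_congr (by simpa using hi.div_mod_nine (Nat.zero_le M))

theorem idealTiling_eq {T : Type*} (x : ℕ → Bool) (D : ℕ → ℕ → T) (hi : IsResidue M i i')
    (hj : IsResidue M j j') : idealTiling x D i j = idealTiling x D i' j' := by
  simp only [idealTiling, cellOf, hi.toDig_nine_eq, hj.toDig_nine_eq, hi.lev_eq, hj.lev_eq,
    hi.idealR_eq, hj.idealR_eq, hi.idealE_eq hj, hj.idealE_eq hi, hi.idealP_eq hj,
    hj.idealP_eq hi, hi.idealW_eq hj, hj.idealW_eq hi, hi.idealH_eq D hj, hi.idealV_eq D hj]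

end IsResidue
end
end MedvedevFormal

namespace MedvedevFormal

/-! ### Computability of the tiling -/

namespace RowMachine

variable {C A : Type*} (M : RowMachine C A)

/-- The run of a row machine on a finite input. -/
def runList (L : List Bool) : ℕ → C × List A
  | 0 => (M.boot, L.map M.ini)
  | l + 1 =>
    let s := runList L l
    let a := fun k => s.2.getD k (M.ini false)
    (M.step s.1 (a 0), (List.range L.length).map fun k =>
      M.upd s.1 (a 0) (if k = 0 then none else some (a (k - 1))) (a k) (a (k + 1)))

theorem runList_spec (Z : ℕ → Bool) (N l : ℕ) :
    (l ≤ N → (M.runList ((List.range N).map Z) l).1 = (M.run Z l).1) ∧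
      ∀ k, k + l < N →
        (M.runList ((List.range N).map Z) l).2.getD k (M.ini false) = (M.run Z l).2 k := by
  induction l with
  | zero =>
    refine ⟨fun _ => rfl, fun k hk => ?_⟩
    simp [runList, run, show k < N by lia]
  | succ l ih =>
    obtain ⟨ih1, ih2⟩ := ih
    refine ⟨fun hl => ?_, fun k hk => ?_⟩
    · simp only [runList, run]
      rw [ih1 (by lia), ih2 0 (by lia)]
    · simp only [runList, run]
      rw [List.getD_eq_getElem _ _ (by simp; lia)]
      simp only [List.getElem_map, List.getElem_range]
      rw [ih1 (by lia), ih2 0 (by lia), ih2 k (by lia), ih2 (k + 1) (by lia), ih2 (k - 1) (by lia)]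

/-- The space-time diagram computed from a finite input. -/
def diagramList (L : List Bool) (k l : ℕ) : Tile C A :=
  let s := M.runList L l
  let a := fun k => s.2.getD k (M.ini false)
  (decide (k = 0), s.1, a 0, a (k - 1), a k, a (k + 1))

theorem diagramList_eq (Z : ℕ → Bool) (k l : ℕ) :
    M.diagramList ((List.range (k + l + 2)).map Z) k l = M.diagram Z k l := by
  obtain ⟨h1, h2⟩ := M.runList_spec Z (k + l + 2) l
  simp only [diagramList, diagram]
  rw [h1 (by lia), h2 0 (by lia), h2 k (by lia), h2 (k + 1) (by lia), h2 (k - 1) (by lia)]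

theorem diagram_congr {Z Z' : ℕ → Bool} {k l : ℕ} (h : ∀ m < k + l + 2, Z m = Z' m) :
    M.diagram Z k l = M.diagram Z' k l := by
  rw [← diagramList_eq, ← diagramList_eq]
  congr 1
  exact List.map_congr_left fun m hm => h m (List.mem_range.1 hm)

section

variable {α : Type*} [Primcodable α] {c a : ℕ} (R : RowMachine (Fin c) (Fin a))

theorem computable_runList {f : α → List Bool} {g : α → ℕ} (hf : Computable f)
    (hg : Computable g) : Computable fun x => R.runList (f x) (g x) := by
  have hini : Computable R.ini := (Primrec.dom_finite _).to_comp
  have hstep : Computable fun q : Fin c × Fin a => R.step q.1 q.2 := (Primrec.dom_finite _).to_comp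
  have hupd : Computable fun q : Fin c × Fin a × Option (Fin a) × Fin a × Fin a =>
    R.upd q.1 q.2.1 q.2.2.1 q.2.2.2.1 q.2.2.2.2 := (Primrec.dom_finite _).to_comp
  have hget : Computable₂ fun (l : List (Fin a)) (k : ℕ) => l.getD k (R.ini false) :=
    (Primrec.list_getD _).to_comp
  have hs : Computable fun q : α × ℕ × Fin c × List (Fin a) => q.2.2 :=
    Computable.snd.comp Computable.snd
  have hs' : Computable fun q : (α × ℕ × Fin c × List (Fin a)) × ℕ => q.1.2.2 :=
    hs.comp Computable.fst
  have ha {u : (α × ℕ × Fin c × List (Fin a)) × ℕ → ℕ} (hu : Computable u) :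
      Computable fun q : (α × ℕ × Fin c × List (Fin a)) × ℕ =>
        q.1.2.2.2.getD (u q) (R.ini false) :=
    hget.comp (Computable.snd.comp hs') hu
  have h := Computable.nat_rec hg (g := fun x => ((R.boot, (f x).map R.ini) : Fin c × List (Fin a)))
    (h := fun x p => (R.step p.2.1 (p.2.2.getD 0 (R.ini false)),
      (List.range (f x).length).map fun k => R.upd p.2.1 (p.2.2.getD 0 (R.ini false))
        (if k = 0 then none else some (p.2.2.getD (k - 1) (R.ini false)))
        (p.2.2.getD k (R.ini false)) (p.2.2.getD (k + 1) (R.ini false))))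
    ((Computable.const _).pair (computable_list_map hf (hini.comp Computable.snd).to₂))
    (Computable.pair (hstep.comp ((Computable.fst.comp hs).pair
      (hget.comp (Computable.snd.comp hs) (Computable.const 0))))
      (computable_list_map (Primrec.list_range.to_comp.comp
        (Computable.list_length.comp (hf.comp Computable.fst)))
        (hupd.comp ((Computable.fst.comp hs').pair ((ha (Computable.const 0)).pair
          ((computable_cond_decide (computable_decide_eq Computable.snd (Computable.const 0))
            (Computable.const none) (Computable.option_some.comp
              (ha (computable_sub Computable.snd (Computable.const 1))))).pair
          ((ha Computable.snd).pair (ha (Computable.succ.comp Computable.snd))))))).to₂)).to₂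
  refine h.of_eq fun x => ?_
  induction g x with
  | zero => rfl
  | succ l ih => simp only [ih]; rfl

theorem computable_diagramList {f : α → List Bool} {g h : α → ℕ} (hf : Computable f)
    (hg : Computable g) (hh : Computable h) :
    Computable fun x => R.diagramList (f x) (g x) (h x) := by
  have hs := R.computable_runList hf hh
  have hget {u : α → ℕ} (hu : Computable u) :
      Computable fun x => (R.runList (f x) (h x)).2.getD (u x) (R.ini false) :=
    (Primrec.list_getD _).to_comp.comp (Computable.snd.comp hs) hu
  exact (computable_decide_eq hg (Computable.const 0)).pair ((Computable.fst.comp hs).pair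
    ((hget (Computable.const 0)).pair ((hget (computable_sub hg (Computable.const 1))).pair
      ((hget hg).pair (hget (Computable.succ.comp hg))))))

end

end RowMachine

end MedvedevFormal

namespace MedvedevFormal

section

variable {α : Type*} [Primcodable α] {f g : α → ℕ}

theorem computable_toDig (n : ℕ) [NeZero n] (hf : Computable f) :
    Computable fun x => toDig n (f x : ℤ) := by
  refine Computable.encode_iff.1 ((computable_mod hf (Computable.const n)).of_eq fun x => ?_)
  change _ = (toDig n (f x : ℤ) : ℕ)
  have h := dig_toDig (n := n) (f x)
  simp only [dig] at h
  exact_mod_cast h.symm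

theorem computable_lev_natCast (hf : Computable f) : Computable fun x => lev (f x : ℤ) :=
  computable_padicValNat_three.comp hf

theorem computable_idealE_natCast (hf : Computable f) (hg : Computable g) :
    Computable fun x => idealE (f x) (g x) := by
  refine (computable_and (computable_not (computable_decide_eq hg (Computable.const 0)))
    (computable_decide_eq (computable_mod hf
      (computable_pow (Computable.const 3) (computable_lev_natCast hg)))
      (Computable.const 0))).of_eq fun x => ?_
  rw [Bool.eq_iff_iff, idealE_iff]
  simp only [Bool.and_eq_true, Bool.not_eq_true', decide_eq_false_iff_not, decide_eq_true_eq,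
    ← Nat.dvd_iff_mod_eq_zero]
  norm_cast

theorem idealP_natCast (i j : ℕ) :
    idealP i j = ((if j = 0 then 0 else i / 3 ^ lev j % 9 : ℕ) : ℤ) := by
  unfold idealP
  split_ifs with h1 h2 h2
  · rfl
  · exact absurd (by exact_mod_cast h1) h2
  · exact absurd (by exact_mod_cast h2) h1
  · push_cast; rfl

theorem computable_toDig_idealP (hf : Computable f) (hg : Computable g) :
    Computable fun x => toDig 9 (idealP (f x) (g x)) := by
  simp only [idealP_natCast]
  exact computable_toDig 9 (computable_cond_decide (computable_decide_eq hg (Computable.const 0))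
    (Computable.const 0) (computable_mod (computable_div hf
      (computable_pow (Computable.const 3) (computable_lev_natCast hg))) (Computable.const 9)))

theorem exists_digit_eq_one (n : ℕ) :
    ∃ s, (decide (IsFree n) || decide (n / 3 ^ s % 3 = 1)) = true := by
  by_cases h : IsFree n
  · exact ⟨0, by simp [h]⟩
  · obtain ⟨s, hs⟩ : ∃ s, n / 3 ^ s % 3 = 1 := by simpa [IsFree] using h
    exact ⟨s, by simp [hs]⟩

theorem act_natCast (n : ℕ) :
    act (n : ℤ) = if IsFree n then none else some (Nat.find (exists_digit_eq_one n)) := by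
  split_ifs with h
  · refine Option.eq_none_iff_forall_ne_some.2 fun s hs => h s ?_
    exact_mod_cast (act_eq_some.1 hs).1
  · rw [act_eq_some]
    have h1 := Nat.find_spec (exists_digit_eq_one n)
    refine ⟨?_, fun m hm => ?_⟩
    · simp only [h, decide_false, Bool.false_or, decide_eq_true_eq] at h1 ⊢
      exact_mod_cast h1
    · have h2 := Nat.find_min (exists_digit_eq_one n) hm
      simp only [h, decide_false, Bool.false_or, decide_eq_true_eq] at h2
      exact_mod_cast h2

theorem computable_act_natCast (hf : Computable f) : Computable fun x => act (f x : ℤ) := by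
  have h : Computable fun n : ℕ => act (n : ℤ) := by
    simp only [act_natCast]
    exact computable_cond_decide computable_isFree (Computable.const none)
      (Computable.option_some.comp (computable_nat_find
        (computable_or (computable_isFree.comp Computable.fst) (computable_decide_eq
          (computable_digit Computable.fst Computable.snd) (Computable.const 1))).to₂ _))
  exact h.comp hf

theorem idealW_natCast (i j : ℕ) :
    idealW i j = ((act (j : ℤ)).elim 0 (fun n => i / 3 ^ n % 3) : ℕ) := by
  unfold idealW
  cases act (j : ℤ) with
  | none => rfl
  | some n => simp

theorem computable_option_elim {β γ : Type*} [Primcodable β] [Primcodable γ] {o : α → Option β}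
    {u : α → γ} {v : α → β → γ} (ho : Computable o) (hu : Computable u) (hv : Computable₂ v) :
    Computable fun x => (o x).elim (u x) (v x) :=
  (Computable.option_casesOn ho hu hv).of_eq fun x => by cases o x <;> rfl

theorem computable_toDig_idealW (hf : Computable f) (hg : Computable g) :
    Computable fun x => toDig 3 (idealW (f x) (g x)) := by
  simp only [idealW_natCast]
  exact computable_toDig 3 (computable_option_elim (computable_act_natCast hg)
    (Computable.const 0) (computable_digit (hf.comp Computable.fst) Computable.snd).to₂)

theorem res_natCast (n i : ℕ) : res n i = i % 3 ^ n := by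
  have := coe_res n i
  exact_mod_cast this

theorem computable_res_natCast {n i : α → ℕ} (hn : Computable n) (hi : Computable i) :
    Computable fun x => res (n x) (i x) := by
  simp only [res_natCast]
  exact computable_mod hi (computable_pow (Computable.const 3) hn)

theorem computable_idealH_natCast {T : Type*} [Primcodable T] {D : α → ℕ → ℕ → T}
    (hD : Computable fun q : α × ℕ × ℕ => D q.1 q.2.1 q.2.2) (hf : Computable f)
    (hg : Computable g) : Computable fun x => idealH (D x) (f x) (g x) := by
  have h {u : α → ℕ} (hu : Computable u) :
      Computable fun q : α × ℕ => nodeIdx (res q.2 (u q.1)) :=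
    computable_nodeIdx.comp (computable_res_natCast Computable.snd (hu.comp Computable.fst))
  exact computable_option_elim (computable_act_natCast hg)
    (hD.comp (Computable.id.pair (Computable.const (0, 0))))
    (hD.comp (Computable.fst.pair ((h hf).pair (h hg)))).to₂

theorem computable_idealV_natCast {T : Type*} [Primcodable T] {D : α → ℕ → ℕ → T}
    (hD : Computable fun q : α × ℕ × ℕ => D q.1 q.2.1 q.2.2) (hf : Computable f)
    (hg : Computable g) : Computable fun x => idealV (D x) (f x) (g x) := by
  have h {u : α → ℕ} (hu : Computable u) :
      Computable fun q : α × ℕ => nodeIdx (res q.2 (u q.1)) :=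
    computable_nodeIdx.comp (computable_res_natCast Computable.snd (hu.comp Computable.fst))
  exact computable_option_elim (computable_act_natCast hf)
    (hD.comp (Computable.id.pair (Computable.const (0, 0))))
    (hD.comp (Computable.fst.pair ((h hf).pair (h hg)))).to₂

theorem computable_idealTiling_natCast {T : Type*} [Primcodable T] {z : α → ℕ → Bool}
    {D : α → ℕ → ℕ → T} (hz : Computable fun q : α × ℕ => z q.1 q.2)
    (hD : Computable fun q : α × ℕ × ℕ => D q.1 q.2.1 q.2.2) (hf : Computable f)
    (hg : Computable g) : Computable fun x => (idealTiling (z x) (D x) (f x) (g x)).toTuple :=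
  (((computable_toDig 9 hf).pair (computable_toDig 9 hg)).pair
    (((computable_toDig_idealP hf hg).pair (computable_toDig_idealP hg hf)).pair
      ((computable_toDig_idealP hf hf).pair (computable_toDig_idealP hg hg)))).pair
  ((((computable_idealE_natCast hf hg).pair (computable_idealE_natCast hg hf)).pair
    ((hz.comp (Computable.id.pair (computable_lev_natCast hf))).pair
      (hz.comp (Computable.id.pair (computable_lev_natCast hg))))).pair
  (((computable_toDig_idealW hf hg).pair (computable_toDig_idealW hg hf)).pair
    ((computable_idealH_natCast hD hf hg).pair (computable_idealV_natCast hD hf hg))))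

end

/-- The bits of a finite word. -/
def listBit (p : List ℕ) (n : ℕ) : Bool := decide (p.getD n 0 = 1)

theorem computable_listBit : Computable fun q : List ℕ × ℕ => listBit q.1 q.2 :=
  computable_decide_eq (Primrec.list_getD 0).to_comp (Computable.const 1)

theorem computable_diagram_listBit {c a : ℕ} (R : RowMachine (Fin c) (Fin a)) :
    Computable fun q : List ℕ × ℕ × ℕ =>
      R.diagram (RowMachine.input (listBit q.1)) q.2.1 q.2.2 := by
  simp only [← RowMachine.diagramList_eq]
  have h1 : Computable fun q : List ℕ × ℕ × ℕ => q.2.1 := Computable.fst.comp Computable.snd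
  have h2 : Computable fun q : List ℕ × ℕ × ℕ => q.2.2 := Computable.snd.comp Computable.snd
  refine R.computable_diagramList (computable_list_map (Primrec.list_range.to_comp.comp
    (computable_add (computable_add h1 h2) (Computable.const 2))) ?_) h1 h2
  exact (computable_cond_decide (computable_decide_eq Computable.snd (Computable.const 0))
    (Computable.const false) (computable_listBit.comp
      ((Computable.fst.comp Computable.fst).pair (computable_freeLevel.comp Computable.snd)))).to₂

theorem nodeIdx_le (t : ℕ) : nodeIdx t ≤ t := by
  have := Nat.count_le (p := IsFree) (n := t + 1)
  unfold nodeIdx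
  lia

theorem padicValNat_three_le (n : ℕ) : padicValNat 3 n ≤ n :=
  (padicValNat_le_nat_log n).trans (Nat.log_le_self 3 n)

theorem idealTiling_congr {T : Type*} {x x' : ℕ → Bool} {D D' : ℕ → ℕ → T} {i j : ℕ}
    (hx : ∀ m ≤ i + j, x m = x' m) (hD : ∀ k ≤ i, ∀ l ≤ j, D k l = D' k l) :
    idealTiling x D i j = idealTiling x' D' i j := by
  have hnode (n k : ℕ) : nodeIdx (res n k) ≤ k :=
    (nodeIdx_le _).trans (by rw [res_natCast]; exact Nat.mod_le _ _)
  have hH : idealH D i j = idealH D' i j := by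
    unfold idealH
    cases act (j : ℤ) with
    | none => exact hD 0 (by lia) 0 (by lia)
    | some n => exact hD _ (hnode _ _) _ (hnode _ _)
  have hV : idealV D i j = idealV D' i j := by
    unfold idealV
    cases act (i : ℤ) with
    | none => exact hD 0 (by lia) 0 (by lia)
    | some n => exact hD _ (hnode _ _) _ (hnode _ _)
  have h1 := hx (lev i) ((padicValNat_three_le i).trans (by lia))
  have h2 := hx (lev j) ((padicValNat_three_le j).trans (by lia))
  simp only [idealTiling, cellOf, hH, hV, h1, h2]

theorem idealTiling_diagram_congr {c a : ℕ} (R : RowMachine (Fin c) (Fin a)) {x x' : ℕ → Bool}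
    {i j : ℕ} (h : ∀ m ≤ freePos (i + j + 2), x m = x' m) :
    idealTiling x (R.diagram (RowMachine.input x)) i j =
      idealTiling x' (R.diagram (RowMachine.input x')) i j := by
  refine idealTiling_congr (fun m hm => h m ?_) fun k hk l hl => R.diagram_congr fun m hm => ?_
  · exact hm.trans ((freePos_strictMono.le_apply (x := i + j)).trans
      (freePos_strictMono.monotone (by lia)))
  · unfold RowMachine.input
    split_ifs with h0
    · rfl
    · refine h _ (le_trans ?_ (freePos_strictMono.monotone (show m ≤ i + j + 2 by lia)))
      exact padicValNat_three_le _

end MedvedevFormal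

namespace MedvedevFormal

/-! ### Coordinates along a copy of `ℤ²` -/

variable {G : Type*} [Group G] {k : ℕ} {a b : G}

theorem commute_zpow_mul (h : Commute a b) (i j i' j' : ℤ) :
    a ^ i * b ^ j * (a ^ i' * b ^ j') = a ^ (i + i') * b ^ (j + j') := by
  rw [zpow_add, zpow_add, mul_assoc, mul_assoc, ← mul_assoc (b ^ j),
    ((h.zpow_zpow i' j).eq).symm, mul_assoc]

/-- The subgroup of products of powers of two commuting elements. -/
def zpowersPair (h : Commute a b) : Subgroup G where
  carrier := {x | ∃ i j : ℤ, x = a ^ i * b ^ j}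
  one_mem' := ⟨0, 0, by simp⟩
  mul_mem' := by
    rintro _ _ ⟨i, j, rfl⟩ ⟨i', j', rfl⟩
    exact ⟨_, _, commute_zpow_mul h i j i' j'⟩
  inv_mem' := by
    rintro _ ⟨i, j, rfl⟩
    refine ⟨-i, -j, inv_eq_of_mul_eq_one_right ?_⟩
    rw [commute_zpow_mul h]
    simp

theorem IsZSquared.inj (h : IsZSquared a b) {i j i' j' : ℤ}
    (he : a ^ i * b ^ j = a ^ i' * b ^ j') : i = i' ∧ j = j' := by
  have h1 := h.2 (i - i') (j - j') (by
    rw [sub_eq_add_neg, sub_eq_add_neg, ← commute_zpow_mul h.1, he, commute_zpow_mul h.1]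
    simp)
  lia

/-- The power of a word. -/
def wordPow (w : List (Fin k × Bool)) (n : ℕ) : List (Fin k × Bool) :=
  (List.range n).flatMap fun _ => w

theorem wordVal_wordPow (σ : Fin k → G) (w : List (Fin k × Bool)) (n : ℕ) :
    wordVal σ (wordPow w n) = wordVal σ w ^ n := by
  unfold wordPow
  induction n with
  | zero => simp [wordVal_nil]
  | succ n ih => simp [List.range_succ, wordVal_append, ih, pow_succ]

theorem computable_wordPow {α : Type*} [Primcodable α] {f : α → List (Fin k × Bool)} {g : α → ℕ}
    (hf : Computable f) (hg : Computable g) : Computable fun x => wordPow (f x) (g x) :=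
  computable_list_flatMap (Primrec.list_range.to_comp.comp hg) (hf.comp Computable.fst).to₂

/-- The word of `a ^ (t.1 - t.2.1) * b ^ (t.2.2.1 - t.2.2.2)`, given words of `a` and `b`. -/
def quadWord (u v : List (Fin k × Bool)) (t : ℕ × ℕ × ℕ × ℕ) : List (Fin k × Bool) :=
  wordPow u t.1 ++ wordPow (invWord u) t.2.1 ++ (wordPow v t.2.2.1 ++ wordPow (invWord v) t.2.2.2)

theorem wordVal_quadWord (σ : Fin k → G) (u v : List (Fin k × Bool)) (t : ℕ × ℕ × ℕ × ℕ) :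
    wordVal σ (quadWord u v t) =
      wordVal σ u ^ ((t.1 : ℤ) - t.2.1) * wordVal σ v ^ ((t.2.2.1 : ℤ) - t.2.2.2) := by
  simp [quadWord, wordVal_append, wordVal_wordPow, wordVal_invWord, zpow_sub, mul_assoc]

theorem computable_quadWord (u v : List (Fin k × Bool)) : Computable (quadWord u v) := by
  unfold quadWord
  have h1 : Computable fun t : ℕ × ℕ × ℕ × ℕ => t.2 := Computable.snd
  have h2 : Computable fun t : ℕ × ℕ × ℕ × ℕ => t.2.2 := Computable.snd.comp h1
  exact Computable.list_append.comp
    (Computable.list_append.comp (computable_wordPow (Computable.const _) Computable.fst)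
      (computable_wordPow (Computable.const _) (Computable.fst.comp h1)))
    (Computable.list_append.comp (computable_wordPow (Computable.const _) (Computable.fst.comp h2))
      (computable_wordPow (Computable.const _) (Computable.snd.comp h2)))

theorem exists_coordinates {σ : Fin k → G} (hσ : IsSymmGen σ)
    (hvp : ∃ K : Subgroup G, K.FiniteIndex ∧ IsPolycyclic K) (hab : IsZSquared a b) :
    ∃ (κ : G → ℤ × ℤ) (t : List (Fin k × Bool) → ℕ × ℕ × ℕ × ℕ), Computable t ∧
      (∀ g, κ (g * a) = ((κ g).1 + 1, (κ g).2)) ∧ (∀ g, κ (g * b) = ((κ g).1, (κ g).2 + 1)) ∧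
      ∀ w, κ (wordVal σ w) = (((t w).1 - (t w).2.1 : ℤ), ((t w).2.2.1 - (t w).2.2.2 : ℤ)) := by
  classical
  have hw (g : G) : ∃ w, wordVal σ w = g := exists_wordVal_eq (by rw [hσ.1]; trivial)
  obtain ⟨u, rfl⟩ := hw a
  obtain ⟨v, rfl⟩ := hw b
  set H := zpowersPair hab.1
  obtain ⟨φ, hφ, hφ'⟩ := decidableMembership_of_polycyclic hvp σ H
  obtain ⟨θ, hθ, hθ'⟩ := decidableMembership_of_polycyclic hvp σ ⊥
  have hrep (g : G) : ∃ n, (wordVal σ (decodeWord k n))⁻¹ * g ∈ H := by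
    obtain ⟨w, rfl⟩ := hw g
    exact ⟨Encodable.encode w, by simp [decodeWord_encode]⟩
  have hκ (g : G) : ∃ c : ℤ × ℤ, (wordVal σ (decodeWord k (Nat.find (hrep g))))⁻¹ * g =
      wordVal σ u ^ c.1 * wordVal σ v ^ c.2 := by
    obtain ⟨i, j, h⟩ := Nat.find_spec (hrep g)
    exact ⟨(i, j), h⟩
  choose κ hκ using hκ
  have hmove (g : G) (i j : ℤ) :
      κ (g * (wordVal σ u ^ i * wordVal σ v ^ j)) = ((κ g).1 + i, (κ g).2 + j) := by
    have hfind : Nat.find (hrep (g * (wordVal σ u ^ i * wordVal σ v ^ j))) =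
        Nat.find (hrep g) := by
      refine Nat.find_congr' fun {n} => ?_
      rw [← mul_assoc]
      exact H.mul_mem_cancel_right ⟨i, j, rfl⟩
    have h1 := hκ (g * (wordVal σ u ^ i * wordVal σ v ^ j))
    rw [hfind, ← mul_assoc, hκ, commute_zpow_mul hab.1] at h1
    obtain ⟨h2, h3⟩ := hab.inj h1
    exact Prod.ext h2.symm h3.symm
  have hn (w : List (Fin k × Bool)) :
      ∃ n, φ (invWord (decodeWord k n) ++ w) = true := by
    obtain ⟨n, h⟩ := hrep (wordVal σ w)
    exact ⟨n, by rwa [hφ', wordVal_append, wordVal_invWord]⟩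
  have hfind (w : List (Fin k × Bool)) : Nat.find (hn w) = Nat.find (hrep (wordVal σ w)) :=
    Nat.find_congr' fun {n} => by rw [hφ', wordVal_append, wordVal_invWord]
  let D : ℕ → ℕ × ℕ × ℕ × ℕ := fun m =>
    (m.unpair.1.unpair.1, m.unpair.1.unpair.2, m.unpair.2.unpair.1, m.unpair.2.unpair.2)
  have hD : Computable D := by
    have h1 := Computable.fst.comp Computable.unpair
    have h2 := Computable.snd.comp Computable.unpair
    exact (h1.comp h1).pair ((h2.comp h1).pair ((h1.comp h2).pair (h2.comp h2)))
  let test : List (Fin k × Bool) → ℕ → Bool := fun w m =>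
    θ (invWord (quadWord u v (D m)) ++ (invWord (decodeWord k (Nat.find (hn w))) ++ w))
  have htest (w : List (Fin k × Bool)) (m : ℕ) : test w m = true ↔
      κ (wordVal σ w) = (((D m).1 : ℤ) - (D m).2.1, ((D m).2.2.1 - (D m).2.2.2 : ℤ)) := by
    simp only [test]
    rw [hθ', wordVal_append, wordVal_append, wordVal_invWord, wordVal_invWord, hfind, hκ,
      Subgroup.mem_bot, inv_mul_eq_one, wordVal_quadWord]
    constructor
    · intro h
      obtain ⟨h1, h2⟩ := hab.inj h
      exact Prod.ext h1.symm h2.symm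
    · intro h
      rw [h]
  have hm (w : List (Fin k × Bool)) : ∃ m, test w m = true := by
    let c := κ (wordVal σ w)
    refine ⟨Nat.pair (Nat.pair c.1.toNat (-c.1).toNat) (Nat.pair c.2.toNat (-c.2).toNat), ?_⟩
    rw [htest]
    simp only [D, Nat.unpair_pair, Int.toNat_sub_toNat_neg]
    rfl
  refine ⟨κ, fun w => D (Nat.find (hm w)), hD.comp (computable_nat_find ?_ hm), fun g => ?_,
    fun g => ?_, fun w => (htest w _).1 (Nat.find_spec (hm w))⟩
  · have hfind' : Computable fun w => Nat.find (hn w) := by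
      refine computable_nat_find (p := fun w n => φ (invWord (decodeWord k n) ++ w)) ?_ hn
      exact (hφ.comp (Computable.list_append.comp (primrec_invWord.to_comp.comp
        ((computable_decodeWord).comp Computable.snd)) Computable.fst)).to₂
    exact (hθ.comp (Computable.list_append.comp (primrec_invWord.to_comp.comp
      ((computable_quadWord u v).comp (hD.comp Computable.snd)))
      (Computable.list_append.comp (primrec_invWord.to_comp.comp
        (computable_decodeWord.comp (hfind'.comp Computable.fst))) Computable.fst))).to₂
  · simpa using hmove g 1 0
  · simpa using hmove g 0 1

end MedvedevFormal

namespace MedvedevFormal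

/-! ### The subshift of tilings -/

variable {G : Type*} [Group G]

/-- Configurations satisfying a local rule form a subshift of finite type. -/
theorem isSFT_of_local {A : Type*} [Finite A] (D : Finset G) (W : ({g // g ∈ D} → A) → Prop) :
    IsSFT {x : G → A | ∀ g, W fun d => x (g * d)} := by
  classical
  have := Fintype.ofFinite A
  refine ⟨((Finset.univ.filter fun p => ¬W p).toList).map fun p => ⟨D, p⟩, Set.ext fun x => ?_⟩
  simp only [Set.mem_ofPred_eq, List.mem_map, Finset.mem_toList, Finset.mem_filter, Finset.mem_univ,
    true_and, forall_exists_index, and_imp, forall_apply_eq_imp_iff₂, MatchesAt, shift]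
  constructor
  · intro h p hp g hg
    exact hp (funext hg ▸ h g⁻¹)
  · intro h g
    by_contra hW
    exact h _ hW g⁻¹ fun d => by simp

/-- The configurations all of whose cosets of `⟨a, b⟩` are tiled. -/
def tilingSet {T : Type*} {n : ℕ} (R : QuadrantRules T) (e : Cell T ≃ Fin n) (a b : G) :
    Set (G → Fin n) :=
  {x | ∀ g, (e.symm (x g)).Ok R ∧ (e.symm (x g)).Horiz R (e.symm (x (g * a))) ∧
    (e.symm (x g)).Vert R (e.symm (x (g * b)))}

section

variable {T : Type*} {n : ℕ} {R : QuadrantRules T} {e : Cell T ≃ Fin n} {a b : G}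

theorem isSFT_tilingSet : IsSFT (tilingSet R e a b) := by
  classical
  refine (congrArg IsSFT (Set.ext fun x => ?_)).mp
    (isSFT_of_local {1, a, b} fun p =>
      (e.symm (p ⟨1, by simp⟩)).Ok R ∧
      (e.symm (p ⟨1, by simp⟩)).Horiz R (e.symm (p ⟨a, by simp⟩)) ∧
      (e.symm (p ⟨1, by simp⟩)).Vert R (e.symm (p ⟨b, by simp⟩)))
  simp [tilingSet]

theorem isTiling_of_mem_tilingSet (hab : Commute a b) {x : G → Fin n}
    (hx : x ∈ tilingSet R e a b) : IsTiling R fun i j => e.symm (x (a ^ i * b ^ j)) where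
  ok i j := (hx _).1
  horiz i j := by
    have := (hx (a ^ i * b ^ j)).2.1
    rwa [mul_assoc, ← (hab.zpow_right j).eq, ← mul_assoc, ← zpow_add_one] at this
  vert i j := by
    have := (hx (a ^ i * b ^ j)).2.2
    rwa [mul_assoc, ← zpow_add_one] at this

theorem mem_tilingSet_of_isTiling {X : ℤ → ℤ → Cell T} (hX : IsTiling R X) {κ : G → ℤ × ℤ}
    (ha : ∀ g, κ (g * a) = ((κ g).1 + 1, (κ g).2)) (hb : ∀ g, κ (g * b) = ((κ g).1, (κ g).2 + 1)) :
    (fun g => e (X (κ g).1 (κ g).2)) ∈ tilingSet R e a b := fun g => by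
  simp only [Equiv.symm_apply_apply, ha, hb]
  exact ⟨hX.ok _ _, hX.horiz _ _, hX.vert _ _⟩

end

/-! ### Computing a configuration from a point -/

/-- A bound for the coordinates. -/
def quadBound (t : ℕ × ℕ × ℕ × ℕ) : ℕ := t.1 + t.2.1 + (t.2.2.1 + t.2.2.2)

/-- The residue of a difference. -/
def diffRes (n p q : ℕ) : ℕ := (p + (3 ^ n * q - q)) % 3 ^ n

theorem diffRes_eq (n p q : ℕ) : diffRes n p q = res n (p - q) := by
  have h : q ≤ 3 ^ n * q := Nat.le_mul_of_pos_left q (by positivity)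
  have h1 : (res n (p - q) : ℤ) = (p + (3 ^ n * q - q)) % 3 ^ n := by
    rw [coe_res, ← Int.add_mul_emod_self_left (p - q : ℤ) (3 ^ n) q]
    congr 1
    ring
  rw [diffRes]
  zify [h]
  exact h1.symm

theorem computable_diffRes {α : Type*} [Primcodable α] {f g h : α → ℕ} (hf : Computable f)
    (hg : Computable g) (hh : Computable h) : Computable fun x => diffRes (f x) (g x) (h x) := by
  have h3 := computable_pow (Computable.const 3) hf
  exact computable_mod (computable_add hg (computable_sub (computable_mul h3 hh) hh)) h3

theorem computable_idealTiling_index {T : Type*} [Primcodable T] {z : List ℕ → ℕ → Bool}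
    {D : List ℕ → ℕ → ℕ → T} (hz : Computable fun q : List ℕ × ℕ => z q.1 q.2)
    (hD : Computable fun q : List ℕ × ℕ × ℕ => D q.1 q.2.1 q.2.2) {I J : ℕ → ℕ}
    (hI : Computable I) (hJ : Computable J) :
    Computable fun q : List ℕ × ℕ =>
      (idealTiling (z q.1) (D q.1) (I q.2) (J q.2)).toTuple := by
  have hz' : Computable fun q : (List ℕ × ℕ) × ℕ => z q.1.1 q.2 :=
    hz.comp (f := fun q : List ℕ × ℕ => z q.1 q.2)
      (g := fun q : (List ℕ × ℕ) × ℕ => (q.1.1, q.2))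
      ((Computable.fst.comp Computable.fst).pair Computable.snd)
  have hD' : Computable fun q : (List ℕ × ℕ) × ℕ × ℕ => D q.1.1 q.2.1 q.2.2 :=
    Computable.comp (g := fun q : (List ℕ × ℕ) × ℕ × ℕ => (q.1.1, q.2))
      hD ((Computable.fst.comp Computable.fst).pair Computable.snd)
  exact computable_idealTiling_natCast (z := fun q : List ℕ × ℕ => z q.1)
    (D := fun q : List ℕ × ℕ => D q.1) hz' hD' (hI.comp Computable.snd) (hJ.comp Computable.snd)

theorem abs_sub_lt_three_pow {p q m : ℕ} (hp : p ≤ m) (hq : q ≤ m) :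
    |(p - q : ℤ)| < 3 ^ m := by
  have h : (m : ℤ) < 3 ^ m := by exact_mod_cast Nat.lt_pow_self (n := m) (show 1 < 3 by norm_num)
  rw [abs_lt]
  lia

theorem baireLE_tilingSet {c a k n : ℕ} {M : RowMachine (Fin c) (Fin a)} {u v : G}
    {e : Cell (RowMachine.Tile (Fin c) (Fin a)) ≃ Fin n} {P : Set (ℕ → ℕ)} (hP : P ⊆ cantorSpace)
    (hM : ∀ x : ℕ → Bool,
      (∀ l, M.reject (M.run (RowMachine.input x) l).1 = false) ↔ (fun n => (x n).toNat) ∈ P)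
    {σ : Fin k → G} {κ : G → ℤ × ℤ} {t : List (Fin k × Bool) → ℕ × ℕ × ℕ × ℕ} (ht : Computable t)
    (hu : ∀ g, κ (g * u) = ((κ g).1 + 1, (κ g).2)) (hv : ∀ g, κ (g * v) = ((κ g).1, (κ g).2 + 1))
    (hκ : ∀ w, κ (wordVal σ w) =
      (((t w).1 - (t w).2.1 : ℤ), ((t w).2.2.1 - (t w).2.2.2 : ℤ))) :
    BaireLE (mSet (pullback (cover σ) (tilingSet M.rules e u v))) P := by
  let I : ℕ → ℕ := fun m => let s := t (decodeWord k m); diffRes (quadBound s + 2) s.1 s.2.1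
  let J : ℕ → ℕ := fun m => let s := t (decodeWord k m); diffRes (quadBound s + 2) s.2.2.1 s.2.2.2
  have hs : Computable fun m => t (decodeWord k m) := ht.comp computable_decodeWord
  have hs1 := Computable.fst.comp hs
  have hs2 := Computable.fst.comp (Computable.snd.comp hs)
  have hs3 := Computable.fst.comp (Computable.snd.comp (Computable.snd.comp hs))
  have hs4 := Computable.snd.comp (Computable.snd.comp (Computable.snd.comp hs))
  have hb : Computable fun m => quadBound (t (decodeWord k m)) + 2 :=
    computable_add (computable_add (computable_add hs1 hs2) (computable_add hs3 hs4))
      (Computable.const 2)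
  have hI : Computable I := computable_diffRes hb hs1 hs2
  have hJ : Computable J := computable_diffRes hb hs3 hs4
  obtain ⟨D, hD⟩ : ∃ D : List ℕ → ℕ → ℕ → RowMachine.Tile (Fin c) (Fin a),
    D = fun p => M.diagram (RowMachine.input (listBit p)) := ⟨_, rfl⟩
  have hDc : Computable fun q : List ℕ × ℕ × ℕ => D q.1 q.2.1 q.2.2 := by
    subst hD
    exact computable_diagram_listBit M
  let cell : List ℕ → ℕ → Cell (RowMachine.Tile (Fin c) (Fin a)) := fun p m =>
    idealTiling (listBit p) (D p) (I m) (J m)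
  have hcell : Computable fun q : List ℕ × ℕ => e (cell q.1 q.2) := by
    have h1 : Computable fun q : List ℕ × ℕ => (cell q.1 q.2).toTuple :=
      computable_idealTiling_index computable_listBit hDc hI hJ
    have h2 : Computable fun q => e (Cell.ofTuple q) := (Primrec.dom_finite _).to_comp
    exact h2.comp h1
  have hφ : Computable fun q : List ℕ × ℕ =>
      if isWordCode k q.2 = true then (e (cell q.1 q.2) : ℕ) + 1 else 0 :=
    computable_cond_decide (p := fun q : List ℕ × ℕ => isWordCode k q.2 = true)
      (((computable_isWordCode (k := k)).comp Computable.snd).of_eq fun q => by simp)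
      (Computable.succ.comp (Computable.encode.comp hcell)) (Computable.const 0)
  refine baireLE_of_use (fun p m => if isWordCode k m = true then (e (cell p m) : ℕ) + 1 else 0)
    hφ.to₂
    (fun m => freePos (I m + J m + 2) + 1)
    (Computable.succ.comp (computable_freePos.comp
      (computable_add (computable_add hI hJ) (Computable.const 2)))) fun z hz => ?_
  let x : ℕ → Bool := fun m => decide (z m = 1)
  have hx : (fun m => (x m).toNat) = z := by
    funext m
    have : z m ≤ 1 := hP hz m
    by_cases h : z m = 1 <;> simp [x, h]
    lia
  have hT := isTiling_ideal (RowMachine.isSolution ((hM x).2 (by rwa [hx])))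
  refine ⟨_, ⟨_, ⟨_, mem_tilingSet_of_isTiling (e := e) hT hu hv, rfl⟩, rfl⟩, fun m => ?_⟩
  have hle (s : ℕ × ℕ × ℕ × ℕ) : s.1 ≤ quadBound s ∧ s.2.1 ≤ quadBound s ∧
      s.2.2.1 ≤ quadBound s ∧ s.2.2.2 ≤ quadBound s := by
    unfold quadBound
    lia
  dsimp only
  split_ifs with hm
  · rw [confFun_of_isWordCode σ _ hm]
    rw [hκ, (isResidue_res (abs_sub_lt_three_pow (hle _).1 (hle _).2.1)).idealTiling_eq _ _
      (isResidue_res (abs_sub_lt_three_pow (hle _).2.2.1 (hle _).2.2.2)), ← diffRes_eq, ← diffRes_eq]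
    congr 3
    subst hD
    refine idealTiling_diagram_congr M fun l hl => ?_
    simp only [listBit, x]
    rw [pref_getD _ (Nat.lt_succ_of_le hl)]
  · rw [confFun_of_not_isWordCode σ _ (by simpa using hm)]

end MedvedevFormal

namespace MedvedevFormal

/-! ### Computing a point from a configuration -/

/-- The value of `f` at the letter with code `v - 1`. -/
def readBit {n : ℕ} (f : Fin n → Bool) (v : ℕ) : Bool :=
  !decide (v = 0) && (Encodable.decode (α := Fin n) (v - 1)).elim false f

theorem readBit_succ {n : ℕ} (f : Fin n → Bool) (s : Fin n) : readBit f (s + 1) = f s := by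
  have h : Encodable.decode (α := Fin n) s = some s := Encodable.encodek s
  simp [readBit, h]

theorem readBit_zero {n : ℕ} (f : Fin n → Bool) : readBit f 0 = false := by
  simp [readBit]

theorem computable_readBit {n : ℕ} (f : Fin n → Bool) : Computable (readBit f) :=
  computable_and (computable_not (computable_decide_eq Computable.id (Computable.const 0)))
    (computable_option_elim (Computable.decode.comp Primrec.pred.to_comp) (Computable.const false)
      ((Primrec.dom_finite f).to_comp.comp Computable.snd).to₂)

/-- A mark showing the level `m` of its column and satisfying `g` can be read off from `p` at the
position coded by `q`; the letter at `(i, j)` is found at the entry `c i j` of `p`. -/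
def marksTest {n : ℕ} (c : ℕ → ℕ → ℕ) (f g : Fin n → Bool) (p : List ℕ) (m q : ℕ) : Bool :=
  readBit g (p.getD (c q.unpair.1 q.unpair.2) 0) &&
    ((readBit f (p.getD (c q.unpair.1 q.unpair.2) 0) &&
      readBit f (p.getD (c q.unpair.1 (q.unpair.2 + 3 ^ m)) 0)) &&
    (List.range m).all fun l =>
      readBit (fun s => !f s) (p.getD (c q.unpair.1 (q.unpair.2 + 3 ^ l)) 0))

section

variable {n : ℕ} {c : ℕ → ℕ → ℕ} {f g : Fin n → Bool}

theorem computable_marksTest (hc : Computable fun q : ℕ × ℕ => c q.1 q.2) (f g : Fin n → Bool) :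
    Computable fun q : (List ℕ × ℕ) × ℕ => marksTest c f g q.1.1 q.1.2 q.2 := by
  have key {α : Type} [Primcodable α] {p : α → List ℕ} {i j : α → ℕ} (g : Fin n → Bool)
      (hp : Computable p) (hi : Computable i) (hj : Computable j) :
      Computable fun x => readBit g ((p x).getD (c (i x) (j x)) 0) :=
    (computable_readBit g).comp ((Primrec.list_getD 0).to_comp.comp hp (hc.comp (hi.pair hj)))
  have hp : Computable fun q : (List ℕ × ℕ) × ℕ => q.1.1 := Computable.fst.comp Computable.fst
  have hm : Computable fun q : (List ℕ × ℕ) × ℕ => q.1.2 := Computable.snd.comp Computable.fst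
  have hi : Computable fun q : (List ℕ × ℕ) × ℕ => q.2.unpair.1 :=
    Computable.fst.comp (Computable.unpair.comp Computable.snd)
  have hj : Computable fun q : (List ℕ × ℕ) × ℕ => q.2.unpair.2 :=
    Computable.snd.comp (Computable.unpair.comp Computable.snd)
  have h3 {α : Type} [Primcodable α] {i : α → ℕ} (hi : Computable i) :
      Computable fun x => 3 ^ i x := computable_pow (Computable.const 3) hi
  refine computable_and (key g hp hi hj) (computable_and (computable_and (key f hp hi hj)
    (key f hp hi (computable_add hj (h3 hm))))
    (computable_list_all (Primrec.list_range.to_comp.comp hm) ?_))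
  exact (key _ (hp.comp Computable.fst) (hi.comp Computable.fst)
    (computable_add (hj.comp Computable.fst) (h3 Computable.snd))).to₂

theorem readBit_pref (f : Fin n → Bool) {y : ℕ → ℕ} {X : ℕ → ℕ → Fin n}
    (hX : ∀ i j, y (c i j) = X i j + 1) (k i j : ℕ) :
    readBit f ((pref y k).getD (c i j) 0) = (decide (c i j < k) && f (X i j)) := by
  by_cases h : c i j < k
  · rw [pref_getD y h, hX, readBit_succ]
    simp [h]
  · rw [List.getD_eq_default _ _ (by rw [pref_length]; lia), readBit_zero]
    simp [h]

theorem marks_of_marksTest {y : ℕ → ℕ} {X : ℕ → ℕ → Fin n} (hX : ∀ i j, y (c i j) = X i j + 1)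
    {k m q : ℕ} (h : marksTest c f g (pref y k) m q = true) :
    ∃ i j : ℕ, g (X i j) = true ∧ f (X i j) = true ∧ f (X i (j + 3 ^ m)) = true ∧
      ∀ l < m, f (X i (j + 3 ^ l)) = false := by
  simp only [marksTest, readBit_pref _ hX, Bool.and_eq_true, decide_eq_true_eq, List.all_eq_true,
    List.mem_range, Bool.not_eq_true'] at h
  exact ⟨_, _, h.1.2, h.2.1.1.2, h.2.1.2.2, fun l hl => (h.2.2 l hl).2⟩

theorem marksTest_of_marks {y : ℕ → ℕ} {X : ℕ → ℕ → Fin n} (hX : ∀ i j, y (c i j) = X i j + 1)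
    {m i j : ℕ} (hg : g (X i j) = true) (hf : f (X i j) = true)
    (hm : f (X i (j + 3 ^ m)) = true) (hl : ∀ l < m, f (X i (j + 3 ^ l)) = false) :
    ∃ K, ∀ k ≥ K, marksTest c f g (pref y k) m (Nat.pair i j) = true := by
  obtain ⟨B, hB⟩ := (Set.finite_range fun l : Fin m => c i (j + 3 ^ (l : ℕ))).bddAbove
  refine ⟨max (c i j) (max (c i (j + 3 ^ m)) B) + 1, fun k hk => ?_⟩
  simp only [marksTest, readBit_pref _ hX, Bool.and_eq_true, decide_eq_true_eq, List.all_eq_true,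
    List.mem_range, Bool.not_eq_true', Nat.unpair_pair]
  refine ⟨⟨by lia, hg⟩, ⟨⟨by lia, hf⟩, by lia, hm⟩, fun l h => ⟨?_, hl l h⟩⟩
  have := hB ⟨⟨l, h⟩, rfl⟩
  dsimp only at this
  lia

/-- A sequence of bits is computable from an array whose marks determine it. -/
theorem baireLE_of_marks {P Q : Set (ℕ → ℕ)} (hc : Computable fun q : ℕ × ℕ => c q.1 q.2)
    (f z : Fin n → Bool)
    (h : ∀ y ∈ Q, ∃ (X : ℕ → ℕ → Fin n) (x : ℕ → Bool), (∀ i j, y (c i j) = X i j + 1) ∧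
      (∀ m i j, MarksLevel (fun i j => f (X i.toNat j.toNat) = true) m (i : ℕ) (j : ℕ) →
        z (X i j) = x m) ∧
      (∀ m, ∃ i j : ℕ, MarksLevel (fun i j => f (X i.toNat j.toNat) = true) m i j) ∧
      (fun m => (x m).toNat) ∈ P) : BaireLE P Q := by
  have hany (g : Fin n → Bool) : Computable fun q : List ℕ × ℕ =>
      (List.range q.1.length).any (marksTest c f g q.1 q.2) :=
    computable_list_any (p := fun q : List ℕ × ℕ => marksTest c f g q.1 q.2)
      (Primrec.list_range.to_comp.comp (Computable.list_length.comp Computable.fst))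
      (computable_marksTest hc f g).to₂
  have hψ : Computable fun q : List ℕ × ℕ =>
      cond ((List.range q.1.length).any (marksTest c f z q.1 q.2)) (some 1)
        (cond ((List.range q.1.length).any (marksTest c f (fun s => !z s) q.1 q.2)) (some 0) none) :=
    Computable.cond (hany _) (Computable.const _)
      (Computable.cond (hany _) (Computable.const _) (Computable.const _))
  refine baireLE_of_stage _ hψ.to₂ fun y hy => ?_
  obtain ⟨X, x, hX, hz, hm, hP⟩ := h y hy
  have cast (j l : ℕ) : ((j : ℤ) + 3 ^ l).toNat = j + 3 ^ l := by
    rw [← Int.toNat_natCast (j + 3 ^ l)]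
    push_cast
    rfl
  simp only [MarksLevel, Int.toNat_natCast, cast, Bool.not_eq_true] at hz hm
  refine ⟨_, hP, fun k m v hv => ?_, fun m => ?_⟩
  · rcases h1 : (List.range (pref y k).length).any (marksTest c f z (pref y k) m) with _ | _
    · rcases h2 : (List.range (pref y k).length).any
        (marksTest c f (fun s => !z s) (pref y k) m) with _ | _
      · simp [h1, h2] at hv
      · obtain ⟨q, -, hq⟩ := List.any_eq_true.1 h2
        obtain ⟨i, j, h3, h4⟩ := marks_of_marksTest hX hq
        have := hz m i j h4
        simp_all
    · obtain ⟨q, -, hq⟩ := List.any_eq_true.1 h1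
      obtain ⟨i, j, h3, h4⟩ := marks_of_marksTest hX hq
      have := hz m i j h4
      simp_all
  · obtain ⟨i, j, h1, h2, h3⟩ := hm m
    have key {g : Fin n → Bool} (hg : g (X i j) = true) : ∃ K, ∀ k ≥ K,
        (List.range (pref y k).length).any (marksTest c f g (pref y k) m) = true := by
      obtain ⟨K, hK⟩ := marksTest_of_marks hX hg h1 h2 h3
      refine ⟨max K (Nat.pair i j + 1), fun k hk => List.any_eq_true.2 ⟨Nat.pair i j, ?_, ?_⟩⟩
      · rw [List.mem_range, pref_length]
        lia
      · exact hK k (by lia)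
    rcases h4 : z (X i j) with _ | _
    · obtain ⟨K, hK⟩ := key (g := fun s => !z s) (by simp [h4])
      refine ⟨K, fun k hk => ?_⟩
      simp only [hK k hk]
      cases (List.range (pref y k).length).any (marksTest c f z (pref y k) m) <;> rfl
    · obtain ⟨K, hK⟩ := key h4
      refine ⟨K, fun k hk => ?_⟩
      simp only [hK k hk]
      rfl

end

theorem tilingSet_baireLE {G : Type*} [Group G] {c a k n : ℕ} {M : RowMachine (Fin c) (Fin a)}
    {u v : G} (huv : Commute u v) {e : Cell (RowMachine.Tile (Fin c) (Fin a)) ≃ Fin n}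
    {P : Set (ℕ → ℕ)}
    (hM : ∀ x : ℕ → Bool,
      (∀ l, M.reject (M.run (RowMachine.input x) l).1 = false) ↔ (fun n => (x n).toNat) ∈ P)
    {σ : Fin k → G} (hσ : IsSymmGen σ) :
    BaireLE P (mSet (pullback (cover σ) (tilingSet M.rules e u v))) := by
  obtain ⟨U, rfl⟩ := exists_wordVal_eq (τ := σ) (x := u) (by rw [hσ.1]; trivial)
  obtain ⟨V, rfl⟩ := exists_wordVal_eq (τ := σ) (x := v) (by rw [hσ.1]; trivial)
  refine baireLE_of_marks (c := fun i j => Encodable.encode (wordPow U i ++ wordPow V j))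
    (Computable.encode.comp (Computable.list_append.comp
      (computable_wordPow (Computable.const U) Computable.fst)
      (computable_wordPow (Computable.const V) Computable.snd)))
    (fun s => (e.symm s).F) (fun s => (e.symm s).Z) ?_
  rintro _ ⟨_, ⟨x, hx, rfl⟩, rfl⟩
  have hT := isTiling_of_mem_tilingSet huv hx
  obtain ⟨y, h1, h2, h3⟩ := hT.isHierarchy.exists_point hT.isBoardLayer
  have hmark (m i j : ℕ) : MarksLevel (fun i j : ℤ =>
      (e.symm (x (wordVal σ U ^ i.toNat * wordVal σ V ^ j.toNat))).F = true) m i j ↔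
      MarksLevel (fun i j : ℤ =>
        (e.symm (x (wordVal σ U ^ i * wordVal σ V ^ j))).F = true) m i j := by
    have cast (j l : ℕ) : (j : ℤ) + 3 ^ l = ((j + 3 ^ l : ℕ) : ℤ) := by push_cast; rfl
    simp only [MarksLevel, cast, zpow_natCast, Int.toNat_natCast]
  refine ⟨fun i j => x (wordVal σ U ^ i * wordVal σ V ^ j), y, fun i j => ?_, fun m i j h => ?_,
    fun m => ?_, ?_⟩
  · rw [confFun_of_isWordCode σ _ (isWordCode_encode _), decodeWord_encode, wordVal_append,
      wordVal_wordPow, wordVal_wordPow]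
  · rw [← h1 m i j ((hmark m i j).1 h), ← hT.Z_eq _ j]
    simp only [zpow_natCast]
  · obtain ⟨i, j, h⟩ := h2 m
    exact ⟨i, j, (hmark m i j).2 h⟩
  · exact (hM y).1 fun l => RowMachine.reject_eq_false h3 l

end MedvedevFormal

namespace MedvedevFormal

theorem IsPi01Deg.isSFTDeg {G : Type*} [Group G] {k : ℕ} {σ : Fin k → G} (hσ : IsSymmGen σ)
    (hvp : ∃ K : Subgroup G, K.FiniteIndex ∧ IsPolycyclic K)
    (hvc : ¬∃ K : Subgroup G, K.FiniteIndex ∧ IsCyclic K) {P : Set (ℕ → ℕ)} (h : IsPi01Deg P) :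
    IsSFTDeg σ P := by
  obtain ⟨Q, hQ, hne, hPQ⟩ := h
  obtain ⟨c, a, M, hM⟩ := exists_rowMachine_of_isPi01Cantor hQ
  obtain ⟨u, v, huv⟩ := exists_zSquared_of_not_virtuallyCyclic hvp hvc
  obtain ⟨κ, t, ht, hu, hv, hκ⟩ := exists_coordinates hσ hvp huv
  obtain ⟨n, ⟨e⟩⟩ := Finite.exists_equiv_fin (Cell (RowMachine.Tile (Fin c) (Fin a)))
  have hQc : Q ⊆ cantorSpace := by
    obtain ⟨f, -, rfl⟩ := hQ
    exact Set.sdiff_subset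
  have hle := baireLE_tilingSet (e := e) hQc hM ht hu hv hκ
  refine ⟨n, tilingSet M.rules e u v, isSFT_tilingSet, ?_,
    BaireEquiv.trans ⟨hle, tilingSet_baireLE huv.1 hM hσ⟩ hPQ.symm⟩
  obtain ⟨φ, -, -, hφ⟩ := hle
  obtain ⟨z, hz⟩ := hne
  obtain ⟨_, ⟨_, ⟨x, hx, -⟩, -⟩, -⟩ := hφ z hz
  exact ⟨x, hx⟩

/-- For a virtually polycyclic group `G`: if `G` is virtually cyclic then
`M_SFT(G) = {0_M}`, and otherwise `M_SFT(G)` is the set of all `Π⁰₁` Medvedev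
degrees. -/
theorem statement12 {G : Type*} [Group G] {k : ℕ} (σ : Fin k → G) (hσ : IsSymmGen σ)
    (hvp : ∃ K : Subgroup G, K.FiniteIndex ∧ IsPolycyclic ↥K) :
    ((∃ K : Subgroup G, K.FiniteIndex ∧ IsCyclic ↥K) →
      ∀ P : Set (ℕ → ℕ), IsSFTDeg σ P ↔ IsZeroDeg P) ∧
    (¬(∃ K : Subgroup G, K.FiniteIndex ∧ IsCyclic ↥K) →
      ∀ P : Set (ℕ → ℕ), IsSFTDeg σ P ↔ IsPi01Deg P) :=
  ⟨fun hvc P => isSFTDeg_iff_isZeroDeg σ hvc P,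
    fun hvc _ => ⟨fun h => h.isPi01Deg hσ hvp, fun h => h.isSFTDeg hσ hvp hvc⟩⟩

end MedvedevFormal
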